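/- Let N ≥ 2 be an integer, p, q ∈ ℂ with 0 < |p| < 1, 0 < |q| < 1, and let s₁, …, s_{N+1}, t₁, …, t_{N+1} ∈ ℂ with 0 < |s_m| < 1, 0 < |t_m| < 1 for all m, and (∏_{m=1}^{N+1} s_m)(∏_{m=1}^{N+1} t_m) = pq. Set S = ∏_{m=1}^{N+1} s_m and T = ∏_{m=1}^{N+1} t_m. Then ((p;p)_∞^{N−1}(q;q)_∞^{N−1}/N!) ∫_{𝕋^{N−1}} [∏_{j=1}^{N} ∏_{m=1}^{N+1} Γ(s_m z_j;p,q) Γ(t_m z_j^{−1};p,q)] / [∏_{1≤i<j≤N} Γ(z_i z_j^{−1};p,q) Γ(z_i^{−1} z_j;p,q)] ∏_{j=1}^{N−1} dz_j/(2πi z_j) = ∏_{m=1}^{N+1} Γ(S s_m^{−1};p,q) Γ(T t_m^{−1};p,q) · ∏_{k=1}^{N+1} ∏_{m=1}^{N+1} Γ(s_k t_m;p,q), where z_N = (z₁⋯z_{N−1})^{−1}. This is the type I elliptic beta integral on the root system A_{N−1}, expressing the s-confinement of SU(N) SQCD with N+1 flavors. -/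

import Mathlib

open scoped BigOperators

/-- The infinite q-Pochhammer symbol `(x;p)_∞ = ∏_{j≥0} (1 - x p^j)`. -/
noncomputable def pochInf (x p : ℂ) : ℂ := ∏' j : ℕ, (1 - x * p ^ j)

/-- The elliptic gamma function `Γ(z;p,q)`. -/
noncomputable def ellGamma (z p q : ℂ) : ℂ :=
  ∏' jk : ℕ × ℕ, (1 - z⁻¹ * p ^ (jk.1 + 1) * q ^ (jk.2 + 1)) / (1 - z * p ^ jk.1 * q ^ jk.2)

/-- The contour integral `(2πi)⁻¹ ∮_{𝕋} f(z) dz/z` over the positively oriented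
unit circle. -/
noncomputable def circleInt (f : ℂ → ℂ) : ℂ :=
  (2 * (Real.pi : ℂ) * Complex.I)⁻¹ * ∮ z in C(0, 1), f z / z

/-- The iterated contour integral `∫_{𝕋^n} f ∏_{j=1}^n dz_j/(2πi z_j)`. -/
noncomputable def torusInt : (n : ℕ) → ((Fin n → ℂ) → ℂ) → ℂ
  | 0, f => f Fin.elim0
  | n + 1, f => circleInt fun z => torusInt n fun w => f (Fin.cons z w)

/-- Extension of `N-1` integration variables `z₁,…,z_{N-1}` to `N` variables
with `z_N = (z₁⋯z_{N-1})⁻¹`, so that `z₁⋯z_N = 1`. -/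
noncomputable def zfull (N : ℕ) (z : Fin (N - 1) → ℂ) : Fin N → ℂ :=
  fun i => if h : (i : ℕ) < N - 1 then z ⟨i, h⟩ else (∏ j, z j)⁻¹

/-- A nonzero complex number in the unit disc. -/
class Nome (p : ℂ) : Prop where
  ne : p ≠ 0
  lt : ‖p‖ < 1

/-- generic product. -/
noncomputable def gprod {ι : Type*} (a : ι → ℂ) (x : ℂ) : ℂ := ∏' i, (1 - x * a i)

lemma gprod_multipliable {ι : Type*} {a : ι → ℂ} (ha : Summable fun i => ‖a i‖) (x : ℂ) :
    Multipliable fun i => (1 - x * a i) := by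
  have : Multipliable fun i => (1 + (-x * a i)) := by
    apply multipliable_one_add_of_summable
    simpa [norm_mul] using ha.mul_left ‖x‖
  simpa [sub_eq_add_neg] using this

lemma gprod_ne {ι : Type*} {a : ι → ℂ} (ha : Summable fun i => ‖a i‖) {x : ℂ}
    (h : ∀ i, 1 - x * a i ≠ 0) : gprod a x ≠ 0 := by
  have : ∏' i, (1 + (-x * a i)) ≠ 0 := by
    apply tprod_one_add_ne_zero_of_summable
    · intro i; simpa [sub_eq_add_neg] using h i
    · simpa [norm_mul] using ha.mul_left ‖x‖
  simpa [gprod, sub_eq_add_neg] using this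

lemma gprod_ne_of_norm {ι : Type*} {a : ι → ℂ} (ha : Summable fun i => ‖a i‖) (ha1 : ∀ i, ‖a i‖ ≤ 1)
    {x : ℂ} (hx : ‖x‖ < 1) : gprod a x ≠ 0 := by
  apply gprod_ne ha
  intro i h
  have h1 : x * a i = 1 := by linear_combination -h
  have h2 : ‖x‖ * ‖a i‖ = 1 := by rw [← norm_mul, h1]; simp
  nlinarith [ha1 i, norm_nonneg x, norm_nonneg (a i)]

lemma gprod_zero {ι : Type*} {a : ι → ℂ} {x : ℂ} (h : ∃ i, 1 - x * a i = 0) : gprod a x = 0 :=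
  (hasProd_zero_of_exists_eq_zero h).tprod_eq

lemma gprod_differentiable {ι : Type*} {a : ι → ℂ} (ha : Summable fun i => ‖a i‖) :
    Differentiable ℂ (gprod a) := by
  intro x
  have h1 : HasProdLocallyUniformlyOn (fun i (x : ℂ) => 1 + (-x * a i))
      (fun x => ∏' i, (1 + (-x * a i))) (Metric.ball 0 (‖x‖ + 1)) := by
    apply Summable.hasProdLocallyUniformlyOn_one_add Metric.isOpen_ball (ha.mul_left (‖x‖ + 1))
    · refine Filter.Eventually.of_forall fun i y hy => ?_
      rw [norm_mul, norm_neg]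
      gcongr
      exact (mem_ball_zero_iff.1 hy).le
    · intro i; fun_prop
  have h2 : DifferentiableOn ℂ (fun x => ∏' i, (1 + (-x * a i))) (Metric.ball 0 (‖x‖ + 1)) := by
    apply TendstoLocallyUniformlyOn.differentiableOn h1 ?_ Metric.isOpen_ball
    refine Filter.Eventually.of_forall fun s => ?_
    simp only [DifferentiableOn]
    intro y hy
    apply DifferentiableAt.differentiableWithinAt
    fun_prop
  have h3 : gprod a = (fun x => ∏' i, (1 + (-x * a i))) := by
    ext y; simp [gprod, sub_eq_add_neg]
  rw [h3]
  exact h2.differentiableAt (Metric.isOpen_ball.mem_nhds (by simp))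

set_option linter.unusedSectionVars false
set_option linter.unusedVariables false

section
variable {p q : ℂ} [hp : Nome p] [hq : Nome q]

lemma Nome.norm_pos (p : ℂ) [hp : Nome p] : 0 < ‖p‖ := norm_pos_iff.2 hp.ne

lemma summ_pow (p : ℂ) [hp : Nome p] : Summable fun j : ℕ => ‖p ^ j‖ := by
  simp only [norm_pow]
  exact summable_geometric_of_lt_one (norm_nonneg _) hp.lt

lemma summ_pow2 (p q : ℂ) [hp : Nome p] [hq : Nome q] :
    Summable fun j : ℕ × ℕ => ‖p ^ j.1 * q ^ j.2‖ := by
  simp only [norm_mul]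
  exact (summ_pow p).mul_of_nonneg (summ_pow q) (fun _ => norm_nonneg _) (fun _ => norm_nonneg _)

lemma pochInf_eq (x p : ℂ) : pochInf x p = gprod (fun j : ℕ => p ^ j) x := rfl

/-- double product -/
noncomputable def Eg (p q x : ℂ) : ℂ := gprod (fun j : ℕ × ℕ => p ^ j.1 * q ^ j.2) x

lemma pochInf_ne {x : ℂ} (hx : ‖x‖ < 1) : pochInf x p ≠ 0 :=
  gprod_ne_of_norm (summ_pow p) (fun i => by
    rw [norm_pow]; exact pow_le_one₀ (norm_nonneg _) hp.lt.le) hx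

lemma Eg_ne {x : ℂ} (hx : ‖x‖ < 1) : Eg p q x ≠ 0 :=
  gprod_ne_of_norm (summ_pow2 p q) (fun i => by
    rw [norm_mul, norm_pow, norm_pow]
    exact mul_le_one₀ (pow_le_one₀ (norm_nonneg _) hp.lt.le) (by positivity)
      (pow_le_one₀ (norm_nonneg _) hq.lt.le)) hx

lemma pochInf_differentiable : Differentiable ℂ fun x => pochInf x p :=
  gprod_differentiable (summ_pow p)

lemma Eg_differentiable : Differentiable ℂ fun x => Eg p q x :=
  gprod_differentiable (summ_pow2 p q)

lemma pochInf_rec (x : ℂ) : pochInf x p = (1 - x) * pochInf (p * x) p := by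
  have h := (gprod_multipliable (summ_pow p) (p * x)).hasProd
  have h2 : HasProd (fun n : ℕ => (1 - x * p ^ (n + 1))) (pochInf (p * x) p) := by
    have h' : (fun n : ℕ => (1 - x * p ^ (n + 1))) = fun n : ℕ => (1 - p * x * p ^ n) := by
      ext n; ring
    rw [h']; exact h
  have := h2.zero_mul (f := fun n : ℕ => (1 - x * p ^ n))
  rw [pochInf, this.tprod_eq]
  simp

lemma Eg_symm (x : ℂ) : Eg p q x = Eg q p x := by
  rw [Eg, Eg, gprod, gprod, ← (Equiv.prodComm ℕ ℕ).tprod_eq]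
  congr 1
  ext j
  simp [mul_comm]

lemma Eg_rec (x : ℂ) : Eg p q x = pochInf x p * Eg p q (q * x) := by
  have key : ∀ y, HasProd (fun k : ℕ => pochInf (y * q ^ k) p) (Eg p q y) := by
    intro y
    have h := (gprod_multipliable (summ_pow2 q p) y).hasProd
    have h3 : ∏' i : ℕ × ℕ, (1 - y * (q ^ i.1 * p ^ i.2)) = Eg p q y := by
      rw [Eg_symm]; rfl
    rw [h3] at h
    refine HasProd.prod_fiberwise h ?_
    intro k
    have := (gprod_multipliable (summ_pow p) (y * q ^ k)).hasProd
    have h' : (fun n : ℕ => (1 - y * (q ^ k * p ^ n))) = fun n : ℕ => (1 - y * q ^ k * p ^ n) := by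
      ext n; ring
    exact h' ▸ this
  have h := key (q * x)
  have h2 : HasProd (fun n : ℕ => pochInf (x * q ^ (n + 1)) p) (Eg p q (q * x)) := by
    convert h using 3
    ring
  have := h2.zero_mul (f := fun n : ℕ => pochInf (x * q ^ n) p)
  rw [HasProd.unique (key x) this]
  simp

lemma Eg_rec' (x : ℂ) : Eg p q x = pochInf x q * Eg p q (p * x) := by
  rw [Eg_symm, Eg_rec, Eg_symm]

lemma ellGamma_eq (x : ℂ) : ellGamma x p q = Eg p q (p * q / x) / Eg p q x := by
  rw [ellGamma]
  by_cases h0 : ∃ i : ℕ × ℕ, 1 - x * (p ^ i.1 * q ^ i.2) = 0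
  · rw [show Eg p q x = 0 from gprod_zero h0, div_zero]
    obtain ⟨i, hi⟩ := h0
    refine (hasProd_zero_of_exists_eq_zero ⟨i, ?_⟩).tprod_eq
    rw [show 1 - x * p ^ i.1 * q ^ i.2 = 0 by rw [← hi]; ring]
    simp
  · push Not at h0
    have hne : Eg p q x ≠ 0 := gprod_ne (summ_pow2 p q) h0
    have h1 := (gprod_multipliable (summ_pow2 p q) x).hasProd
    have h2 := (gprod_multipliable (summ_pow2 p q) (p * q / x)).hasProd
    have h3 := Filter.Tendsto.div h2 h1 hne
    refine HasProd.tprod_eq ?_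
    refine Filter.Tendsto.congr (fun s => ?_) h3
    simp only [Pi.div_apply]
    rw [← Finset.prod_div_distrib]
    refine Finset.prod_congr rfl fun i _ => ?_
    rw [div_eq_mul_inv (p * q) x]
    ring_nf

lemma ellGamma_symm (x : ℂ) : ellGamma x p q = ellGamma x q p := by
  rw [ellGamma_eq, ellGamma_eq, Eg_symm x, Eg_symm (p * q / x), mul_comm p q]

/-- theta function -/
noncomputable def th (p x : ℂ) : ℂ := pochInf x p * pochInf (p / x) p
/-- theta function without the zero at one -/
noncomputable def th1 (p x : ℂ) : ℂ := pochInf (p * x) p * pochInf (p / x) p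
/-- gamma function without the pole at one -/
noncomputable def Gs (p q x : ℂ) : ℂ := Eg p q (p * q / x) / (pochInf (p * x) p * Eg p q (q * x))

lemma th_eq (x : ℂ) : th p x = (1 - x) * th1 p x := by
  rw [th, th1, pochInf_rec]; ring

lemma th1_inv (x : ℂ) : th1 p x⁻¹ = th1 p x := by
  rw [th1, th1, div_inv_eq_mul, div_eq_mul_inv]; ring

lemma th_inv {x : ℂ} (hx : x ≠ 0) : th p x⁻¹ = - th p x / x := by
  rw [th_eq, th_eq, th1_inv]; field_simp; ring

lemma th_pdiv {x : ℂ} (hx : x ≠ 0) : th p (p / x) = th p x := by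
  rw [th, th, div_div_cancel₀ hp.ne, mul_comm]

lemma th_pmul {x : ℂ} (hx : x ≠ 0) : th p (p * x) = - th p x / x := by
  rw [← th_inv hx, ← th_pdiv (inv_ne_zero hx), div_inv_eq_mul]

lemma th_one : th p 1 = 0 := by rw [th_eq]; simp

lemma th_ne {x : ℂ} (hx : ‖p‖ < ‖x‖) (hx1 : ‖x‖ < 1) : th p x ≠ 0 := by
  apply mul_ne_zero (pochInf_ne hx1) (pochInf_ne _)
  rw [norm_div, div_lt_one (by linarith [norm_nonneg p])]; exact hx

lemma th1_ne {x : ℂ} (hx : ‖p‖ < ‖x‖) (hx1 : ‖p‖ * ‖x‖ < 1) : th1 p x ≠ 0 := by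
  apply mul_ne_zero (pochInf_ne (by rwa [norm_mul])) (pochInf_ne _)
  rw [norm_div, div_lt_one (by linarith [norm_nonneg p])]; exact hx

lemma ellGamma_q {x : ℂ} (hx : x ≠ 0) (hx1 : ‖x‖ < 1) :
    ellGamma (q * x) p q = th p x * ellGamma x p q := by
  have h1 : pochInf x p ≠ 0 := pochInf_ne hx1
  have h2 : Eg p q (q * x) ≠ 0 := Eg_ne (by
    rw [norm_mul]; nlinarith [hq.lt, norm_nonneg q, norm_nonneg x])
  have h3 : p * q / (q * x) = p / x := by have := hq.ne; field_simp
  rw [ellGamma_eq, ellGamma_eq, Eg_rec x, h3, Eg_rec (p / x), th,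
    show q * (p / x) = p * q / x by ring]
  field_simp

lemma ellGamma_refl {x : ℂ} (hx : x ≠ 0) (hx1 : ‖x‖ < 1) (hx2 : ‖p * q / x‖ < 1) :
    ellGamma x p q * ellGamma (p * q / x) p q = 1 := by
  have h1 : Eg p q x ≠ 0 := Eg_ne hx1
  have h2 : Eg p q (p * q / x) ≠ 0 := Eg_ne hx2
  have := hp.ne
  have := hq.ne
  rw [ellGamma_eq, ellGamma_eq, show p * q / (p * q / x) = x by field_simp]
  field_simp

lemma ellGamma_ne {x : ℂ} (hx1 : ‖x‖ < 1) (hx2 : ‖p * q / x‖ < 1) :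
    ellGamma x p q ≠ 0 := by
  rw [ellGamma_eq]
  exact div_ne_zero (Eg_ne hx2) (Eg_ne hx1)

lemma ellGamma_Gs (x : ℂ) : ellGamma x p q = Gs p q x / (1 - x) := by
  rw [ellGamma_eq, Gs, Eg_rec x, pochInf_rec x, div_div]
  ring

lemma Gs_one : Gs p q 1 = (pochInf p p * pochInf q q)⁻¹ := by
  have h1 : pochInf p p ≠ 0 := pochInf_ne hp.lt
  have h2 : pochInf q q ≠ 0 := pochInf_ne hq.lt
  have h3 : Eg p q (p * q) ≠ 0 := Eg_ne (by
    rw [norm_mul]; nlinarith [hp.lt, hq.lt, norm_nonneg q, norm_nonneg p])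
  rw [Gs, mul_one, mul_one, div_one, Eg_rec' q]
  field_simp

lemma Gs_refl {x : ℂ} (hx : x ≠ 0) (h1 : ‖p * x‖ < 1) (h2 : ‖q * x‖ < 1) (h3 : ‖p / x‖ < 1)
    (h4 : ‖q / x‖ < 1) : Gs p q x * Gs p q x⁻¹ * (th1 p x * th1 q x) = 1 := by
  have a1 : pochInf (p * x) p ≠ 0 := pochInf_ne h1
  have a2 : pochInf (q * x) q ≠ 0 := pochInf_ne h2
  have a3 : pochInf (p / x) p ≠ 0 := pochInf_ne h3
  have a4 : pochInf (q / x) q ≠ 0 := pochInf_ne h4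
  have a5 : Eg p q (p * (q * x)) ≠ 0 := Eg_ne (by
    rw [norm_mul]; nlinarith [hp.lt, norm_nonneg p, norm_nonneg (q * x)])
  have a6 : Eg p q (p * (q / x)) ≠ 0 := Eg_ne (by
    rw [norm_mul]; nlinarith [hp.lt, norm_nonneg p, norm_nonneg (q / x)])
  rw [Gs, Gs, th1, th1, Eg_rec' (q * x), Eg_rec' (q * x⁻¹), div_inv_eq_mul, ← div_eq_mul_inv,
    ← div_eq_mul_inv, mul_assoc p q x, mul_div_assoc p q x]
  generalize Eg p q (p * (q * x)) = A at *
  generalize Eg p q (p * (q / x)) = B at *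
  generalize pochInf (p * x) p = A1 at *
  generalize pochInf (q * x) q = A2 at *
  generalize pochInf (p / x) p = A3 at *
  generalize pochInf (q / x) q = A4 at *
  field_simp

lemma v_eq {x : ℂ} (hx : ‖x‖ = 1) :
    (ellGamma x p q * ellGamma x⁻¹ p q)⁻¹ = th p x * th q x⁻¹ := by
  have hx0 : x ≠ 0 := by rw [← norm_pos_iff, hx]; norm_num
  have h := Gs_refl (p := p) (q := q) hx0 (by rw [norm_mul, hx, mul_one]; exact hp.lt)
    (by rw [norm_mul, hx, mul_one]; exact hq.lt)
    (by rw [norm_div, hx, div_one]; exact hp.lt) (by rw [norm_div, hx, div_one]; exact hq.lt)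
  rw [ellGamma_Gs, ellGamma_Gs, th_eq, th_eq, th1_inv]
  have h' : Gs p q x * Gs p q x⁻¹ = (th1 p x * th1 q x)⁻¹ := eq_inv_of_mul_eq_one_left h
  rw [div_mul_div_comm, h', inv_div, div_inv_eq_mul]
  ring

lemma th_differentiableAt' {x : ℂ} (h0 : x ≠ 0) : DifferentiableAt ℂ (th p) x := by
  have h1 : DifferentiableAt ℂ (fun z => pochInf z p) x := pochInf_differentiable (p := p) x
  have h2 : DifferentiableAt ℂ (fun z => pochInf (p / z) p) x :=
    (pochInf_differentiable (p := p) (p / x)).comp x (by fun_prop (disch := assumption))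
  exact h1.mul h2

lemma th1_differentiableAt' {x : ℂ} (h0 : x ≠ 0) : DifferentiableAt ℂ (th1 p) x := by
  have h1 : DifferentiableAt ℂ (fun z => pochInf (p * z) p) x :=
    (pochInf_differentiable (p := p) (p * x)).comp x (by fun_prop)
  have h2 : DifferentiableAt ℂ (fun z => pochInf (p / z) p) x :=
    (pochInf_differentiable (p := p) (p / x)).comp x (by fun_prop (disch := assumption))
  exact h1.mul h2

lemma ellGamma_differentiableAt' {x : ℂ} (h0 : x ≠ 0) (h1 : ‖x‖ < 1) :
    DifferentiableAt ℂ (fun z => ellGamma z p q) x := by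
  simp only [ellGamma_eq]
  have h3 : DifferentiableAt ℂ (fun z => Eg p q z) x := Eg_differentiable (p := p) (q := q) x
  have h2 : DifferentiableAt ℂ (fun z => Eg p q (p * q / z)) x :=
    (Eg_differentiable (p := p) (q := q) (p * q / x)).comp x (by fun_prop (disch := assumption))
  exact h2.fun_div h3 (Eg_ne h1)

lemma Gs_differentiableAt' {x : ℂ} (h0 : x ≠ 0) (h1 : ‖p * x‖ < 1) (h2 : ‖q * x‖ < 1) :
    DifferentiableAt ℂ (Gs p q) x := by
  have h3 : DifferentiableAt ℂ (fun z => Eg p q (q * z)) x :=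
    (Eg_differentiable (p := p) (q := q) (q * x)).comp x (by fun_prop)
  have h4 : DifferentiableAt ℂ (fun z => pochInf (p * z) p) x :=
    (pochInf_differentiable (p := p) (p * x)).comp x (by fun_prop)
  have h5 : DifferentiableAt ℂ (fun z => Eg p q (p * q / z)) x :=
    (Eg_differentiable (p := p) (q := q) (p * q / x)).comp x (by fun_prop (disch := assumption))
  exact h5.fun_div (h4.mul h3) (mul_ne_zero (pochInf_ne h1) (Eg_ne h2))

variable {V : Type*} [NormedAddCommGroup V] [NormedSpace ℂ V] {f : V → ℂ} {z : V}

lemma th_differentiableAt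
    (hf : DifferentiableAt ℂ f z) (h0 : f z ≠ 0) : DifferentiableAt ℂ (fun z => th p (f z)) z :=
  (th_differentiableAt' h0).comp z hf

lemma th1_differentiableAt
    (hf : DifferentiableAt ℂ f z) (h0 : f z ≠ 0) : DifferentiableAt ℂ (fun z => th1 p (f z)) z :=
  (th1_differentiableAt' h0).comp z hf

lemma ellGamma_differentiableAt (hf : DifferentiableAt ℂ f z) (h0 : f z ≠ 0) (h1 : ‖f z‖ < 1) :
    DifferentiableAt ℂ (fun z => ellGamma (f z) p q) z :=
  (ellGamma_differentiableAt' h0 h1).comp z hf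

lemma Gs_differentiableAt (hf : DifferentiableAt ℂ f z) (h0 : f z ≠ 0) (h1 : ‖p * f z‖ < 1)
    (h2 : ‖q * f z‖ < 1) : DifferentiableAt ℂ (fun z => Gs p q (f z)) z :=
  (Gs_differentiableAt' h0 h1 h2).comp z hf

end

open MeasureTheory

instance unitAddCircle_prob : IsProbabilityMeasure (volume : Measure UnitAddCircle) :=
  ⟨UnitAddCircle.measure_univ⟩

/-- the exponential on the additive circle -/
noncomputable def ee (x : UnitAddCircle) : ℂ := (AddCircle.toCircle x : ℂ)

@[fun_prop] lemma ee_continuous : Continuous ee :=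
  continuous_subtype_val.comp AddCircle.continuous_toCircle

@[simp] lemma norm_ee (x : UnitAddCircle) : ‖ee x‖ = 1 := Circle.norm_coe _

@[simp] lemma ee_ne (x : UnitAddCircle) : ee x ≠ 0 := Circle.coe_ne_zero _

lemma ee_add (x y : UnitAddCircle) : ee (x + y) = ee x * ee y := by
  simp [ee, AddCircle.toCircle_add]

lemma ee_neg (x : UnitAddCircle) : ee (-x) = (ee x)⁻¹ := by
  simp [ee, AddCircle.toCircle_neg]

lemma ee_zero : ee 0 = 1 := by simp [ee]

lemma ee_sub (x y : UnitAddCircle) : ee (x - y) = ee x / ee y := by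
  rw [sub_eq_add_neg, ee_add, ee_neg, div_eq_mul_inv]

lemma ee_sum {ι : Type*} (s : Finset ι) (x : ι → UnitAddCircle) :
    ee (∑ i ∈ s, x i) = ∏ i ∈ s, ee (x i) := by
  induction s using Finset.cons_induction with
  | empty => simp [ee_zero]
  | cons a s ha ih => rw [Finset.sum_cons, Finset.prod_cons, ee_add, ih]

lemma ee_injective : Function.Injective ee := by
  intro x y h
  exact AddCircle.injective_toCircle one_ne_zero (Subtype.ext h)

lemma ee_surj {z : ℂ} (hz : ‖z‖ = 1) : ∃ x, ee x = z := by
  obtain ⟨t, ht⟩ := (Complex.norm_eq_one_iff z).1 hz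
  refine ⟨((t / (2 * Real.pi) : ℝ) : UnitAddCircle), ?_⟩
  rw [ee, AddCircle.toCircle_apply_mk, Circle.coe_exp, ← ht]
  congr 2
  have : Real.pi ≠ 0 := Real.pi_ne_zero
  push_cast
  field_simp

lemma ee_mk (x : ℝ) : ee (x : UnitAddCircle) = Complex.exp (((2 * Real.pi * x : ℝ) : ℂ) * Complex.I) := by
  rw [ee, AddCircle.toCircle_apply_mk, Circle.coe_exp, div_one]

lemma circle_int_eq {r : ℝ} (hr : 0 < r) (F : ℂ → ℂ) :
    (2 * (Real.pi : ℂ) * Complex.I)⁻¹ * ∮ z in C(0, r), F z / z = ∫ x : UnitAddCircle, F (r * ee x) := by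
  have h1 : (∮ z in C(0, r), F z / z) =
      ∫ θ in (0:ℝ)..2 * Real.pi, Complex.I * F (r * Complex.exp (θ * Complex.I)) := by
    rw [circleIntegral]
    congr 1
    ext θ
    have : (r : ℂ) ≠ 0 := by exact_mod_cast hr.ne'
    simp only [deriv_circleMap, circleMap, zero_add, smul_eq_mul]
    field_simp
  have h2 : (∫ θ in (0:ℝ)..2 * Real.pi, Complex.I * F (r * Complex.exp (θ * Complex.I))) =
      (2 * Real.pi) • ∫ x in (0:ℝ)..1, Complex.I * F (r * ee (x : UnitAddCircle)) := by
    have := intervalIntegral.smul_integral_comp_mul_left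
      (f := fun θ : ℝ => Complex.I * F (r * Complex.exp (θ * Complex.I))) (a := 0) (b := 1)
      (2 * Real.pi)
    rw [mul_zero, mul_one] at this
    rw [← this]
    simp only [ee_mk]
  have h3 := UnitAddCircle.intervalIntegral_preimage 0
    (fun x : UnitAddCircle => Complex.I * F (r * ee x))
  rw [zero_add] at h3
  rw [h1, h2, h3, integral_const_mul, Complex.real_smul]
  have : (Real.pi : ℂ) ≠ 0 := by exact_mod_cast Real.pi_ne_zero
  push_cast
  field_simp

lemma circleInt_eq (F : ℂ → ℂ) : circleInt F = ∫ x : UnitAddCircle, F (ee x) := by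
  have := circle_int_eq one_pos F
  simpa [circleInt] using this

/-- mean over a circle with complex radius is rotation invariant -/
lemma mean_rot (r u : ℂ) (hu : ‖u‖ = 1) (F : ℂ → ℂ) :
    ∫ x : UnitAddCircle, F (r * u * ee x) = ∫ x : UnitAddCircle, F (r * ee x) := by
  obtain ⟨y, rfl⟩ := ee_surj hu
  have := integral_add_left_eq_self (μ := (volume : Measure UnitAddCircle))
    (fun x => F (r * ee x)) y
  rw [← this]
  simp only [ee_add, mul_assoc]

lemma mean_abs (r : ℂ) (F : ℂ → ℂ) :
    ∫ x : UnitAddCircle, F (r * ee x) = ∫ x : UnitAddCircle, F ((‖r‖ : ℝ) * ee x) := by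
  by_cases hr : r = 0
  · simp [hr]
  have hr' : (‖r‖ : ℂ) ≠ 0 := by exact_mod_cast norm_ne_zero_iff.2 hr
  rw [← mean_rot (‖r‖ : ℂ) (r / ‖r‖) _ F]
  · congr 1; ext x; congr 2; field_simp
  · rw [norm_div, Complex.norm_real, norm_norm, div_self (norm_ne_zero_iff.2 hr)]

lemma contour_A1 {r R : ℂ} (hr : r ≠ 0) (hrR : ‖r‖ ≤ ‖R‖) {F : ℂ → ℂ}
    (hF : ∀ w, ‖r‖ ≤ ‖w‖ → ‖w‖ ≤ ‖R‖ → DifferentiableAt ℂ F w) :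
    ∫ x : UnitAddCircle, F (r * ee x) = ∫ x : UnitAddCircle, F (R * ee x) := by
  have hr0 : 0 < ‖r‖ := norm_pos_iff.2 hr
  rw [mean_abs r, mean_abs R, ← circle_int_eq hr0, ← circle_int_eq (hr0.trans_le hrR)]
  have := Complex.circleIntegral_sub_center_inv_smul_eq_of_differentiable_on_annulus_off_countable
    (c := 0) hr0 hrR (f := F) (s := ∅) Set.countable_empty ?_ ?_
  · simp only [sub_zero, smul_eq_mul] at this
    simp only [div_eq_inv_mul]
    rw [this]
  · intro w hw
    simp at hw
    exact (hF w hw.2 hw.1).continuousAt.continuousWithinAt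
  · intro w hw
    simp at hw
    exact hF w hw.2.le hw.1.le

lemma contour_center {r : ℂ} (hr : r ≠ 0) {F : ℂ → ℂ}
    (hF : ∀ w, ‖w‖ ≤ ‖r‖ → DifferentiableAt ℂ F w) :
    ∫ x : UnitAddCircle, F (r * ee x) = F 0 := by
  have hr0 : 0 < ‖r‖ := norm_pos_iff.2 hr
  rw [mean_abs r, ← circle_int_eq hr0]
  have := Complex.circleIntegral_sub_center_inv_smul_of_differentiable_on_off_countable
    (c := 0) hr0 (f := F) (s := ∅) Set.countable_empty ?_ ?_
  · simp only [sub_zero, smul_eq_mul] at this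
    simp only [div_eq_inv_mul]
    rw [this]
    have : (Real.pi : ℂ) ≠ 0 := by exact_mod_cast Real.pi_ne_zero
    field_simp
  · intro w hw
    simp at hw
    exact (hF w hw).continuousAt.continuousWithinAt
  · intro w hw
    simp at hw
    exact hF w hw.le

lemma one_sub_ne {z : ℂ} (h : ‖z‖ ≠ 1) : 1 - z ≠ 0 := by
  intro h'
  apply h
  rw [← sub_eq_zero.1 h']; simp

lemma mean_pole_in {r x : ℂ} (hr : r ≠ 0) (h : ‖r‖ < ‖x‖) :
    ∫ y : UnitAddCircle, (1 - r * ee y / x)⁻¹ = 1 := by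
  rw [contour_center hr (F := fun w => (1 - w / x)⁻¹)]
  · simp
  · intro w hw
    have hx : 0 < ‖x‖ := (norm_nonneg r).trans_lt h
    have : 1 - w / x ≠ 0 := one_sub_ne (by
      rw [norm_div]; exact ((div_lt_one hx).2 (hw.trans_lt h)).ne)
    fun_prop (disch := assumption)

lemma mean_pole_out {R x : ℂ} (hx : x ≠ 0) (h : ‖x‖ < ‖R‖) :
    ∫ y : UnitAddCircle, (1 - R * ee y / x)⁻¹ = 0 := by
  have hR : 0 < ‖R‖ := (norm_nonneg x).trans_lt h
  have hR0 : R ≠ 0 := norm_pos_iff.1 hR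
  have h1 := mean_pole_in (r := x) (x := R) hx h
  rw [← integral_neg_eq_self] at h1
  have h2 : ∀ y : UnitAddCircle, (1 - R * ee y / x)⁻¹ = 1 - (1 - x * ee (-y) / R)⁻¹ := by
    intro y
    have a1 : 1 - R * ee y / x ≠ 0 := one_sub_ne (by
      simp; exact ((one_lt_div (norm_pos_iff.2 hx)).2 h).ne')
    have a2 : 1 - x * ee (-y) / R ≠ 0 := one_sub_ne (by
      simp; exact ((div_lt_one hR).2 h).ne)
    rw [ee_neg] at *
    have := ee_ne y
    have a3 : x - R * ee y ≠ 0 := by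
      intro h; apply a1; field_simp; simpa using h
    have a4 : R * ee y - x ≠ 0 := by
      intro h; apply a3; linear_combination -h
    rw [show 1 - R * ee y / x = (x - R * ee y) / x by field_simp,
      show 1 - x * (ee y)⁻¹ / R = (R * ee y - x) / (R * ee y) by field_simp]
    rw [inv_div, inv_div, eq_sub_iff_add_eq, div_add_div _ _ a3 a4, div_eq_one_iff_eq (mul_ne_zero a3 a4)]
    ring
  simp_rw [h2]
  rw [integral_sub (by simp) , h1]
  · simp [Measure.real]
  · apply Integrable.of_bound (C := (1 - ‖x‖ / ‖R‖)⁻¹)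
    · apply Continuous.aestronglyMeasurable
      apply Continuous.inv₀ (by fun_prop)
      intro y
      exact one_sub_ne (by simp; exact ((div_lt_one hR).2 h).ne)
    · refine Filter.Eventually.of_forall fun y => ?_
      rw [norm_inv]
      apply inv_anti₀
      · rw [sub_pos, div_lt_one hR]; exact h
      · have := norm_sub_norm_le 1 (x * ee (-y) / R)
        simpa using this

lemma cont_mean_integrable {F : UnitAddCircle → ℂ} (hF : Continuous F) : Integrable F :=
  hF.integrable_of_hasCompactSupport (HasCompactSupport.of_compactSpace F)

lemma contour_A2 {r R x : ℂ} (hr : r ≠ 0) (h1 : ‖r‖ < ‖x‖) (h2 : ‖x‖ < ‖R‖) {g : ℂ → ℂ}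
    (hg : ∀ w, ‖r‖ ≤ ‖w‖ → ‖w‖ ≤ ‖R‖ → DifferentiableAt ℂ g w) :
    ∫ y : UnitAddCircle, g (r * ee y) * (1 - r * ee y / x)⁻¹ =
      g x + ∫ y : UnitAddCircle, g (R * ee y) * (1 - R * ee y / x)⁻¹ := by
  have hx0 : x ≠ 0 := norm_pos_iff.1 ((norm_nonneg r).trans_lt h1)
  have hd : ∀ w, ‖r‖ ≤ ‖w‖ → ‖w‖ ≤ ‖R‖ → DifferentiableAt ℂ (dslope g x) w := by
    intro w hw1 hw2
    by_cases hwx : w = x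
    · subst hwx
      set s : Set ℂ := {w | ‖r‖ < ‖w‖ ∧ ‖w‖ < ‖R‖} with hs
      have hso : IsOpen s := (isOpen_lt continuous_const continuous_norm).inter
        (isOpen_lt continuous_norm continuous_const)
      have hsn : s ∈ nhds w := hso.mem_nhds ⟨h1, h2⟩
      have := (Complex.differentiableOn_dslope hsn (f := g)).2
        (fun y hy => (hg y hy.1.le hy.2.le).differentiableWithinAt)
      exact this.differentiableAt hsn
    · exact (differentiableAt_dslope_of_ne hwx).2 (hg w hw1 hw2)
  have key := contour_A1 hr (h1.trans h2).le hd
  have gen : ∀ ρ : ℂ, ‖r‖ ≤ ‖ρ‖ → ‖ρ‖ ≤ ‖R‖ → ‖ρ‖ ≠ ‖x‖ →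
      ∫ y : UnitAddCircle, g (ρ * ee y) * (1 - ρ * ee y / x)⁻¹ =
        g x * (∫ y : UnitAddCircle, (1 - ρ * ee y / x)⁻¹) -
          x * ∫ y : UnitAddCircle, dslope g x (ρ * ee y) := by
    intro ρ ha hb hc
    have hne : ∀ y, 1 - ρ * ee y / x ≠ 0 := by
      intro y; apply one_sub_ne
      simp only [norm_div, norm_mul, norm_ee, mul_one]
      intro h; apply hc
      rwa [div_eq_one_iff_eq (norm_ne_zero_iff.2 hx0)] at h
    rw [← integral_const_mul, ← integral_const_mul, ← integral_sub]
    · congr 1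
      ext y
      have hne' : ρ * ee y ≠ x := by
        intro h; apply hc; rw [← h]; simp
      have h3 : ρ * ee y - x ≠ 0 := sub_ne_zero.2 hne'
      have h4 : x - ρ * ee y ≠ 0 := sub_ne_zero.2 hne'.symm
      rw [dslope_of_ne _ hne', slope_def_field]
      rw [show 1 - ρ * ee y / x = (x - ρ * ee y) / x by field_simp, inv_div]
      rw [show ρ * ee y - x = - (x - ρ * ee y) by ring, div_neg]
      field_simp
      ring
    · apply cont_mean_integrable
      apply Continuous.mul continuous_const
      apply Continuous.inv₀ (by fun_prop) hne
    · apply cont_mean_integrable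
      apply Continuous.mul continuous_const
      rw [continuous_iff_continuousAt]
      intro y
      have := (hd (ρ * ee y) (by simpa using ha) (by simpa using hb)).continuousAt
      exact ContinuousAt.comp (f := fun y => ρ * ee y) this (by fun_prop)
  rw [gen r le_rfl (h1.trans h2).le h1.ne, gen R (h1.trans h2).le le_rfl h2.ne',
    mean_pole_in hr h1, mean_pole_out hx0 h2, key]
  ring

open MeasureTheory

lemma mul_prod_ite {ι : Type*} [Fintype ι] [DecidableEq ι] (i : ι) (u : ι → ℂ) :
    u i * ∏ k, (if k = i then 1 else u k) = ∏ k, u k := by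
  rw [← Finset.mul_prod_erase _ u (Finset.mem_univ i)]
  congr 1
  rw [← Finset.mul_prod_erase _ _ (Finset.mem_univ i)]
  simp only [if_true, one_mul]
  refine Finset.prod_congr rfl fun k hk => ?_
  rw [if_neg (Finset.ne_of_mem_erase hk)]

lemma prod_ite_mul {ι : Type*} [Fintype ι] [DecidableEq ι] (i : ι) (u f : ι → ℂ) :
    (∏ k, if k = i then 1 else u k * f k) =
      (∏ k, if k = i then 1 else u k) * ∏ k, if k = i then 1 else f k := by
  rw [← Finset.prod_mul_distrib]
  refine Finset.prod_congr rfl fun k _ => ?_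
  split_ifs <;> simp

lemma lagrange_pow {ι : Type*} [Fintype ι] [DecidableEq ι] {v : ι → ℂ} (hv : Function.Injective v)
    {k : ℕ} (hk : k < Fintype.card ι) {w : ℂ} (hw : ∀ i, w ≠ v i) :
    w ^ k * ∏ i, (w - v i)⁻¹ =
      ∑ i, (w - v i)⁻¹ * v i ^ k * ∏ j, if j = i then 1 else (v i - v j)⁻¹ := by
  have h1 := Lagrange.eval_interpolate_not_at_node (s := Finset.univ) (v := v)
    (fun i => v i ^ k) (x := w) (fun i _ => hw i)
  have h2 : Lagrange.interpolate Finset.univ v (fun i => v i ^ k) = Polynomial.X ^ k := by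
    symm
    apply Lagrange.eq_interpolate_of_eval_eq
    · exact hv.injOn
    · rw [Polynomial.degree_X_pow]; exact_mod_cast hk
    · intro i _; simp
  rw [h2, Polynomial.eval_pow, Polynomial.eval_X, Lagrange.eval_nodal] at h1
  rw [h1, mul_comm, ← mul_assoc, ← Finset.prod_mul_distrib]
  have h3 : ∏ i, ((w - v i)⁻¹ * (w - v i)) = 1 := by
    apply Finset.prod_eq_one
    intro i _
    exact inv_mul_cancel₀ (sub_ne_zero.2 (hw i))
  rw [h3, one_mul]
  refine Finset.sum_congr rfl fun i _ => ?_
  rw [Lagrange.nodalWeight]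
  have h4 : ∏ j ∈ Finset.univ.erase i, (v i - v j)⁻¹ = ∏ j, if j = i then 1 else (v i - v j)⁻¹ := by
    rw [← Finset.mul_prod_erase Finset.univ _ (Finset.mem_univ i)]
    simp only [if_true, one_mul]
    refine Finset.prod_congr rfl fun k hk => ?_
    rw [if_neg (Finset.ne_of_mem_erase hk)]
  rw [h4]; ring

lemma lagrange_one {ι : Type*} [Fintype ι] [DecidableEq ι] [Nonempty ι] {x : ι → ℂ}
    (hx : Function.Injective x) (hx0 : ∀ i, x i ≠ 0) {w : ℂ} (hw : ∀ i, w ≠ x i) :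
    ∏ i, (1 - w / x i)⁻¹ =
      ∑ i, (1 - w / x i)⁻¹ * ∏ j, if j = i then 1 else (1 - x i / x j)⁻¹ := by
  have h := lagrange_pow hx (k := 0) Fintype.card_pos hw
  have e1 : ∀ i, (1 - w / x i)⁻¹ = (-x i) * (w - x i)⁻¹ := by
    intro i
    have a1 : w - x i ≠ 0 := sub_ne_zero.2 (hw i)
    have := hx0 i
    rw [show 1 - w / x i = (w - x i) / (- x i) by field_simp; ring, inv_div]; ring
  have e2 : ∀ i, (∏ j, if j = i then 1 else (1 - x i / x j)⁻¹) =
      (∏ j, if j = i then 1 else -x j) * ∏ j, if j = i then 1 else (x i - x j)⁻¹ := by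
    intro i
    rw [← prod_ite_mul]
    refine Finset.prod_congr rfl fun j _ => ?_
    split_ifs with hj
    · rfl
    · have := hx0 j
      have a1 : x i - x j ≠ 0 := sub_ne_zero.2 (fun h => hj (hx h).symm)
      rw [show 1 - x i / x j = (x i - x j) / (- x j) by field_simp; ring, inv_div]; ring
  simp_rw [e1, e2]
  rw [Finset.prod_mul_distrib]
  simp only [pow_zero, one_mul, mul_one] at h
  rw [h, Finset.mul_sum]
  refine Finset.sum_congr rfl fun i _ => ?_
  rw [← mul_prod_ite i (fun j => -x j)]
  ring

section
variable {p q : ℂ} [hp : Nome p] [hq : Nome q]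

lemma pf_base {ι : Type*} [Fintype ι] [DecidableEq ι] [Nonempty ι] (x a : ι → ℂ)
    (hx0 : ∀ i, x i ≠ 0) (ha0 : ∀ i, a i ≠ 0) (hx : Function.Injective x)
    (hprod : ∏ i, x i = ∏ i, a i) (R : ℝ) (hR : 0 < R) (hxR : ∀ i, ‖x i‖ < R)
    (hxR' : ∀ i, R * ‖p‖ < ‖x i‖) :
    ∑ i, (∏ m, th p (x i / a m)) / (∏ k, if k = i then 1 else th p (x i / x k)) = 0 := by
  have hRc : (R : ℂ) ≠ 0 := by exact_mod_cast hR.ne'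
  have hp0 := Nome.norm_pos p
  set f : ℂ → ℂ := fun w => (∏ m, th p (w / a m)) / ∏ k, th p (w / x k) with hf
  have hper : ∀ w, w ≠ 0 → f (p * w) = f w := by
    intro w hw
    have e : ∀ b : ι → ℂ, (∀ i, b i ≠ 0) →
        ∏ m, th p (p * w / b m) = (∏ m, b m) * (∏ m : ι, (-1 / w)) * ∏ m, th p (w / b m) := by
      intro b hb
      rw [← Finset.prod_mul_distrib, ← Finset.prod_mul_distrib]
      refine Finset.prod_congr rfl fun m _ => ?_
      have := hb m
      rw [mul_div_assoc, th_pmul (div_ne_zero hw this)]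
      field_simp
    simp only [hf]
    rw [e a ha0, e x hx0, hprod, mul_div_mul_left]
    apply mul_ne_zero
    · exact Finset.prod_ne_zero_iff.2 fun i _ => ha0 i
    · exact Finset.prod_ne_zero_iff.2 fun i _ => by
        simp [hw]
  set g : ℂ → ℂ := fun w => (∏ m, th p (w / a m)) / ∏ k, th1 p (w / x k) with hg
  have hfg : ∀ w, f w = g w * ∏ i, (1 - w / x i)⁻¹ := by
    intro w
    simp only [hf, hg, th_eq (p := p) (w / x _)]
    rw [Finset.prod_mul_distrib, Finset.prod_inv_distrib]
    ring
  have hth1 : ∀ w, R * ‖p‖ ≤ ‖w‖ → ‖w‖ ≤ R → ∀ k, th1 p (w / x k) ≠ 0 := by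
    intro w h1 h2 k
    have hk : 0 < ‖x k‖ := norm_pos_iff.2 (hx0 k)
    apply th1_ne
    · rw [norm_div, lt_div_iff₀ hk]
      nlinarith [hxR k]
    · rw [norm_div, ← mul_div_assoc, div_lt_one hk]
      nlinarith [hxR' k]
  have hgd : ∀ w, ‖(R : ℂ) * p‖ ≤ ‖w‖ → ‖w‖ ≤ ‖(R : ℂ)‖ → DifferentiableAt ℂ g w := by
    intro w h1 h2
    rw [norm_mul, Complex.norm_real, Real.norm_of_nonneg hR.le] at h1
    rw [Complex.norm_real, Real.norm_of_nonneg hR.le] at h2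
    have hw : w ≠ 0 := by
      rw [← norm_pos_iff]; nlinarith [mul_pos hR hp0]
    apply DifferentiableAt.fun_div
    · apply DifferentiableAt.fun_finsetProd
      intro m _
      exact th_differentiableAt (by fun_prop) (div_ne_zero hw (ha0 m))
    · apply DifferentiableAt.fun_finsetProd
      intro m _
      exact th1_differentiableAt (by fun_prop) (div_ne_zero hw (hx0 m))
    · exact Finset.prod_ne_zero_iff.2 fun k _ => hth1 w h1 h2 k
  have hgc : ∀ ρ : ℂ, ‖(R : ℂ) * p‖ ≤ ‖ρ‖ → ‖ρ‖ ≤ ‖(R : ℂ)‖ → (∀ i, ‖ρ‖ ≠ ‖x i‖) →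
      ∫ y : UnitAddCircle, f (ρ * ee y) =
        ∑ i, (∏ j, if j = i then 1 else (1 - x i / x j)⁻¹) *
          ∫ y : UnitAddCircle, g (ρ * ee y) * (1 - ρ * ee y / x i)⁻¹ := by
    intro ρ h1 h2 h3
    simp_rw [← integral_const_mul]
    rw [← integral_finsetSum]
    · congr 1
      ext y
      rw [hfg, lagrange_one hx hx0, Finset.mul_sum]
      · refine Finset.sum_congr rfl fun i _ => ?_
        ring
      · intro i h; apply h3 i; rw [← h]; simp
    · intro i _
      apply cont_mean_integrable
      apply Continuous.mul continuous_const
      apply Continuous.mul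
      · rw [continuous_iff_continuousAt]
        intro y
        have := (hgd (ρ * ee y) (by simpa using h1) (by simpa using h2)).continuousAt
        exact ContinuousAt.comp (f := fun y => ρ * ee y) this (by fun_prop)
      · apply Continuous.inv₀ (by fun_prop)
        intro y; apply one_sub_ne
        simp only [norm_div, norm_mul, norm_ee, mul_one]
        intro h; apply h3 i
        rwa [div_eq_one_iff_eq (norm_ne_zero_iff.2 (hx0 i))] at h
  have nR : ‖(R : ℂ)‖ = R := by rw [Complex.norm_real, Real.norm_of_nonneg hR.le]
  have nRp : ‖(R : ℂ) * p‖ = R * ‖p‖ := by rw [norm_mul, nR]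
  have hle : ‖(R : ℂ) * p‖ ≤ ‖(R : ℂ)‖ := by rw [nRp, nR]; nlinarith [hp.lt]
  have e1 := hgc (R * p) le_rfl hle (fun i => by rw [nRp]; exact (hxR' i).ne)
  have e2 := hgc R hle le_rfl (fun i => by rw [nR]; exact (hxR i).ne')
  have e3 : ∫ y : UnitAddCircle, f (R * p * ee y) = ∫ y : UnitAddCircle, f (R * ee y) := by
    congr 1
    ext y
    rw [← hper _ (mul_ne_zero hRc (ee_ne y))]
    congr 1; ring
  have e4 : ∀ i, ∫ y : UnitAddCircle, g (R * p * ee y) * (1 - R * p * ee y / x i)⁻¹ = g (x i) +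
      ∫ y : UnitAddCircle, g (R * ee y) * (1 - R * ee y / x i)⁻¹ := by
    intro i
    exact contour_A2 (mul_ne_zero hRc hp.ne) (by rw [nRp]; exact hxR' i) (by rw [nR]; exact hxR i) hgd
  rw [e3, e2] at e1
  simp_rw [e4, mul_add] at e1
  rw [Finset.sum_add_distrib, right_eq_add] at e1
  have h11 : th1 p 1 ≠ 0 := th1_ne (by simpa using hp.lt) (by simpa using hp.lt)
  have : (∑ i, (∏ m, th p (x i / a m)) / (∏ k, if k = i then 1 else th p (x i / x k))) * (th1 p 1)⁻¹
      = 0 := by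
    rw [← e1, Finset.sum_mul]
    refine Finset.sum_congr rfl fun i _ => ?_
    simp only [hg]
    rw [← mul_prod_ite i (fun k => th1 p (x i / x k)), div_self (hx0 i)]
    simp_rw [th_eq (p := p) (x i / x _)]
    rw [prod_ite_mul]
    have : (∏ k, if k = i then 1 else (1 - x i / x k)⁻¹) =
        (∏ k, if k = i then 1 else (1 - x i / x k))⁻¹ := by
      rw [← Finset.prod_inv_distrib]
      refine Finset.prod_congr rfl fun k _ => ?_
      split_ifs <;> simp
    rw [this]
    simp only [div_eq_mul_inv, mul_inv]
    ring
  exact (mul_eq_zero.1 this).resolve_right (inv_ne_zero h11)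

/-- summand of the theta identity -/
noncomputable def pfTerm (p : ℂ) {N : ℕ} (z : Fin N → ℂ) (t : Fin (N + 1) → ℂ) (l : ℂ) (i : Fin N) : ℂ :=
  (l / z i) * (∏ m, th p (z i / t m)) * ∏ k, if k = i then 1 else th p (l / z k) / th p (z i / z k)

lemma pf_main0 {N : ℕ} (z : Fin N → ℂ) (t : Fin (N + 1) → ℂ) (hz : ∀ i, ‖z i‖ = 1)
    (hinj : Function.Injective z) (ht : ∀ i, t i ≠ 0) (l : ℂ) (hl : l * ∏ i, z i = ∏ i, t i)
    (h1 : ‖p‖ < ‖l‖) (h2 : ‖l‖ < 1) :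
    ∑ i, pfTerm p z t l i = ∏ m, th p (l / t m) := by
  have hp0 := Nome.norm_pos p
  have hl0 : l ≠ 0 := by rw [← norm_pos_iff]; linarith
  have hz0 : ∀ i, z i ≠ 0 := fun i => by rw [← norm_pos_iff, hz]; norm_num
  obtain ⟨R, hR1, hR2⟩ : ∃ R : ℝ, 1 < R ∧ R < ‖l‖ / ‖p‖ := by
    apply exists_between; rwa [one_lt_div hp0]
  rw [lt_div_iff₀ hp0] at hR2
  have hne : ∀ k, l ≠ z k := by
    intro k h; rw [h, hz] at h2; exact lt_irrefl _ h2
  have h := pf_base (p := p) (Fin.cons l z) t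
    (by intro i; refine Fin.cases hl0 (fun i => by simpa using hz0 i) i) ht
    (by
      rw [Fin.cons_injective_iff]
      refine ⟨?_, hinj⟩
      rintro ⟨k, hk⟩
      exact hne k hk.symm)
    (by rw [Fin.prod_univ_succ]; simpa using hl) R (by linarith)
    (by intro i; refine Fin.cases (by simp; linarith) (fun i => by simp [hz, hR1]) i)
    (by intro i; refine Fin.cases (by simpa using hR2) (fun i => by simp only [Fin.cons_succ, hz]; linarith) i)
  rw [Fin.sum_univ_succ] at h
  simp only [Fin.cons_zero, Fin.cons_succ, Fin.prod_univ_succ (n := N) (M := ℂ) (fun k => ite _ _ _),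
    Fin.succ_ne_zero, if_false, if_true, one_mul, Fin.succ_inj, (Fin.succ_ne_zero _).symm] at h
  have hth : ∀ k, th p (l / z k) ≠ 0 := by
    intro k
    apply th_ne <;> simpa [hz]
  have hP : ∏ k, th p (l / z k) ≠ 0 := Finset.prod_ne_zero_iff.2 fun k _ => hth k
  have h' : ∏ m, th p (l / t m) = (∏ k, th p (l / z k)) *
     - ∑ x, (∏ m, th p (z x / t m)) / (th p (z x / l) * ∏ k, if k = x then 1 else th p (z x / z k)) := by
    rw [← div_eq_iff_mul_eq hP |>.1 (eq_neg_of_add_eq_zero_left h)]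
    ring
  rw [h', ← Finset.sum_neg_distrib, Finset.mul_sum]
  refine Finset.sum_congr rfl fun i _ => ?_
  rw [pfTerm, show z i / l = (l / z i)⁻¹ by rw [inv_div], th_inv (div_ne_zero hl0 (hz0 i)),
    ← mul_prod_ite i (fun k => th p (l / z k))]
  have : (∏ k, if k = i then 1 else th p (l / z k) / th p (z i / z k)) =
    (∏ k, if k = i then 1 else th p (l / z k)) / ∏ k, if k = i then 1 else th p (z i / z k) := by
    rw [← Finset.prod_div_distrib]
    refine Finset.prod_congr rfl fun k _ => ?_
    split_ifs <;> simp
  rw [this]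
  have := hz0 i
  have := hth i
  generalize th p (l / z i) = A at *
  field_simp

lemma th_divp {x : ℂ} (hx : x ≠ 0) : th p (x / p) = - (x / p) * th p x := by
  have := hp.ne
  have h := th_pmul (p := p) (div_ne_zero hx this)
  rw [mul_div_cancel₀ _ this] at h
  rw [h]; field_simp

lemma pf_main {N : ℕ} (z : Fin N → ℂ) (t : Fin (N + 1) → ℂ) (hz : ∀ i, ‖z i‖ = 1)
    (hinj : Function.Injective z) (ht : ∀ i, t i ≠ 0) (l : ℂ) (hl : l * ∏ i, z i = ∏ i, t i)
    (h1 : ‖p‖ ^ 2 < ‖l‖) (h2 : ‖l‖ < 1) (h3 : ‖l‖ ≠ ‖p‖) :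
    ∑ i, pfTerm p z t l i = ∏ m, th p (l / t m) := by
  have hp0 := Nome.norm_pos p
  rcases lt_or_gt_of_ne h3 with h3 | h3
  swap
  · exact pf_main0 z t hz hinj ht l hl h3 h2
  have hpne := hp.ne
  have hl0 : l ≠ 0 := by rw [← norm_pos_iff]; nlinarith
  have hz0 : ∀ i, z i ≠ 0 := fun i => by rw [← norm_pos_iff, hz]; norm_num
  have hZ : ∏ i, z i ≠ 0 := Finset.prod_ne_zero_iff.2 fun k _ => hz0 k
  have hT : ∏ i, t i ≠ 0 := Finset.prod_ne_zero_iff.2 fun k _ => ht k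
  have h := pf_main0 (p := p) z (Fin.cons (t 0 / p) (fun i => t i.succ)) hz hinj
    (by intro i; refine Fin.cases (div_ne_zero (ht 0) hpne) (fun i => ht _) i) (l / p)
    (by
      rw [Fin.prod_univ_succ] at hl ⊢
      simp only [Fin.cons_zero, Fin.cons_succ]
      linear_combination hl / p)
    (by rw [norm_div, lt_div_iff₀ hp0]; nlinarith) (by rw [norm_div, div_lt_one hp0]; exact h3)
  set c : ℂ := (- (t 0) / p) * (∏ k, -(l / (z k * p))) * (-(l / p))⁻¹ with hc
  have hc0 : c ≠ 0 := by
    refine mul_ne_zero (mul_ne_zero (div_ne_zero (neg_ne_zero.2 (ht 0)) hpne) ?_) ?_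
    · exact Finset.prod_ne_zero_iff.2 fun k _ => neg_ne_zero.2 (div_ne_zero hl0 (mul_ne_zero (hz0 k) hpne))
    · exact inv_ne_zero (neg_ne_zero.2 (div_ne_zero hl0 hpne))
  have hL : ∀ i, pfTerm p z (Fin.cons (t 0 / p) (fun i => t i.succ)) (l / p) i =
      c * pfTerm p z t l i := by
    intro i
    rw [pfTerm, pfTerm, Fin.prod_univ_succ, Fin.prod_univ_succ]
    simp only [Fin.cons_zero, Fin.cons_succ]
    have e1 : ∀ k, th p (l / p / z k) / th p (z i / z k) =
        (-(l / (z k * p))) * (th p (l / z k) / th p (z i / z k)) := by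
      intro k
      rw [show l / p / z k = l / z k / p by ring, th_divp (div_ne_zero hl0 (hz0 k))]
      ring
    simp_rw [e1]
    rw [prod_ite_mul, show z i / (t 0 / p) = p * (z i / t 0) by field_simp,
      th_pmul (div_ne_zero (hz0 i) (ht 0)), hc, ← mul_prod_ite i (fun k => -(l / (z k * p)))]
    have := hz0 i
    have := ht 0
    generalize (∏ k, if k = i then 1 else -(l / (z k * p))) = A
    generalize (∏ k, if k = i then 1 else th p (l / z k) / th p (z i / z k)) = B
    field_simp
  have hRR : ∏ m, th p (l / p / (Fin.cons (t 0 / p) (fun i => t i.succ) : Fin (N + 1) → ℂ) m) =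
      c * ∏ m, th p (l / t m) := by
    rw [Fin.prod_univ_succ, Fin.prod_univ_succ]
    simp only [Fin.cons_zero, Fin.cons_succ]
    have e1 : ∀ k : Fin N, th p (l / p / t k.succ) =
        (-(l / (t k.succ * p))) * (th p (l / t k.succ)) := by
      intro k
      rw [show l / p / t k.succ = l / t k.succ / p by ring, th_divp (div_ne_zero hl0 (ht _))]
      ring
    simp_rw [e1]
    rw [Finset.prod_mul_distrib, show l / p / (t 0 / p) = l / t 0 by field_simp]
    have e2 : ∏ k : Fin N, (-(l / (t k.succ * p))) = c := by
      have e3 : ∀ u : Fin N → ℂ, ∏ k : Fin N, (-(l / (u k * p))) = (∏ k : Fin N, (-(l/p))) / ∏ k, u k := by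
        intro u
        rw [← Finset.prod_div_distrib]
        refine Finset.prod_congr rfl fun k _ => ?_
        rw [mul_comm, ← div_div]; ring
      rw [hc, e3, e3]
      rw [Fin.prod_univ_succ] at hl hT
      have hT' := right_ne_zero_of_mul hT
      have := ht 0
      have h5 : ∏ k, z k = t 0 * (∏ i : Fin N, t i.succ) / l := by
        rw [eq_div_iff hl0, ← hl]; ring
      rw [h5]
      generalize (∏ k : Fin N, (-(l/p))) = A
      field_simp
    rw [e2]; ring
  rw [hRR, Finset.sum_congr rfl (fun i _ => hL i), ← Finset.mul_sum] at h
  exact mul_left_cancel₀ hc0 h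
end

open MeasureTheory

/-- the torus -/
abbrev Tor (n : ℕ) := Fin n → UnitAddCircle

/-- coordinates of the torus point -/
noncomputable def eT {n : ℕ} (x : Tor n) : Fin n → ℂ := fun i => ee (x i)

@[fun_prop] lemma eT_continuous {n : ℕ} : Continuous (eT (n := n)) := by
  unfold eT; fun_prop

lemma cont_integrable {X : Type*} [TopologicalSpace X] [CompactSpace X] [MeasurableSpace X]
    [OpensMeasurableSpace X] [T2Space X] [SecondCountableTopology X] {μ : Measure X} [IsFiniteMeasure μ]
    {F : X → ℂ} (hF : Continuous F) : Integrable F μ :=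
  hF.integrable_of_hasCompactSupport (HasCompactSupport.of_compactSpace F)

lemma int_insertNth {n : ℕ} (i : Fin (n + 1)) (F : Tor (n + 1) → ℂ) (hF : Continuous F) :
    ∫ x, F x = ∫ a, ∫ y, F (i.insertNth a y) := by
  have h := (volume_preserving_piFinSuccAbove (fun _ : Fin (n + 1) => UnitAddCircle) i).symm
  rw [← h.integral_comp', Measure.volume_eq_prod, integral_prod]
  · rfl
  · apply cont_integrable
    apply hF.comp
    change Continuous fun ab : UnitAddCircle × Tor n =>
      (i.insertNth (α := fun _ => UnitAddCircle) ab.1 ab.2 : Tor (n + 1))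
    fun_prop

lemma int_cons {n : ℕ} (F : Tor (n + 1) → ℂ) (hF : Continuous F) :
    ∫ x, F x = ∫ a, ∫ y, F (Fin.cons a y) := by
  rw [int_insertNth 0 F hF]
  simp only [Fin.insertNth_zero']

lemma int_cons' {n : ℕ} (F : Tor (n + 1) → ℂ) (hF : Continuous F) :
    ∫ x, F x = ∫ y, ∫ a, F (Fin.cons a y) := by
  rw [int_cons F hF, integral_integral_swap]
  apply cont_integrable
  exact hF.comp (by fun_prop)

lemma int_slice {n : ℕ} (F : Tor (n + 1) → ℂ) (hF : Continuous F) :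
    ∫ x, F x = ∫ y, ∫ x : Tor n, F (Fin.snoc x (y - ∑ i, x i)) := by
  have hc : Continuous (fun ab : UnitAddCircle × Tor n => (Fin.snoc (α := fun _ => UnitAddCircle) ab.2 ab.1 : Tor (n + 1))) := by
    fun_prop
  have hc2 : Continuous (fun ab : UnitAddCircle × Tor n =>
      (Fin.snoc (α := fun _ => UnitAddCircle) ab.2 (ab.1 - ∑ i, ab.2 i) : Tor (n + 1))) := by
    fun_prop
  rw [int_insertNth (Fin.last n) F hF]
  simp only [Fin.insertNth_last']
  have s1 := integral_integral_swap (f := fun (a : UnitAddCircle) (x : Tor n) => F (Fin.snoc x a))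
    (μ := volume) (ν := volume) (cont_integrable (hF.comp hc))
  have s2 := integral_integral_swap (μ := volume) (ν := volume)
    (f := fun (a : UnitAddCircle) (x : Tor n) => F (Fin.snoc x (a - ∑ i, x i)))
    (cont_integrable (hF.comp hc2))
  rw [s1, s2]
  congr 1
  ext x
  exact (integral_sub_right_eq_self (μ := (volume : Measure UnitAddCircle))
    (fun a => F (Fin.snoc x a)) (∑ i, x i)).symm

lemma int_perm {n : ℕ} (F : Tor n → ℂ) (σ : Equiv.Perm (Fin n)) :
    ∫ x, F (x ∘ σ) = ∫ x, F x := by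
  have h := (volume_measurePreserving_piCongrLeft (fun _ : Fin n => UnitAddCircle) σ).symm
  rw [← h.integral_comp' F]
  rfl

lemma torusInt_eq : ∀ (n : ℕ) (f : (Fin n → ℂ) → ℂ), Continuous (fun x : Tor n => f (eT x)) →
    torusInt n f = ∫ x : Tor n, f (eT x) := by
  intro n
  induction n with
  | zero =>
    intro f _
    rw [torusInt, integral_unique]
    simp only [probReal_univ, one_smul]
    congr 1
    exact Subsingleton.elim _ _
  | succ n ih =>
    intro f hf
    have hcons : ∀ (a : UnitAddCircle) (y : Tor n), eT (Fin.cons a y : Tor (n + 1)) = Fin.cons (ee a) (eT y) := by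
      intro a y
      ext i
      refine Fin.cases rfl (fun i => rfl) i
    rw [torusInt, circleInt_eq, int_cons _ hf]
    congr 1
    ext a
    rw [ih]
    · simp only [hcons]
    · simp only [← hcons]
      exact hf.comp (by fun_prop)

lemma ae_distinct {n : ℕ} : ∀ᵐ x : Tor n, Function.Injective (eT x) := by
  have h : ∀ i j : Fin n, i ≠ j → ∀ᵐ x : Tor n, x i - x j ≠ 0 := by
    intro i j hij
    let f : Tor n →+ UnitAddCircle :=
      { toFun := fun x => x i - x j
        map_zero' := by simp
        map_add' := by intro x y; simp; abel }
    have hf : MeasurePreserving f := by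
      apply AddMonoidHom.measurePreserving
      · change Continuous (fun x : Tor n => x i - x j)
        fun_prop
      · intro y
        refine ⟨Pi.single i y, ?_⟩
        change (Pi.single i y : Tor n) i - (Pi.single i y : Tor n) j = y
        simp [hij.symm]
      · simp
    have h0 : (volume : Measure UnitAddCircle) {0} = 0 := by
      have := AddCircle.volume_closedBall (T := 1) (x := 0) 0
      simpa using this
    have h1 := hf.measure_preimage (s := {0}) (measurableSet_singleton 0).nullMeasurableSet
    rw [h0] at h1
    rw [ae_iff]
    convert h1 using 2
    ext x
    simp [f]
  have h' : ∀ᵐ x : Tor n, ∀ i j : Fin n, i ≠ j → x i - x j ≠ 0 := by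
    rw [ae_all_iff]; intro i
    rw [ae_all_iff]; intro j
    by_cases hij : i = j
    · simp [hij]
    · filter_upwards [h i j hij] with x hx _ using hx
  filter_upwards [h'] with x hx i j hij
  by_contra hne
  exact hx i j hne (sub_eq_zero.2 (ee_injective hij))

lemma const_of_fourier (F : UnitAddCircle → ℂ) (hF : Continuous F)
    (h : ∀ k : ℤ, k ≠ 0 → ∫ y, F y * ee y ^ (-k) = 0) : ∀ x y, F x = F y := by
  have hv : (AddCircle.haarAddCircle : Measure UnitAddCircle) = volume := by
    rw [AddCircle.volume_eq_smul_haarAddCircle]; simp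
  have hc : ∀ k : ℤ, k ≠ 0 → fourierCoeff F k = 0 := by
    intro k hk
    rw [fourierCoeff, hv, ← h k hk]
    congr 1
    ext y
    rw [fourier_apply, smul_eq_mul, mul_comm, AddCircle.toCircle_zsmul]
    simp [ee]
  have hs : Summable (fourierCoeff F) := by
    apply summable_of_ne_finset_zero (s := {0})
    intro k hk
    exact hc k (by simpa using hk)
  have key : ∀ x, F x = fourierCoeff F 0 := by
    intro x
    have h1 := has_pointwise_sum_fourier_series_of_summable (f := ⟨F, hF⟩) hs x
    have h2 := hasSum_single (f := fun i => fourierCoeff F i • fourier i x) (0 : ℤ) (by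
      intro k hk; simp [hc k hk])
    have := h1.unique h2
    simpa using this
  intro x y
  rw [key x, key y]

open MeasureTheory
set_option linter.unusedSectionVars false
set_option linter.unusedVariables false

lemma div_diffAt {V : Type*} [NormedAddCommGroup V] [NormedSpace ℂ V] {f g : V → ℂ} {z : V}
    (hf : DifferentiableAt ℂ f z) (hg : DifferentiableAt ℂ g z) (h : g z ≠ 0) :
    DifferentiableAt ℂ (fun z => f z / g z) z := by
  simp only [div_eq_mul_inv]
  exact hf.fun_mul (hg.fun_inv h)

lemma prod_diffAt {V ι : Type*} [NormedAddCommGroup V] [NormedSpace ℂ V] {u : Finset ι}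
    {f : ι → V → ℂ} {z : V}
    (hf : ∀ i ∈ u, DifferentiableAt ℂ (f i) z) :
    DifferentiableAt ℂ (fun z => ∏ i ∈ u, f i z) z := by
  classical
  induction u using Finset.induction_on with
  | empty => simp
  | insert a u ha ih =>
    simp only [Finset.prod_insert ha]
    exact (hf a (Finset.mem_insert_self a u)).fun_mul
      (ih fun i hi => hf i (Finset.mem_insert_of_mem hi))

/-- one-variable factor -/
noncomputable def Phi (p q : ℂ) {M : ℕ} (s t : Fin M → ℂ) (x : ℂ) : ℂ :=
  ∏ m, (ellGamma (s m * x) p q * ellGamma (t m / x) p q)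

/-- pair factor -/
noncomputable def vv (p q x : ℂ) : ℂ := th p x * th q x⁻¹

/-- product of pair factors -/
noncomputable def VV (p q : ℂ) {N : ℕ} (z : Fin N → ℂ) : ℂ :=
  ∏ i, ∏ j ∈ Finset.Ioi i, vv p q (z i / z j)

/-- Vandermonde product -/
noncomputable def Vd {N : ℕ} (z : Fin N → ℂ) : ℂ := ∏ i, ∏ j ∈ Finset.Ioi i, (z j - z i)

/-- the other antisymmetric product -/
noncomputable def Vp (p q : ℂ) {N : ℕ} (z : Fin N → ℂ) : ℂ :=
  ∏ i, ∏ j ∈ Finset.Ioi i, ((z j)⁻¹ - (z i)⁻¹) * (th1 p (z i / z j) * th1 q (z i / z j))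

/-- the integrand -/
noncomputable def Del (p q : ℂ) {N M : ℕ} (s t : Fin M → ℂ) (z : Fin N → ℂ) : ℂ :=
  (∏ j, Phi p q s t (z j)) * VV p q z

lemma Vd_perm {N : ℕ} (z : Fin N → ℂ) (σ : Equiv.Perm (Fin N)) :
    Vd (z ∘ σ) = (Equiv.Perm.sign σ : ℂ) * Vd z :=
  σ.prod_Ioi_comp_eq_sign_mul_prod (f := fun i j => z j - z i) (by intros; ring)

section
variable {p q : ℂ} [hp : Nome p] [hq : Nome q]

lemma Vp_perm {N : ℕ} (z : Fin N → ℂ) (σ : Equiv.Perm (Fin N)) :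
    Vp p q (z ∘ σ) = (Equiv.Perm.sign σ : ℂ) * Vp p q z :=
  σ.prod_Ioi_comp_eq_sign_mul_prod (f := fun i j => ((z j)⁻¹ - (z i)⁻¹) * (th1 p (z i / z j) * th1 q (z i / z j)))
    (by
      intro i j
      rw [← inv_div (z j) (z i), th1_inv, th1_inv]
      ring)

lemma VV_eq {N : ℕ} (z : Fin N → ℂ) (hz : ∀ i, z i ≠ 0) : VV p q z = Vd z * Vp p q z := by
  unfold VV Vd Vp
  rw [← Finset.prod_mul_distrib]
  refine Finset.prod_congr rfl fun i _ => ?_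
  rw [← Finset.prod_mul_distrib]
  refine Finset.prod_congr rfl fun j _ => ?_
  have := hz i
  have := hz j
  rw [vv, th_eq, th_eq, th1_inv, inv_div]
  field_simp

lemma sign_sq {N : ℕ} (σ : Equiv.Perm (Fin N)) :
    (Equiv.Perm.sign σ : ℂ) * (Equiv.Perm.sign σ : ℂ) = 1 := by
  rcases Int.units_eq_one_or (Equiv.Perm.sign σ) with h | h <;> simp [h]

lemma VV_perm {N : ℕ} (z : Fin N → ℂ) (hz : ∀ i, z i ≠ 0) (σ : Equiv.Perm (Fin N)) :
    VV p q (z ∘ σ) = VV p q z := by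
  rw [VV_eq (z ∘ σ) (fun i => hz _), VV_eq z hz, Vd_perm, Vp_perm]
  linear_combination (Vd z * Vp p q z) * sign_sq σ

lemma Del_perm {N M : ℕ} (s t : Fin M → ℂ) (z : Fin N → ℂ) (hz : ∀ i, z i ≠ 0)
    (σ : Equiv.Perm (Fin N)) :
    Del p q s t (z ∘ σ) = Del p q s t z := by
  unfold Del
  rw [VV_perm z hz]
  congr 1
  exact Equiv.prod_comp σ (fun j => Phi p q s t (z j))

lemma VV_cons {n : ℕ} (a : ℂ) (y : Fin n → ℂ) :
    VV p q (Fin.cons a y : Fin (n + 1) → ℂ) = (∏ k, vv p q (a / y k)) * VV p q y := by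
  unfold VV
  rw [Fin.prod_univ_succ, Fin.prod_Ioi_zero]
  simp only [Fin.cons_zero, Fin.cons_succ, Fin.prod_Ioi_succ]

lemma Del_cons {n M : ℕ} (s t : Fin M → ℂ) (a : ℂ) (y : Fin n → ℂ) :
    Del p q s t (Fin.cons a y : Fin (n + 1) → ℂ) =
      Phi p q s t a * (∏ k, vv p q (a / y k)) * (∏ k, Phi p q s t (y k)) * VV p q y := by
  unfold Del
  rw [VV_cons, Fin.prod_univ_succ]
  simp only [Fin.cons_zero, Fin.cons_succ]
  ring

section
variable {V : Type*} [NormedAddCommGroup V] [NormedSpace ℂ V] {v : V}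

lemma Phi_diffAt {M : ℕ} {s t : Fin M → ℂ} {f : V → ℂ} (hf : DifferentiableAt ℂ f v)
    (hs0 : ∀ m, s m ≠ 0) (ht0 : ∀ m, t m ≠ 0)
    (h0 : f v ≠ 0) (hs : ∀ m, ‖s m * f v‖ < 1) (ht : ∀ m, ‖t m / f v‖ < 1) :
    DifferentiableAt ℂ (fun v => Phi p q s t (f v)) v := by
  unfold Phi
  refine prod_diffAt fun m _ => ?_
  refine DifferentiableAt.fun_mul ?_ ?_
  · exact ellGamma_differentiableAt (by fun_prop) (mul_ne_zero (hs0 m) h0) (hs m)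
  · exact ellGamma_differentiableAt (div_diffAt (by fun_prop) hf h0) (div_ne_zero (ht0 m) h0) (ht m)

lemma vv_diffAt {f : V → ℂ} (hf : DifferentiableAt ℂ f v) (h0 : f v ≠ 0) :
    DifferentiableAt ℂ (fun v => vv p q (f v)) v := by
  unfold vv
  exact (th_differentiableAt hf h0).fun_mul (th_differentiableAt (hf.fun_inv h0) (inv_ne_zero h0))

lemma VV_diffAt {n : ℕ} {f : V → Fin n → ℂ} (hf : ∀ i, DifferentiableAt ℂ (fun v => f v i) v)
    (h0 : ∀ i, f v i ≠ 0) : DifferentiableAt ℂ (fun v => VV p q (f v)) v := by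
  unfold VV
  refine prod_diffAt fun i _ => prod_diffAt fun j _ => ?_
  exact vv_diffAt (div_diffAt (hf i) (hf j) (h0 j)) (div_ne_zero (h0 i) (h0 j))

lemma Vp_diffAt {n : ℕ} {f : V → Fin n → ℂ} (hf : ∀ i, DifferentiableAt ℂ (fun v => f v i) v)
    (h0 : ∀ i, f v i ≠ 0) : DifferentiableAt ℂ (fun v => Vp p q (f v)) v := by
  unfold Vp
  refine prod_diffAt fun i _ => prod_diffAt fun j _ => ?_
  have hd := div_diffAt (hf i) (hf j) (h0 j)
  have hn := div_ne_zero (h0 i) (h0 j)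
  exact (((hf j).fun_inv (h0 j)).fun_sub ((hf i).fun_inv (h0 i))).fun_mul
    ((th1_differentiableAt hd hn).fun_mul (th1_differentiableAt hd hn))

lemma Del_diffAt {n M : ℕ} {s t : Fin M → ℂ} {f : V → Fin n → ℂ} (hf : ∀ i, DifferentiableAt ℂ (fun v => f v i) v)
    (hs0 : ∀ m, s m ≠ 0) (ht0 : ∀ m, t m ≠ 0)
    (h0 : ∀ i, f v i ≠ 0) (hs : ∀ m i, ‖s m * f v i‖ < 1) (ht : ∀ m i, ‖t m / f v i‖ < 1) :
    DifferentiableAt ℂ (fun v => Del p q s t (f v)) v := by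
  unfold Del
  refine DifferentiableAt.fun_mul (prod_diffAt fun j _ => ?_) (VV_diffAt hf h0)
  exact Phi_diffAt (hf j) hs0 ht0 (h0 j) (fun m => hs m j) (fun m => ht m j)
end

lemma eT_ne {n : ℕ} (x : Tor n) (i : Fin n) : eT x i ≠ 0 := by simp [eT]
lemma eT_norm {n : ℕ} (x : Tor n) (i : Fin n) : ‖eT x i‖ = 1 := by simp [eT]

/-- continuity on the torus from pointwise differentiability -/
lemma cont_of_diffAt {X : Type*} [TopologicalSpace X] {V : Type*} [NormedAddCommGroup V] [NormedSpace ℂ V]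
    {F : V → ℂ} {e : X → V} (he : Continuous e) (hF : ∀ x, DifferentiableAt ℂ F (e x)) :
    Continuous fun x => F (e x) :=
  continuous_iff_continuousAt.mpr fun x =>
    ContinuousAt.comp (f := e) (g := F) (hF x).continuousAt he.continuousAt

lemma Del_cont {n M : ℕ} {s t : Fin M → ℂ} (hs0 : ∀ m, s m ≠ 0) (ht0 : ∀ m, t m ≠ 0)
    (hs : ∀ m, ‖s m‖ < 1) (ht : ∀ m, ‖t m‖ < 1) :
    Continuous fun x : Tor n => Del p q s t (eT x) :=
  cont_of_diffAt eT_continuous fun x =>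
    Del_diffAt (f := fun v => v) (fun i => by fun_prop) hs0 ht0 (eT_ne x) (fun m i => by simp [eT_norm, hs])
      (fun m i => by simp [eT_norm, ht])
end

open MeasureTheory
set_option linter.unusedSectionVars false
set_option linter.unusedVariables false

/-- the shifted integrand -/
noncomputable def gt (p q : ℂ) {n : ℕ} (s t : Fin (n + 2) → ℂ) (w : ℂ → ℂ) (a : ℂ) (y : Fin n → ℂ) : ℂ :=
  (((∏ m, t m) / (a * ∏ k, y k)) / a) *
    (∏ m, ellGamma (s m * a) p q * ellGamma (q * (t m / a)) p q * (-(a / t m))) *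
    (∏ k, th q (y k / a) * th p ((∏ m, t m) / (a * ∏ k, y k) / y k)) *
    ((∏ k, Phi p q s t (y k)) * VV p q y) * w (a * ∏ k, y k)

section
variable {p q : ℂ} [hp : Nome p] [hq : Nome q]

lemma prod_ne {ι : Type*} {u : Finset ι} {f : ι → ℂ} (h : ∀ i, f i ≠ 0) : ∏ i ∈ u, f i ≠ 0 :=
  Finset.prod_ne_zero_iff.mpr fun i _ => h i

lemma prod_norm_one {ι : Type*} [Fintype ι] {f : ι → ℂ} (h : ∀ i, ‖f i‖ = 1) : ‖∏ i, f i‖ = 1 := by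
  simp [norm_prod, h]

lemma th_ne_one {x : ℂ} (hx : ‖x‖ = 1) (h : x ≠ 1) : th p x ≠ 0 := by
  rw [th_eq]
  exact mul_ne_zero (sub_ne_zero.mpr h.symm) (th1_ne (by rw [hx]; exact hp.lt) (by rw [hx, mul_one]; exact hp.lt))

lemma ne_of_norm_one {x : ℂ} (hx : ‖x‖ = 1) : x ≠ 0 := by
  rintro rfl; simp at hx

lemma pfTerm_cons {n : ℕ} (a : ℂ) (y : Fin n → ℂ) (t : Fin (n + 2) → ℂ) (l : ℂ) :
    pfTerm p (Fin.cons a y : Fin (n + 1) → ℂ) t l 0 =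
      (l / a) * (∏ m, th p (a / t m)) * ∏ k, (th p (l / y k) / th p (a / y k)) := by
  have h : (∏ k : Fin (n + 1), if k = 0 then 1 else
      th p (l / (Fin.cons a y : Fin (n + 1) → ℂ) k) / th p (a / (Fin.cons a y : Fin (n + 1) → ℂ) k)) =
      ∏ k, (th p (l / y k) / th p (a / y k)) := by
    rw [Fin.prod_univ_succ]
    simp
  rw [pfTerm, Fin.cons_zero, h]

lemma gt_at {n : ℕ} {s t : Fin (n + 2) → ℂ} (hs0 : ∀ m, s m ≠ 0) (ht0 : ∀ m, t m ≠ 0)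
    (hs : ∀ m, ‖s m‖ < 1) (ht : ∀ m, ‖t m‖ < 1) (w : ℂ → ℂ) {a : ℂ} {y : Fin n → ℂ}
    (ha : ‖a‖ = 1) (hy : ∀ k, ‖y k‖ = 1) (hay : ∀ k, a ≠ y k) :
    gt p q s t w a y = Del p q s t (Fin.cons a y : Fin (n + 1) → ℂ) *
      pfTerm p (Fin.cons a y : Fin (n + 1) → ℂ) t ((∏ m, t m) / (a * ∏ k, y k)) 0 * w (a * ∏ k, y k) := by
  have ha0 := ne_of_norm_one ha
  have hy0 := fun k => ne_of_norm_one (hy k)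
  rw [Del_cons, pfTerm_cons, gt]
  have e1 : (∏ m, ellGamma (s m * a) p q * ellGamma (q * (t m / a)) p q * (-(a / t m))) =
      Phi p q s t a * ∏ m, th p (a / t m) := by
    rw [Phi, ← Finset.prod_mul_distrib]
    refine Finset.prod_congr rfl fun m _ => ?_
    have h0 := ht0 m
    rw [ellGamma_q (div_ne_zero h0 ha0) (by simpa [ha] using ht m), ← inv_div (t m) a,
      th_inv (div_ne_zero h0 ha0)]
    field_simp
  have e2 : (∏ k, th q (y k / a) * th p ((∏ m, t m) / (a * ∏ k, y k) / y k)) =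
      (∏ k, vv p q (a / y k)) * ∏ k, (th p ((∏ m, t m) / (a * ∏ k, y k) / y k) / th p (a / y k)) := by
    rw [← Finset.prod_mul_distrib]
    refine Finset.prod_congr rfl fun k _ => ?_
    have : th p (a / y k) ≠ 0 := th_ne_one (by simp [ha, hy]) (by
      rw [Ne, div_eq_one_iff_eq (hy0 k)]; exact hay k)
    rw [vv, inv_div]
    field_simp
  rw [e1, e2]
  ring

lemma gt_at_q {n : ℕ} {s t : Fin (n + 2) → ℂ} (hs0 : ∀ m, s m ≠ 0) (ht0 : ∀ m, t m ≠ 0)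
    (hs : ∀ m, ‖s m‖ < 1) (ht : ∀ m, ‖t m‖ < 1) (hbal : (∏ m, s m) * ∏ m, t m = p * q)
    (w : ℂ → ℂ) {a : ℂ} {y : Fin n → ℂ}
    (ha : ‖a‖ = 1) (hy : ∀ k, ‖y k‖ = 1) (hay : ∀ k, a ≠ y k) :
    gt p q s t w (q * a) y = Del p q s t (Fin.cons a y : Fin (n + 1) → ℂ) *
      pfTerm p (Fin.cons a⁻¹ y⁻¹ : Fin (n + 1) → ℂ) s ((∏ m, s m) * (a * ∏ k, y k)) 0 *
        w (q * (a * ∏ k, y k)) := by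
  have ha0 := ne_of_norm_one ha
  have hy0 := fun k => ne_of_norm_one (hy k)
  have hq0 := hq.ne
  have hp0 := hp.ne
  have hS : ∏ m, s m ≠ 0 := prod_ne hs0
  have hT : ∏ m, t m ≠ 0 := prod_ne ht0
  have hP : ∏ k, y k ≠ 0 := prod_ne hy0
  rw [Del_cons, pfTerm_cons, gt]
  have e1 : (∏ m, ellGamma (s m * (q * a)) p q * ellGamma (q * (t m / (q * a))) p q * (-((q * a) / t m))) =
      Phi p q s t a * (∏ m, th p (a⁻¹ / s m)) * (q ^ (n + 2) * a ^ (2 * n + 4) * (∏ m, s m) / ∏ m, t m) := by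
    have : (q ^ (n + 2) * a ^ (2 * n + 4) * (∏ m, s m) / ∏ m, t m) = ∏ m, (q * a ^ 2 * s m / t m) := by
      rw [Finset.prod_div_distrib, Finset.prod_mul_distrib, Finset.prod_const]
      simp
      ring
    rw [this, Phi, ← Finset.prod_mul_distrib, ← Finset.prod_mul_distrib]
    refine Finset.prod_congr rfl fun m _ => ?_
    have h0 := ht0 m
    have h1 := hs0 m
    rw [show s m * (q * a) = q * (s m * a) by ring, show q * (t m / (q * a)) = t m / a by field_simp,
      ellGamma_q (mul_ne_zero h1 ha0) (by simpa [ha] using hs m),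
      show a⁻¹ / s m = (s m * a)⁻¹ by field_simp, th_inv (mul_ne_zero h1 ha0)]
    field_simp
  have e2 : (∏ k, th q (y k / (q * a)) * th p ((∏ m, t m) / (q * a * ∏ k, y k) / y k)) =
      (∏ k, vv p q (a / y k)) * (∏ k, (th p ((∏ m, s m) * (a * ∏ k, y k) / (y⁻¹ k)) / th p (a⁻¹ / y⁻¹ k))) *
       ((∏ k, y k) ^ 2 / (q ^ n * a ^ (2 * n))) := by
    have : ((∏ k, y k) ^ 2 / (q ^ n * a ^ (2 * n))) = ∏ k, (y k ^ 2 / (q * a ^ 2)) := by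
      rw [Finset.prod_div_distrib, Finset.prod_const, Finset.prod_pow]
      simp
      ring
    rw [this, ← Finset.prod_mul_distrib, ← Finset.prod_mul_distrib]
    refine Finset.prod_congr rfl fun k _ => ?_
    have hk := hy0 k
    have h3 : th p (y k / a) ≠ 0 := th_ne_one (by simp [ha, hy]) (by
      rw [Ne, div_eq_one_iff_eq ha0]; exact (hay k).symm)
    have h4 : (∏ m, t m) / (q * a * ∏ k, y k) / y k = p / ((∏ m, s m) * (a * ∏ k, y k) / (y⁻¹ k)) := by
      simp only [Pi.inv_apply]
      field_simp
      linear_combination hbal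
    rw [h4, th_pdiv (by simp only [Pi.inv_apply]; positivity), vv, inv_div,
      show y k / (q * a) = (y k / a) / q by field_simp, th_divp (div_ne_zero hk ha0),
      ← inv_div (y k) a, th_inv (div_ne_zero hk ha0), Pi.inv_apply, show a⁻¹ / (y k)⁻¹ = y k / a by field_simp]
    field_simp
  rw [e1, e2]
  have e3 : (∏ m, t m) / (q * a * ∏ k, y k) / (q * a) *
      (q ^ (n + 2) * a ^ (2 * n + 4) * (∏ m, s m) / ∏ m, t m) * ((∏ k, y k) ^ 2 / (q ^ n * a ^ (2 * n)))
       = (∏ m, s m) * (a * ∏ k, y k) / a⁻¹ := by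
    field_simp
    ring
  rw [← e3, mul_assoc q a]
  ring

lemma gt_diffAt {n : ℕ} {s t : Fin (n + 2) → ℂ} (hs0 : ∀ m, s m ≠ 0) (ht0 : ∀ m, t m ≠ 0)
    (hs : ∀ m, ‖s m‖ < 1) (ht : ∀ m, ‖t m‖ < 1) {w : ℂ → ℂ}
    (hw : ∀ Z, ‖q‖ ≤ ‖Z‖ → ‖Z‖ ≤ 1 → DifferentiableAt ℂ w Z)
    {V : Type*} [NormedAddCommGroup V] [NormedSpace ℂ V] {v : V} {f : V → ℂ} {g : V → Fin n → ℂ}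
    (hf : DifferentiableAt ℂ f v) (hg : ∀ i, DifferentiableAt ℂ (fun v => g v i) v)
    (ha1 : ‖q‖ ≤ ‖f v‖) (ha2 : ‖f v‖ ≤ 1) (hy : ∀ k, ‖g v k‖ = 1) :
    DifferentiableAt ℂ (fun v => gt p q s t w (f v) (g v)) v := by
  have hq0 := hq.ne
  have hT : ∏ m, t m ≠ 0 := prod_ne ht0
  have ha0 : f v ≠ 0 := by
    intro h; rw [h, norm_zero] at ha1; exact absurd ha1 (not_le.mpr (norm_pos_iff.mpr hq0))
  have hy0 := fun k => ne_of_norm_one (hy k)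
  have hP : ∏ k, g v k ≠ 0 := prod_ne hy0
  have hZ : f v * ∏ k, g v k ≠ 0 := mul_ne_zero ha0 hP
  have dP : DifferentiableAt ℂ (fun v => ∏ k, g v k) v := prod_diffAt fun i _ => hg i
  have dZ : DifferentiableAt ℂ (fun v => f v * ∏ k, g v k) v := hf.fun_mul dP
  have dL : DifferentiableAt ℂ (fun v => (∏ m, t m) / (f v * ∏ k, g v k)) v :=
    div_diffAt (by fun_prop) dZ hZ
  unfold gt
  refine DifferentiableAt.fun_mul (DifferentiableAt.fun_mul (DifferentiableAt.fun_mul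
    (DifferentiableAt.fun_mul ?_ ?_) ?_) ?_) ?_
  · exact div_diffAt dL hf ha0
  · refine prod_diffAt fun m _ => DifferentiableAt.fun_mul (DifferentiableAt.fun_mul ?_ ?_) ?_
    · refine ellGamma_differentiableAt (by fun_prop) (mul_ne_zero (hs0 m) ha0) ?_
      rw [norm_mul]
      exact (mul_le_of_le_one_right (norm_nonneg _) ha2).trans_lt (hs m)
    · refine ellGamma_differentiableAt (DifferentiableAt.fun_mul (by fun_prop) (div_diffAt (by fun_prop) hf ha0))
        (mul_ne_zero hq0 (div_ne_zero (ht0 m) ha0)) ?_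
      rw [norm_mul, norm_div, ← mul_div_assoc, div_lt_one (norm_pos_iff.mpr ha0)]
      exact (mul_lt_of_lt_one_right (norm_pos_iff.mpr hq0) (ht m)).trans_le ha1
    · exact (div_diffAt hf (by fun_prop) (ht0 m)).fun_neg
  · refine prod_diffAt fun k _ => DifferentiableAt.fun_mul ?_ ?_
    · exact th_differentiableAt (div_diffAt (hg k) hf ha0) (div_ne_zero (hy0 k) ha0)
    · exact th_differentiableAt (div_diffAt dL (hg k) (hy0 k)) (div_ne_zero (div_ne_zero hT hZ) (hy0 k))
  · refine DifferentiableAt.fun_mul (prod_diffAt fun j _ => ?_) (VV_diffAt hg hy0)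
    exact Phi_diffAt (hg j) hs0 ht0 (hy0 j) (fun m => by simp [hy, hs]) (fun m => by simp [hy, ht])
  · have hn : ‖f v * ∏ k, g v k‖ = ‖f v‖ := by rw [norm_mul, prod_norm_one hy, mul_one]
    exact DifferentiableAt.comp (g := w) v (hw _ (by rw [hn]; exact ha1) (by rw [hn]; exact ha2)) dZ

end

open MeasureTheory
set_option linter.unusedSectionVars false
set_option linter.unusedVariables false

lemma sum_sym {n : ℕ} {G F : Tor (n + 1) → ℂ} (hG : Continuous G)
    (h : ∀ᵐ x : Tor (n + 1), ∑ i, G (x ∘ Equiv.swap 0 i) = F x) :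
    ∫ x, F x = (n + 1 : ℂ) * ∫ x, G x := by
  rw [← integral_congr_ae h, integral_finsetSum]
  · simp only [int_perm, Finset.sum_const, Finset.card_univ, Fintype.card_fin, nsmul_eq_mul]
    push_cast
    ring
  · intro i _
    apply cont_integrable
    apply hG.comp
    fun_prop

lemma pfTerm_perm (p : ℂ) {N : ℕ} (z : Fin N → ℂ) (t : Fin (N + 1) → ℂ) (l : ℂ) (i : Fin N)
    (σ : Equiv.Perm (Fin N)) : pfTerm p (z ∘ σ) t l i = pfTerm p z t l (σ i) := by
  unfold pfTerm
  rw [← Equiv.prod_comp σ (fun k => if k = σ i then 1 else th p (l / z k) / th p (z (σ i) / z k))]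
  simp only [Function.comp, EmbeddingLike.apply_eq_iff_eq]

section
variable {p q : ℂ} [hp : Nome p] [hq : Nome q]

variable {n : ℕ} {s t : Fin (n + 2) → ℂ}

lemma shift_rel (hs0 : ∀ m, s m ≠ 0) (ht0 : ∀ m, t m ≠ 0)
    (hs : ∀ m, ‖s m‖ < 1) (ht : ∀ m, ‖t m‖ < 1) (hbal : (∏ m, s m) * ∏ m, t m = p * q)
    (hT1 : ‖p‖ ^ 2 < ‖∏ m, t m‖) (hT2 : ‖∏ m, t m‖ < 1) (hT3 : ‖∏ m, t m‖ ≠ ‖p‖)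
    (hS1 : ‖p‖ ^ 2 < ‖∏ m, s m‖) (hS2 : ‖∏ m, s m‖ < 1) (hS3 : ‖∏ m, s m‖ ≠ ‖p‖)
    {w : ℂ → ℂ} (hw : ∀ Z, ‖q‖ ≤ ‖Z‖ → ‖Z‖ ≤ 1 → DifferentiableAt ℂ w Z) :
    ∫ x : Tor (n + 1), Del p q s t (eT x) * (∏ m, th p ((∏ m, t m) / (∏ i, eT x i) / t m)) * w (∏ i, eT x i) =
    ∫ x : Tor (n + 1), Del p q s t (eT x) * (∏ m, th p ((∏ m, s m) * (∏ i, eT x i) / s m)) * w (q * ∏ i, eT x i) := by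
  have hq1 : ‖q‖ ≤ 1 := hq.lt.le
  have hc1 : Continuous fun x : Tor (n + 1) => gt p q s t w (eT x 0) (Fin.tail (eT x)) :=
    cont_of_diffAt (F := fun z : Fin (n + 1) → ℂ => gt p q s t w (z 0) (Fin.tail z)) eT_continuous fun x =>
      gt_diffAt hs0 ht0 hs ht hw (by fun_prop) (fun i => by unfold Fin.tail; fun_prop)
        (by rw [eT_norm]; exact hq1) (by rw [eT_norm]) (fun k => by simp [Fin.tail, eT_norm])
  have hc2 : Continuous fun x : Tor (n + 1) => gt p q s t w (q * eT x 0) (Fin.tail (eT x)) :=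
    cont_of_diffAt (F := fun z : Fin (n + 1) → ℂ => gt p q s t w (q * z 0) (Fin.tail z)) eT_continuous fun x =>
      gt_diffAt hs0 ht0 hs ht hw (by fun_prop) (fun i => by unfold Fin.tail; fun_prop)
        (by rw [norm_mul, eT_norm, mul_one]) (by rw [norm_mul, eT_norm, mul_one]; exact hq1) (fun k => by simp [Fin.tail, eT_norm])
  have hcomp : ∀ (x : Tor (n + 1)) (σ : Equiv.Perm (Fin (n + 1))), eT (x ∘ σ) = eT x ∘ σ := fun x σ => rfl
  rw [sum_sym (F := fun x : Tor (n + 1) => Del p q s t (eT x) * (∏ m, th p ((∏ m, t m) / (∏ i, eT x i) / t m)) * w (∏ i, eT x i)) hc1,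
    sum_sym (F := fun x : Tor (n + 1) => Del p q s t (eT x) * (∏ m, th p ((∏ m, s m) * (∏ i, eT x i) / s m)) * w (q * ∏ i, eT x i)) hc2]
  · congr 1
    rw [int_cons' _ hc1, int_cons' _ hc2]
    congr 1
    ext y
    have h1 : ∀ a : UnitAddCircle, eT (Fin.cons a y : Tor (n + 1)) 0 = ee a := fun a => rfl
    have h2 : ∀ a : UnitAddCircle, Fin.tail (eT (Fin.cons a y : Tor (n + 1))) = eT y := fun a => rfl
    simp only [h1, h2]
    have := contour_A1 (r := q) (R := 1) (F := fun a => gt p q s t w a (eT y)) hq.ne (by simpa using hq1)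
      (fun a ha1 ha2 => gt_diffAt hs0 ht0 hs ht hw (by fun_prop) (fun i => by fun_prop) ha1 (by simpa using ha2)
        (eT_norm y))
    rw [this]
    simp
  · filter_upwards [ae_distinct] with x hx
    have hZ : ‖∏ i, eT x i‖ = 1 := prod_norm_one (eT_norm x)
    have hZ0 := ne_of_norm_one hZ
    have hpf := pf_main (p := p) (fun i => (eT x i)⁻¹) s (fun i => by simp [eT_norm]) (fun i j h => hx (inv_injective h))
      hs0 ((∏ m, s m) * ∏ i, eT x i) (by rw [Finset.prod_inv_distrib]; field_simp)
      (by simpa [hZ] using hS1) (by simpa [hZ] using hS2) (by simpa [hZ] using hS3)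
    rw [← hpf, Finset.mul_sum, Finset.sum_mul]
    refine Finset.sum_congr rfl fun i _ => ?_
    rw [hcomp]
    set z := eT x ∘ Equiv.swap 0 i with hz
    have hz1 : ∀ k, ‖z k‖ = 1 := fun k => eT_norm x _
    have hcs : (Fin.cons (z 0) (Fin.tail z) : Fin (n + 1) → ℂ) = z := Fin.cons_self_tail z
    have hcs' : (Fin.cons (z 0)⁻¹ (Fin.tail z)⁻¹ : Fin (n + 1) → ℂ) = (fun i => (eT x i)⁻¹) ∘ Equiv.swap 0 i := by
      ext k; refine Fin.cases ?_ (fun k => ?_) k <;> simp [hz, Fin.tail]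
    have hprod : z 0 * ∏ k, (Fin.tail z) k = ∏ i, eT x i := by
      rw [← Equiv.prod_comp (Equiv.swap 0 i) (eT x), Fin.prod_univ_succ]; rfl
    rw [gt_at_q (y := Fin.tail z) hs0 ht0 hs ht hbal w (hz1 0) (fun k => hz1 _) (fun k h => by
      have := hx.comp (Equiv.swap 0 i).injective h
      exact absurd this (Fin.succ_ne_zero k).symm), hcs, hcs', hprod, pfTerm_perm, hz,
      Del_perm s t (eT x) (eT_ne x), Equiv.swap_apply_left]
  · filter_upwards [ae_distinct] with x hx
    have hZ : ‖∏ i, eT x i‖ = 1 := prod_norm_one (eT_norm x)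
    have hZ0 := ne_of_norm_one hZ
    have hpf := pf_main (p := p) (eT x) t (eT_norm x) hx
      ht0 ((∏ m, t m) / ∏ i, eT x i) (by field_simp)
      (by simpa [hZ] using hT1) (by simpa [hZ] using hT2) (by simpa [hZ] using hT3)
    rw [← hpf, Finset.mul_sum, Finset.sum_mul]
    refine Finset.sum_congr rfl fun i _ => ?_
    rw [hcomp]
    set z := eT x ∘ Equiv.swap 0 i with hz
    have hz1 : ∀ k, ‖z k‖ = 1 := fun k => eT_norm x _
    have hcs : (Fin.cons (z 0) (Fin.tail z) : Fin (n + 1) → ℂ) = z := Fin.cons_self_tail z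
    have hprod : z 0 * ∏ k, (Fin.tail z) k = ∏ i, eT x i := by
      rw [← Equiv.prod_comp (Equiv.swap 0 i) (eT x), Fin.prod_univ_succ]; rfl
    rw [gt_at (y := Fin.tail z) hs0 ht0 hs ht w (hz1 0) (fun k => hz1 _) (fun k h => by
      have := hx.comp (Equiv.swap 0 i).injective h
      exact absurd this (Fin.succ_ne_zero k).symm), hcs, hprod, pfTerm_perm, hz,
      Del_perm s t (eT x) (eT_ne x), Equiv.swap_apply_left]

end

open MeasureTheory
set_option linter.unusedSectionVars false
set_option linter.unusedVariables false

/-- sliced torus point -/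
noncomputable def slc {n : ℕ} (y : UnitAddCircle) (x : Tor n) : Tor (n + 1) := Fin.snoc x (y - ∑ i, x i)

/-- sliced integral -/
noncomputable def jj (p q : ℂ) {n M : ℕ} (s t : Fin M → ℂ) (y : UnitAddCircle) : ℂ :=
  ∫ x : Tor n, Del p q s t (eT (slc y x))

lemma slc_cont {n : ℕ} : Continuous fun u : UnitAddCircle × Tor n => slc u.1 u.2 := by
  unfold slc; fun_prop

lemma slc_prod {n : ℕ} (y : UnitAddCircle) (x : Tor n) : ∏ i, eT (slc y x) i = ee y := by
  unfold eT
  rw [← ee_sum]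
  congr 1
  unfold slc
  rw [Fin.sum_univ_castSucc]
  simp

/-- the auxiliary weight -/
noncomputable def WW (p q : ℂ) {M : ℕ} (s t : Fin M → ℂ) (Y : ℂ) : ℂ :=
  ∏ m, ellGamma ((∏ m, t m) * s m / Y) p q * ellGamma ((∏ m, s m) * t m * Y) p q

/-- single-variable part of the evaluation -/
noncomputable def RW (p q : ℂ) {M : ℕ} (s t : Fin M → ℂ) (Y : ℂ) : ℂ :=
  ∏ m, ellGamma ((∏ m, s m) / s m * Y) p q * ellGamma ((∏ m, t m) / t m / Y) p q

section
variable {p q : ℂ} [hp : Nome p] [hq : Nome q]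

variable {n : ℕ} {s t : Fin (n + 2) → ℂ}

lemma jj_cont (hs0 : ∀ m, s m ≠ 0) (ht0 : ∀ m, t m ≠ 0)
    (hs : ∀ m, ‖s m‖ < 1) (ht : ∀ m, ‖t m‖ < 1) : Continuous (jj (n := n) p q s t) := by
  have := continuous_parametric_integral_of_continuous (μ := (volume : Measure (Tor n)))
    (f := fun y x => Del p q s t (eT (slc y x)))
    ((Del_cont (p := p) (q := q) (n := n + 1) hs0 ht0 hs ht).comp slc_cont) (s := Set.univ) isCompact_univ
  simp only [setIntegral_univ] at this
  exact this

lemma jj_int (hs0 : ∀ m, s m ≠ 0) (ht0 : ∀ m, t m ≠ 0)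
    (hs : ∀ m, ‖s m‖ < 1) (ht : ∀ m, ‖t m‖ < 1) {F : ℂ → ℂ} (hF : Continuous fun y => F (ee y)) :
    ∫ x : Tor (n + 1), Del p q s t (eT x) * F (∏ i, eT x i) = ∫ y, jj (n := n) p q s t y * F (ee y) := by
  rw [int_slice]
  · congr 1
    ext y
    rw [jj, ← integral_mul_const]
    congr 1
    ext x
    have := slc_prod y x
    rw [slc] at this
    rw [this, slc]
  · refine (Del_cont hs0 ht0 hs ht).mul ?_
    have : ∀ x : Tor (n + 1), ∏ i, eT x i = ee (∑ i, x i) := fun x => by rw [ee_sum]; rfl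
    simp only [this]
    exact hF.comp (by fun_prop : Continuous fun x : Tor (n + 1) => ∑ i, x i)

lemma WW_diffAt (hs0 : ∀ m, s m ≠ 0) (ht0 : ∀ m, t m ≠ 0) {b c Y : ℂ} (hY : Y ≠ 0) (hb : b ≠ 0) (hc : c ≠ 0)
    (h1 : ∀ m, ‖b * s m / Y‖ < 1) (h2 : ∀ m, ‖c * t m * Y‖ < 1) :
    DifferentiableAt ℂ (fun Y => ∏ m, ellGamma (b * s m / Y) p q * ellGamma (c * t m * Y) p q) Y := by
  refine prod_diffAt fun m _ => DifferentiableAt.fun_mul ?_ ?_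
  · exact ellGamma_differentiableAt (div_diffAt (by fun_prop) (by fun_prop) hY)
      (div_ne_zero (mul_ne_zero hb (hs0 m)) hY) (h1 m)
  · exact ellGamma_differentiableAt (by fun_prop) (mul_ne_zero (mul_ne_zero hc (ht0 m)) hY) (h2 m)

lemma jj_W_const (hs0 : ∀ m, s m ≠ 0) (ht0 : ∀ m, t m ≠ 0)
    (hs : ∀ m, ‖s m‖ < 1) (ht : ∀ m, ‖t m‖ < 1) (hbal : (∏ m, s m) * ∏ m, t m = p * q)
    (hT1 : ‖p‖ ^ 2 < ‖∏ m, t m‖) (hT2 : ‖∏ m, t m‖ < 1) (hT3 : ‖∏ m, t m‖ ≠ ‖p‖)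
    (hS1 : ‖p‖ ^ 2 < ‖∏ m, s m‖) (hS2 : ‖∏ m, s m‖ < 1) (hS3 : ‖∏ m, s m‖ ≠ ‖p‖)
    (hTs : ∀ m, ‖(∏ m, t m) * s m‖ < ‖q‖) (hSt : ∀ m, ‖(∏ m, s m) * t m‖ < ‖q‖) :
    ∀ x y, jj (n := n) p q s t x * WW p q s t (ee x) = jj (n := n) p q s t y * WW p q s t (ee y) := by
  have hq0 := hq.ne
  have hp0 := hp.ne
  have hqn : 0 < ‖q‖ := norm_pos_iff.mpr hq0
  have hS0 : ∏ m, s m ≠ 0 := prod_ne hs0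
  have hT0 : ∏ m, t m ≠ 0 := prod_ne ht0
  have hWc : Continuous fun y => WW p q s t (ee y) :=
    cont_of_diffAt (F := WW p q s t) ee_continuous fun y => WW_diffAt hs0 ht0 (ee_ne y) hT0 hS0
      (fun m => by rw [norm_div, norm_ee, div_one]; exact (hTs m).trans hq.lt)
      (fun m => by rw [norm_mul _ (ee y), norm_ee, mul_one]; exact (hSt m).trans hq.lt)
  refine const_of_fourier (fun y => jj (n := n) p q s t y * WW p q s t (ee y)) ((jj_cont hs0 ht0 hs ht).mul hWc) ?_
  intro k hk
  have hkc : Continuous fun y => WW p q s t (ee y) * ee y ^ (-k) :=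
    hWc.mul (ee_continuous.zpow₀ _ (fun y => Or.inl (ee_ne y)))
  simp only [mul_assoc]
  rw [← jj_int (F := fun Y => WW p q s t Y * Y ^ (-k)) hs0 ht0 hs ht hkc]
  have key := shift_rel hs0 ht0 hs ht hbal hT1 hT2 hT3 hS1 hS2 hS3
    (w := fun Y => (∏ m, ellGamma ((∏ m, t m) * s m / Y) p q * ellGamma ((∏ m, s m) / q * t m * Y) p q) * Y ^ (-k))
    (fun Z h1 h2 => by
      have hZp : 0 < ‖Z‖ := hqn.trans_le h1
      have hZ0 : Z ≠ 0 := norm_pos_iff.mp hZp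
      refine DifferentiableAt.fun_mul (WW_diffAt hs0 ht0 hZ0 hT0 (div_ne_zero hS0 hq0) (fun m => ?_) (fun m => ?_)) ?_
      · rw [norm_div, div_lt_one hZp]
        exact (hTs m).trans_le h1
      · rw [norm_mul _ Z]
        refine (mul_le_of_le_one_right (norm_nonneg _) h2).trans_lt ?_
        rw [div_mul_eq_mul_div, norm_div, div_lt_one hqn]
        exact hSt m
      · exact differentiableAt_zpow.mpr (Or.inl hZ0))
  have e1 : ∀ Z : ℂ, ‖Z‖ = 1 → (∏ m, th p ((∏ m, t m) / Z / t m)) *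
      ((∏ m, ellGamma ((∏ m, t m) * s m / Z) p q * ellGamma ((∏ m, s m) / q * t m * Z) p q) * Z ^ (-k)) =
      WW p q s t Z * Z ^ (-k) := by
    intro Z hZ
    have hZ0 := ne_of_norm_one hZ
    rw [← mul_assoc, WW, ← Finset.prod_mul_distrib]
    congr 1
    refine Finset.prod_congr rfl fun m _ => ?_
    have hm := ht0 m
    have h1 : (∏ m, s m) / q * t m * Z ≠ 0 := by positivity
    have h2 : ‖(∏ m, s m) / q * t m * Z‖ < 1 := by
      rw [norm_mul _ Z, hZ, mul_one, div_mul_eq_mul_div, norm_div, div_lt_one hqn]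
      exact hSt m
    have h3 : (∏ m, s m) / q * t m * Z = p / ((∏ m, t m) / Z / t m) := by
      field_simp; linear_combination hbal
    have h4 : (∏ m, s m) * t m * Z = q * ((∏ m, s m) / q * t m * Z) := by field_simp
    rw [h4, ellGamma_q h1 h2, h3, th_pdiv (by positivity)]
    ring
  have e2 : ∀ Z : ℂ, ‖Z‖ = 1 → (∏ m, th p ((∏ m, s m) * Z / s m)) *
      ((∏ m, ellGamma ((∏ m, t m) * s m / (q * Z)) p q * ellGamma ((∏ m, s m) / q * t m * (q * Z)) p q) * (q * Z) ^ (-k)) =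
      WW p q s t Z * Z ^ (-k) * q ^ (-k) := by
    intro Z hZ
    have hZ0 := ne_of_norm_one hZ
    rw [← mul_assoc, WW, ← Finset.prod_mul_distrib, mul_zpow, mul_comm (q ^ (-k)), ← mul_assoc]
    congr 2
    refine Finset.prod_congr rfl fun m _ => ?_
    have hm := hs0 m
    have h1 : (∏ m, t m) * s m / (q * Z) ≠ 0 := by positivity
    have h2 : ‖(∏ m, t m) * s m / (q * Z)‖ < 1 := by
      rw [norm_div, norm_mul q, hZ, mul_one, div_lt_one hqn]
      exact hTs m
    have h3 : (∏ m, t m) * s m / (q * Z) = p / ((∏ m, s m) * Z / s m) := by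
      field_simp; linear_combination hbal
    have h4 : (∏ m, t m) * s m / Z = q * ((∏ m, t m) * s m / (q * Z)) := by field_simp
    have h5 : (∏ m, s m) / q * t m * (q * Z) = (∏ m, s m) * t m * Z := by field_simp
    rw [h4, h5, ellGamma_q h1 h2, h3, th_pdiv (by positivity)]
    ring
  simp only [mul_assoc] at key e1 e2
  have key2 : ∫ x : Tor (n + 1), Del p q s t (eT x) * (WW p q s t (∏ i, eT x i) * (∏ i, eT x i) ^ (-k)) =
      ∫ x : Tor (n + 1), Del p q s t (eT x) * (WW p q s t (∏ i, eT x i) * (∏ i, eT x i) ^ (-k)) * q ^ (-k) := by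
    convert key using 2
    · ext x
      rw [e1 _ (prod_norm_one (eT_norm x))]
    · ext x
      rw [e2 _ (prod_norm_one (eT_norm x))]
      ring
  rw [integral_mul_const] at key2
  have hqk : (1 : ℂ) - q ^ (-k) ≠ 0 := by
    apply one_sub_ne
    rw [norm_zpow]
    intro h
    rw [zpow_eq_one_iff_right₀ (norm_nonneg _) hq.lt.ne] at h
    exact hk (neg_eq_zero.mp h)
  have : (∫ x : Tor (n + 1), Del p q s t (eT x) * (WW p q s t (∏ i, eT x i) * (∏ i, eT x i) ^ (-k))) * (1 - q ^ (-k)) = 0 := by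
    linear_combination key2
  exact (mul_eq_zero.mp this).resolve_right hqk

lemma div_norm_lt (hs0 : ∀ m, s m ≠ 0) (hs : ∀ m, ‖s m‖ < 1) (m : Fin (n + 2)) : ‖(∏ m, s m) / s m‖ < 1 := by
  have h : (∏ m, s m) / s m = ∏ i ∈ Finset.univ.erase m, s i := by
    rw [← Finset.mul_prod_erase _ _ (Finset.mem_univ m)]
    have := hs0 m
    field_simp
  rw [h, norm_prod]
  have hc : (Finset.univ.erase m).Nonempty := by
    rw [← Finset.card_pos, Finset.card_erase_of_mem (Finset.mem_univ m)]
    simp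
  calc _ < ∏ i ∈ Finset.univ.erase m, (1 : ℝ) :=
        Finset.prod_lt_prod_of_nonempty (fun i _ => norm_pos_iff.mpr (hs0 i)) (fun i _ => hs i) hc
    _ = 1 := by simp

lemma WW_RW (hs0 : ∀ m, s m ≠ 0) (ht0 : ∀ m, t m ≠ 0)
    (hs : ∀ m, ‖s m‖ < 1) (ht : ∀ m, ‖t m‖ < 1) (hbal : (∏ m, s m) * ∏ m, t m = p * q)
    (hT2 : ‖∏ m, t m‖ < 1) (hS2 : ‖∏ m, s m‖ < 1) {Y : ℂ} (hY : ‖Y‖ = 1) :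
    WW p q s t Y * RW p q s t Y = 1 := by
  have hY0 := ne_of_norm_one hY
  have hS0 : ∏ m, s m ≠ 0 := prod_ne hs0
  have hT0 : ∏ m, t m ≠ 0 := prod_ne ht0
  rw [WW, RW, ← Finset.prod_mul_distrib]
  refine Finset.prod_eq_one fun m _ => ?_
  have h1 := hs0 m
  have h2 := ht0 m
  have e1 : (∏ m, s m) / s m * Y = p * q / ((∏ m, t m) * s m / Y) := by
    rw [← hbal]; field_simp
  have e2 : (∏ m, t m) / t m / Y = p * q / ((∏ m, s m) * t m * Y) := by
    rw [← hbal]; field_simp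
  have r1 := ellGamma_refl (p := p) (q := q) (x := (∏ m, t m) * s m / Y) (by positivity)
    (by rw [norm_div, hY, norm_mul, div_one]; nlinarith [norm_nonneg (s m), norm_nonneg (∏ m, t m), hs m])
    (by rw [← e1, norm_mul _ Y, hY, mul_one]; exact div_norm_lt hs0 hs m)
  have r2 := ellGamma_refl (p := p) (q := q) (x := (∏ m, s m) * t m * Y) (by positivity)
    (by rw [norm_mul, hY, norm_mul, mul_one]; nlinarith [norm_nonneg (t m), norm_nonneg (∏ m, s m), ht m])
    (by rw [← e2, norm_div _ Y, hY, div_one]; exact div_norm_lt ht0 ht m)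
  rw [e1, e2]
  linear_combination r1 * (ellGamma ((∏ m, s m) * t m * Y) p q * ellGamma (p * q / ((∏ m, s m) * t m * Y)) p q) + r2

lemma jj_eq (hs0 : ∀ m, s m ≠ 0) (ht0 : ∀ m, t m ≠ 0)
    (hs : ∀ m, ‖s m‖ < 1) (ht : ∀ m, ‖t m‖ < 1) (hbal : (∏ m, s m) * ∏ m, t m = p * q)
    (hT1 : ‖p‖ ^ 2 < ‖∏ m, t m‖) (hT2 : ‖∏ m, t m‖ < 1) (hT3 : ‖∏ m, t m‖ ≠ ‖p‖)
    (hS1 : ‖p‖ ^ 2 < ‖∏ m, s m‖) (hS2 : ‖∏ m, s m‖ < 1) (hS3 : ‖∏ m, s m‖ ≠ ‖p‖)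
    (hTs : ∀ m, ‖(∏ m, t m) * s m‖ < ‖q‖) (hSt : ∀ m, ‖(∏ m, s m) * t m‖ < ‖q‖) :
    ∃ C : ℂ, ∀ y, jj (n := n) p q s t y = C * RW p q s t (ee y) := by
  refine ⟨jj (n := n) p q s t 0 * WW p q s t (ee 0), fun y => ?_⟩
  rw [jj_W_const hs0 ht0 hs ht hbal hT1 hT2 hT3 hS1 hS2 hS3 hTs hSt 0 y, mul_assoc,
    WW_RW hs0 ht0 hs ht hbal hT2 hS2 (norm_ee y), mul_one]

end

open MeasureTheory Filter Topology
set_option linter.unusedSectionVars false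
set_option linter.unusedVariables false

/-- asymptotic kernel -/
noncomputable def KK (k : ℕ) (u z : ℂ) : ℂ := ((u * z)⁻¹) ^ k * (1 - u * z)⁻¹

lemma KK_cont {X : Type*} [TopologicalSpace X] {k : ℕ} {u : ℂ} (hu : u ≠ 0) {f : X → ℂ} (hf : Continuous f)
    (h0 : ∀ x, f x ≠ 0) (h1 : ∀ x, ‖u * f x‖ ≠ 1) : Continuous fun x => KK k u (f x) := by
  unfold KK
  exact (((continuous_const.mul hf).inv₀ (fun x => mul_ne_zero hu (h0 x))).pow k).mul
    ((continuous_const.sub (continuous_const.mul hf)).inv₀ (fun x => one_sub_ne (h1 x)))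

lemma KK_step {k : ℕ} {u : ℂ} {ρ : ℝ} (hu0 : u ≠ 0) (hu1 : ‖u‖ < 1) (hρ : 1 < ρ * ‖u‖)
    {g : ℂ → ℂ} (hg : ∀ z, 1 ≤ ‖z‖ → ‖z‖ ≤ ρ → DifferentiableAt ℂ g z) :
    ∫ a, KK k u (ee a) * g (ee a) = g u⁻¹ + ∫ a, KK k u (ρ * ee a) * g (ρ * ee a) := by
  have hup : 0 < ‖u‖ := norm_pos_iff.mpr hu0
  have hρ0 : 0 < ρ := by
    by_contra h
    push Not at h
    nlinarith
  have hρn : ‖(ρ : ℂ)‖ = ρ := by simp [abs_of_pos hρ0]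
  have h := contour_A2 (r := 1) (R := (ρ : ℂ)) (x := u⁻¹) (g := fun z => ((u * z)⁻¹) ^ k * g z) one_ne_zero
    (by rw [norm_one, norm_inv]; exact (one_lt_inv₀ hup).mpr hu1)
    (by rw [hρn, norm_inv, inv_lt_iff_one_lt_mul₀ hup]; exact hρ)
    (fun w h1 h2 => by
      rw [norm_one] at h1
      rw [hρn] at h2
      have hw0 : w ≠ 0 := by rintro rfl; norm_num at h1
      refine DifferentiableAt.fun_mul ?_ (hg w h1 h2)
      exact (DifferentiableAt.fun_inv (by fun_prop) (mul_ne_zero hu0 hw0)).fun_pow k)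
  have e : ∀ z : ℂ, KK k u z * g z = (u * z)⁻¹ ^ k * g z * (1 - z / u⁻¹)⁻¹ := by
    intro z
    rw [KK, div_inv_eq_mul, mul_comm z u]
    ring
  simp only [e]
  simpa [hu0] using h

/-- the polyannulus -/
def ann {N : ℕ} (ρ : ℝ) (z : Fin N → ℂ) : Prop := ∀ j, 1 ≤ ‖z j‖ ∧ ‖z j‖ ≤ ρ

lemma ann_ne {N : ℕ} {ρ : ℝ} {z : Fin N → ℂ} (h : ann ρ z) (j) : z j ≠ 0 := by
  intro h0
  have := (h j).1
  rw [h0] at this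
  norm_num at this

lemma ann_cons {N : ℕ} {ρ : ℝ} {z : Fin N → ℂ} {a : ℂ} (h : ann ρ z) (h1 : 1 ≤ ‖a‖) (h2 : ‖a‖ ≤ ρ) :
    ann ρ (Fin.cons a z : Fin (N + 1) → ℂ) := by
  intro j
  refine Fin.cases ?_ (fun j => ?_) j
  · exact ⟨h1, h2⟩
  · simpa using h j

lemma kernel_bound {ρ θ : ℝ} (hρ1 : 1 < ρ) (hθ1 : θ ≤ 1) (hθ0 : 0 ≤ θ) : ∀ {N : ℕ} (u : Fin N → ℂ)
    (hu0 : ∀ j, u j ≠ 0) (hu1 : ∀ j, ‖u j‖ < 1) (hρ : ∀ j, 1 < ρ * ‖u j‖)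
    (hθ : ∀ j, (ρ * ‖u j‖)⁻¹ ≤ θ),
    ∃ B : ℝ, 0 ≤ B ∧ ∀ (g : (Fin N → ℂ) → ℂ) (M : ℝ) (k : ℕ), (∀ z, ann ρ z → DifferentiableAt ℂ g z) →
      (∀ z, ann ρ z → ‖g z‖ ≤ M) →
      ‖(∫ x : Tor N, (∏ j, KK k (u j) (eT x j)) * g (eT x)) - g (fun j => (u j)⁻¹)‖ ≤ B * M * θ ^ k := by
  intro N
  induction N with
  | zero =>
    intro u _ _ _ _
    refine ⟨0, le_rfl, fun g M k hg hM => ?_⟩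
    have : ∀ x : Tor 0, eT x = fun j => (u j)⁻¹ := fun x => Subsingleton.elim _ _
    simp [this]
  | succ N ih =>
    intro u hu0 hu1 hρ hθ
    obtain ⟨B, hB0, hB⟩ := ih (fun j => u j.succ) (fun j => hu0 _) (fun j => hu1 _) (fun j => hρ _) (fun j => hθ _)
    have hd : 0 < ρ * ‖u 0‖ - 1 := by linarith [hρ 0]
    refine ⟨B + (1 + B) * (ρ * ‖u 0‖ - 1)⁻¹, by positivity, fun g M k hg hM => ?_⟩
    have hρ0 : 0 < ρ := by linarith
    have hρn : ‖(ρ : ℂ)‖ = ρ := by simp [abs_of_pos hρ0]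
    have hupos : ∀ j, 0 < ‖u j‖ := fun j => norm_pos_iff.mpr (hu0 j)
    have hui : ∀ j, 1 ≤ ‖(u j)⁻¹‖ ∧ ‖(u j)⁻¹‖ ≤ ρ := fun j => by
      rw [norm_inv]
      exact ⟨(one_le_inv₀ (hupos j)).mpr (hu1 j).le, by rw [inv_le_iff_one_le_mul₀ (hupos j)]; exact (hρ j).le⟩
    have heT : ∀ {m : ℕ} (x : Tor m), ann ρ (eT x) := fun x j => by
      rw [eT_norm]; exact ⟨le_rfl, hρ1.le⟩
    have hρe : ∀ a : UnitAddCircle, 1 ≤ ‖(ρ : ℂ) * ee a‖ ∧ ‖(ρ : ℂ) * ee a‖ ≤ ρ := fun a => by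
      rw [norm_mul, norm_ee, hρn, mul_one]; exact ⟨hρ1.le, le_rfl⟩
    have hM0 : 0 ≤ M := (norm_nonneg _).trans (hM (fun j => (u j)⁻¹) hui)
    -- continuity facts
    have hKc : ∀ {m : ℕ} (v : Fin m → ℂ), (∀ j, v j ≠ 0) → (∀ j, ‖v j‖ < 1) →
        Continuous fun x : Tor m => ∏ j, KK k (v j) (eT x j) := fun v h0 h1 =>
      continuous_finsetProd _ fun j _ => KK_cont (h0 j) (by unfold eT; fun_prop) (fun x => eT_ne x j)
        (fun x => by rw [norm_mul, eT_norm, mul_one]; exact (h1 j).ne)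
    have hgc : Continuous fun x : Tor (N + 1) => g (eT x) :=
      cont_of_diffAt eT_continuous fun x => hg _ (heT x)
    have hdc : ∀ {a : ℂ} {y : Fin N → ℂ}, 1 ≤ ‖a‖ → ‖a‖ ≤ ρ → ann ρ y →
        DifferentiableAt ℂ g (Fin.cons a y : Fin (N + 1) → ℂ) := fun h1 h2 hy => hg _ (ann_cons hy h1 h2)
    have hcd : ∀ (a : ℂ) (y : Fin N → ℂ), DifferentiableAt ℂ (fun y => (Fin.cons a y : Fin (N + 1) → ℂ)) y := by
      intro a y
      rw [differentiableAt_pi]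
      intro j
      refine Fin.cases ?_ (fun j => ?_) j
      · simp
      · simp only [Fin.cons_succ]; fun_prop
    have hcd' : ∀ (a : ℂ) (y : Fin N → ℂ), DifferentiableAt ℂ (fun a => (Fin.cons a y : Fin (N + 1) → ℂ)) a := by
      intro a y
      rw [differentiableAt_pi]
      intro j
      refine Fin.cases ?_ (fun j => ?_) j
      · simp
      · simp only [Fin.cons_succ]; fun_prop
    have hg1 : ∀ {a : ℂ}, 1 ≤ ‖a‖ → ‖a‖ ≤ ρ → ∀ y, ann ρ y →
        DifferentiableAt ℂ (fun y => g (Fin.cons a y : Fin (N + 1) → ℂ)) y := fun h1 h2 y hy =>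
      DifferentiableAt.comp (g := g) y (hdc h1 h2 hy) (hcd _ _)
    have hg2 : ∀ {y : Fin N → ℂ}, ann ρ y → ∀ a, 1 ≤ ‖a‖ → ‖a‖ ≤ ρ →
        DifferentiableAt ℂ (fun a => g (Fin.cons a y : Fin (N + 1) → ℂ)) a := fun hy a h1 h2 =>
      DifferentiableAt.comp (g := g) a (hdc h1 h2 hy) (hcd' _ _)
    have hg3 : Continuous fun x : UnitAddCircle × Tor N => g (Fin.cons (ρ * ee x.1) (eT x.2) : Fin (N + 1) → ℂ) :=
      cont_of_diffAt (e := fun x : UnitAddCircle × Tor N => (Fin.cons (ρ * ee x.1) (eT x.2) : Fin (N + 1) → ℂ))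
        (by fun_prop) fun x => hdc (hρe _).1 (hρe _).2 (heT _)
    set Q : Tor N → ℂ := fun y => ∏ j, KK k (u j.succ) (eT y j) with hQ
    have hQc : Continuous Q := hKc (fun j => u j.succ) (fun j => hu0 _) (fun j => hu1 _)
    have hK0 : Continuous fun a : UnitAddCircle => KK k (u 0) (ρ * ee a) :=
      KK_cont (hu0 0) (by fun_prop) (fun a => by simp [hρ0.ne']) (fun a => by
        rw [norm_mul, norm_mul, norm_ee, hρn, mul_one, mul_comm]; exact (hρ 0).ne')
    have split : ∫ x : Tor (N + 1), (∏ j, KK k (u j) (eT x j)) * g (eT x) =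
        (∫ y : Tor N, Q y * g (Fin.cons (u 0)⁻¹ (eT y) : Fin (N + 1) → ℂ)) +
          ∫ a, KK k (u 0) (ρ * ee a) * ∫ y : Tor N, Q y * g (Fin.cons (ρ * ee a) (eT y) : Fin (N + 1) → ℂ) := by
      rw [int_cons' (fun x : Tor (N + 1) => (∏ j, KK k (u j) (eT x j)) * g (eT x)) ((hKc u hu0 hu1).mul hgc)]
      have h1 : ∀ (a : UnitAddCircle) (y : Tor N), eT (Fin.cons a y : Tor (N + 1)) = Fin.cons (ee a) (eT y) := by
        intro a y; ext j; refine Fin.cases ?_ (fun j => ?_) j <;> rfl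
      have h2 : ∀ y : Tor N, ∫ a, (∏ j, KK k (u j) (eT (Fin.cons a y : Tor (N + 1)) j)) * g (eT (Fin.cons a y : Tor (N + 1))) =
          Q y * g (Fin.cons (u 0)⁻¹ (eT y) : Fin (N + 1) → ℂ) +
            ∫ a, Q y * (KK k (u 0) (ρ * ee a) * g (Fin.cons (ρ * ee a) (eT y) : Fin (N + 1) → ℂ)) := by
        intro y
        rw [integral_const_mul, ← mul_add, ← KK_step (g := fun a => g (Fin.cons a (eT y) : Fin (N + 1) → ℂ))
          (hu0 0) (hu1 0) (hρ 0) (hg2 (heT y)), ← integral_const_mul]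
        congr 1
        ext a
        rw [h1, Fin.prod_univ_succ]
        simp only [Fin.cons_zero, Fin.cons_succ, hQ]
        ring
      simp only [h2]
      have hc2 : Continuous fun x : Tor N × UnitAddCircle => Q x.1 * (KK k (u 0) (ρ * ee x.2) *
          g (Fin.cons (ρ * ee x.2) (eT x.1) : Fin (N + 1) → ℂ)) :=
        (hQc.comp continuous_fst).mul ((hK0.comp continuous_snd).mul (hg3.comp continuous_swap))
      rw [integral_add]
      · congr 1
        rw [integral_integral_swap (cont_integrable hc2)]
        congr 1
        ext a
        rw [← integral_const_mul]
        congr 1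
        ext y
        ring
      · apply cont_integrable
        refine hQc.mul ?_
        exact cont_of_diffAt (F := fun y => g (Fin.cons (u 0)⁻¹ y : Fin (N + 1) → ℂ)) eT_continuous
          fun x => hg1 (hui 0).1 (hui 0).2 _ (heT x)
      · exact (cont_integrable (μ := (volume : Measure (Tor N)).prod volume) hc2).integral_prod_left
    have hlast : (fun j => (u j)⁻¹) = (Fin.cons (u 0)⁻¹ (fun j => (u (Fin.succ j))⁻¹) : Fin (N + 1) → ℂ) := by
      ext j; refine Fin.cases ?_ (fun j => ?_) j <;> rfl
    have b1 := hB (fun y => g (Fin.cons (u 0)⁻¹ y : Fin (N + 1) → ℂ)) M k (hg1 (hui 0).1 (hui 0).2)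
      (fun z hz => hM _ (ann_cons hz (hui 0).1 (hui 0).2))
    have hθk : θ ^ k ≤ 1 := pow_le_one₀ hθ0 hθ1
    have hθk0 : 0 ≤ θ ^ k := pow_nonneg hθ0 k
    have b2 : ∀ a : UnitAddCircle, ‖KK k (u 0) (ρ * ee a) * ∫ y : Tor N, Q y * g (Fin.cons (ρ * ee a) (eT y) : Fin (N + 1) → ℂ)‖
        ≤ θ ^ k * (ρ * ‖u 0‖ - 1)⁻¹ * ((1 + B) * M) := by
      intro a
      have c1 := hB (fun y => g (Fin.cons (ρ * ee a) y : Fin (N + 1) → ℂ)) M k (hg1 (hρe a).1 (hρe a).2)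
        (fun z hz => hM _ (ann_cons hz (hρe a).1 (hρe a).2))
      have c2 := hM _ (ann_cons (z := fun j => (u (Fin.succ j))⁻¹) (fun j => hui _) (hρe a).1 (hρe a).2)
      have c3 : ‖∫ y : Tor N, Q y * g (Fin.cons (ρ * ee a) (eT y) : Fin (N + 1) → ℂ)‖ ≤ (1 + B) * M := by
        have := norm_le_norm_sub_add (∫ y : Tor N, Q y * g (Fin.cons (ρ * ee a) (eT y) : Fin (N + 1) → ℂ))
          (g (Fin.cons (ρ * ee a) (fun j => (u (Fin.succ j))⁻¹) : Fin (N + 1) → ℂ))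
        have c4 : B * M * θ ^ k ≤ B * M := mul_le_of_le_one_right (by positivity) hθk
        calc _ ≤ _ := this
          _ ≤ B * M * θ ^ k + M := add_le_add c1 c2
          _ ≤ _ := by linarith
      rw [norm_mul]
      refine mul_le_mul ?_ c3 (norm_nonneg _) (by positivity)
      have hn : ‖u 0 * (ρ * ee a)‖ = ρ * ‖u 0‖ := by
        rw [norm_mul, norm_mul, norm_ee, hρn, mul_one, mul_comm]
      rw [KK, norm_mul, norm_pow, norm_inv, norm_inv, hn]
      refine mul_le_mul (pow_le_pow_left₀ (by have := hupos 0; positivity) (hθ 0) k) ?_ (by positivity) hθk0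
      apply inv_anti₀ hd
      have := norm_sub_norm_le (u 0 * (ρ * ee a)) 1
      rw [hn, norm_one, norm_sub_rev] at this
      exact this
    have b3 := norm_integral_le_of_norm_le_const (μ := (volume : Measure UnitAddCircle)) (Eventually.of_forall b2)
    rw [split, hlast]
    rw [probReal_univ, mul_one] at b3
    calc _ = ‖((∫ y : Tor N, Q y * g (Fin.cons (u 0)⁻¹ (eT y) : Fin (N + 1) → ℂ)) - g (Fin.cons (u 0)⁻¹ (fun j => (u (Fin.succ j))⁻¹) : Fin (N + 1) → ℂ)) +
          ∫ a, KK k (u 0) (ρ * ee a) * ∫ y : Tor N, Q y * g (Fin.cons (ρ * ee a) (eT y) : Fin (N + 1) → ℂ)‖ := by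
            congr 1; ring
      _ ≤ B * M * θ ^ k + θ ^ k * (ρ * ‖u 0‖ - 1)⁻¹ * ((1 + B) * M) := (norm_add_le _ _).trans (add_le_add b1 b3)
      _ = _ := by ring

lemma ann_compact {N : ℕ} {ρ : ℝ} : IsCompact {z : Fin N → ℂ | ann ρ z} := by
  have : {z : Fin N → ℂ | ann ρ z} = Set.pi Set.univ fun _ => {w : ℂ | 1 ≤ ‖w‖ ∧ ‖w‖ ≤ ρ} := by
    ext z; simp [ann]
  rw [this]
  refine isCompact_univ_pi fun _ => ?_
  refine (isCompact_closedBall (0 : ℂ) ρ).of_isClosed_subset ?_ ?_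
  · exact (isClosed_le continuous_const continuous_norm).inter (isClosed_le continuous_norm continuous_const)
  · intro w hw; simpa using hw.2

lemma kernel_lim {ρ : ℝ} (hρ1 : 1 < ρ) {N : ℕ} (u : Fin N → ℂ)
    (hu0 : ∀ j, u j ≠ 0) (hu1 : ∀ j, ‖u j‖ < 1) (hρ : ∀ j, 1 < ρ * ‖u j‖)
    (g : (Fin N → ℂ) → ℂ) (hg : ∀ z, ann ρ z → DifferentiableAt ℂ g z) :
    Tendsto (fun k : ℕ => ∫ x : Tor N, (∏ j, KK k (u j) (eT x j)) * g (eT x)) atTop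
      (𝓝 (g (fun j => (u j)⁻¹))) := by
  obtain ⟨θ, hθ0, hθ1, hθ⟩ : ∃ θ : ℝ, 0 ≤ θ ∧ θ < 1 ∧ ∀ j, (ρ * ‖u j‖)⁻¹ ≤ θ := by
    rcases isEmpty_or_nonempty (Fin N) with h | h
    · exact ⟨0, le_rfl, one_pos, fun j => h.elim j⟩
    · obtain ⟨j0, hj0⟩ := Finite.exists_max (fun j => (ρ * ‖u j‖)⁻¹)
      exact ⟨_, inv_nonneg.mpr (by positivity), inv_lt_one_of_one_lt₀ (hρ j0), hj0⟩
  obtain ⟨B, hB0, hB⟩ := kernel_bound hρ1 hθ1.le hθ0 u hu0 hu1 hρ hθ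
  obtain ⟨M, hM⟩ := ann_compact.exists_bound_of_continuousOn (f := g) (s := {z : Fin N → ℂ | ann ρ z})
    fun z hz => (hg z hz).continuousAt.continuousWithinAt
  rw [tendsto_iff_norm_sub_tendsto_zero]
  refine squeeze_zero (fun _ => norm_nonneg _) (fun k => hB g M k hg hM) ?_
  have := (tendsto_pow_atTop_nhds_zero_of_lt_one hθ0 hθ1).const_mul (B * M)
  simpa using this

open MeasureTheory Filter Topology
set_option linter.unusedSectionVars false
set_option linter.unusedVariables false

lemma prod_offdiag {N : ℕ} (f : Fin N → Fin N → ℂ) :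
    (∏ i, ∏ l, if l = i then 1 else f i l) = ∏ i, ∏ l ∈ Finset.Ioi i, f i l * f l i := by
  have h1 : ∀ i l : Fin N, (if l = i then 1 else f i l) =
      (if i < l then f i l else 1) * (if l < i then f i l else 1) := by
    intro i l
    rcases lt_trichotomy i l with h | h | h
    · simp [h, h.ne', h.not_gt]
    · simp [h]
    · simp [h, h.ne, h.not_gt]
  have h2 : ∀ i : Fin N, Finset.Ioi i = Finset.univ.filter (fun l => i < l) := by
    intro i; ext l; simp
  simp only [h1, h2, Finset.prod_mul_distrib, Finset.prod_filter]
  congr 1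
  rw [Finset.prod_comm]

lemma cauchy_row {N : ℕ} {u : Fin N → ℂ} (hu0 : ∀ j, u j ≠ 0) (hu : Function.Injective u)
    (k : Fin N) {w : ℂ} (hw : ∀ i, 1 - u i * w ≠ 0) :
    w ^ (k : ℕ) * ∏ i, (1 - u i * w)⁻¹ =
      ∑ i, (1 - u i * w)⁻¹ * ((u i)⁻¹ ^ (k : ℕ) * ∏ l, if l = i then 1 else (1 - u l * (u i)⁻¹)⁻¹) := by
  have hL := lagrange_pow (v := fun i => (u i)⁻¹) (fun i j h => hu (inv_injective h)) (k := k)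
    (by simp) (w := w) (fun i h => hw i (by rw [h]; simp [hu0 i]))
  have e1 : ∀ i, (w - (u i)⁻¹)⁻¹ = (-(u i)) * (1 - u i * w)⁻¹ := by
    intro i
    have := hu0 i
    have h2 := hw i
    have h3 : w - (u i)⁻¹ = -(1 - u i * w) / u i := by field_simp; ring
    rw [h3]
    field_simp
  have e2 : ∀ i, (∏ l, if l = i then 1 else ((u i)⁻¹ - (u l)⁻¹)⁻¹) =
      (∏ l, if l = i then 1 else (-(u l))) * (∏ l, if l = i then 1 else (1 - u l * (u i)⁻¹)⁻¹) := by
    intro i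
    rw [← prod_ite_mul]
    refine Finset.prod_congr rfl fun l _ => ?_
    split_ifs with h
    · rfl
    · have h1 := hu0 i
      have h2 := hu0 l
      have h4 : u i - u l ≠ 0 := sub_ne_zero.mpr fun h' => h (hu h').symm
      have h3 : (u i)⁻¹ - (u l)⁻¹ = -(1 - u l * (u i)⁻¹) / u l := by field_simp; ring
      have h5 : 1 - u l * (u i)⁻¹ ≠ 0 := by
        have : 1 - u l * (u i)⁻¹ = (u i - u l) / u i := by field_simp
        rw [this]; exact div_ne_zero h4 h1
      rw [h3]
      field_simp
  have hP : ∏ i, (-(u i)) ≠ 0 := prod_ne fun i => neg_ne_zero.mpr (hu0 i)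
  simp only [e1, e2, Finset.prod_mul_distrib] at hL
  apply mul_left_cancel₀ hP
  rw [Finset.mul_sum]
  calc _ = w ^ (k : ℕ) * ((∏ i, (-(u i))) * ∏ i, (1 - u i * w)⁻¹) := by ring
    _ = _ := by
      rw [hL]
      refine Finset.sum_congr rfl fun i _ => ?_
      rw [← mul_prod_ite i (fun l => -(u l))]
      ring

/-- the constant in the Cauchy determinant -/
noncomputable def Kc {N : ℕ} (u : Fin N → ℂ) : ℂ :=
  (∏ i, ∏ l, if l = i then 1 else (1 - u l * (u i)⁻¹)⁻¹) * Vd (fun i => (u i)⁻¹)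

lemma cauchy_det {N : ℕ} {u : Fin N → ℂ} (hu0 : ∀ j, u j ≠ 0) (hu : Function.Injective u)
    {z : Fin N → ℂ} (hz : ∀ i j, 1 - u i * z j ≠ 0) :
    Vd z * ∏ j, ∏ i, (1 - u i * z j)⁻¹ =
      Kc u * (Matrix.of fun j i => (1 - u i * z j)⁻¹ : Matrix (Fin N) (Fin N) ℂ).det := by
  have hm : Matrix.diagonal (fun j => ∏ i, (1 - u i * z j)⁻¹) * Matrix.vandermonde z =
      (Matrix.of fun j i => (1 - u i * z j)⁻¹ : Matrix (Fin N) (Fin N) ℂ) *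
        (Matrix.diagonal (fun i => ∏ l, if l = i then 1 else (1 - u l * (u i)⁻¹)⁻¹) *
          Matrix.vandermonde (fun i => (u i)⁻¹)) := by
    ext j k
    rw [Matrix.diagonal_mul, Matrix.mul_apply, Matrix.vandermonde_apply, mul_comm,
      cauchy_row hu0 hu k (fun i => hz i j)]
    refine Finset.sum_congr rfl fun i _ => ?_
    rw [Matrix.diagonal_mul, Matrix.vandermonde_apply, Matrix.of_apply, mul_comm (∏ l, _)]
  have := congrArg Matrix.det hm
  rw [Matrix.det_mul, Matrix.det_mul, Matrix.det_mul, Matrix.det_diagonal, Matrix.det_diagonal,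
    Matrix.det_vandermonde, Matrix.det_vandermonde] at this
  rw [Kc, Vd, Vd, mul_comm, this]
  ring

section
variable {p q : ℂ} [hp : Nome p] [hq : Nome q]

variable {n : ℕ} {s t : Fin (n + 2) → ℂ}

/-- regular part of the one-variable factor -/
noncomputable def Phs (p q : ℂ) {n : ℕ} (s t : Fin (n + 2) → ℂ) (x : ℂ) : ℂ :=
  ellGamma (s 0 * x) p q * (∏ j : Fin (n + 1), Gs p q (s j.succ * x)) * ∏ m, ellGamma (t m / x) p q

lemma Phi_Phs (x : ℂ) : Phi p q s t x = Phs p q s t x * ∏ j : Fin (n + 1), (1 - s j.succ * x)⁻¹ := by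
  rw [Phi, Phs, Finset.prod_mul_distrib, Fin.prod_univ_succ]
  simp only [ellGamma_Gs (s (Fin.succ _) * x), div_eq_mul_inv, Finset.prod_mul_distrib]
  ring

lemma Phs_diffAt {V : Type*} [NormedAddCommGroup V] [NormedSpace ℂ V] {v : V} {f : V → ℂ} {ρ : ℝ} (hf : DifferentiableAt ℂ f v)
    (hs0 : ∀ m, s m ≠ 0) (ht0 : ∀ m, t m ≠ 0) (ht : ∀ m, ‖t m‖ < 1)
    (hρs : ‖s 0‖ * ρ < 1) (hρp : ∀ j : Fin (n + 1), ‖p‖ * ‖s j.succ‖ * ρ < 1)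
    (hρq : ∀ j : Fin (n + 1), ‖q‖ * ‖s j.succ‖ * ρ < 1)
    (h1 : 1 ≤ ‖f v‖) (h2 : ‖f v‖ ≤ ρ) : DifferentiableAt ℂ (fun v => Phs p q s t (f v)) v := by
  have hpos : 0 < ‖f v‖ := by linarith
  have h0 : f v ≠ 0 := norm_pos_iff.mp hpos
  unfold Phs
  refine DifferentiableAt.fun_mul (DifferentiableAt.fun_mul ?_ (prod_diffAt fun j _ => ?_)) (prod_diffAt fun m _ => ?_)
  · refine ellGamma_differentiableAt (by fun_prop) (mul_ne_zero (hs0 0) h0) ?_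
    rw [norm_mul]
    exact (mul_le_mul_of_nonneg_left h2 (norm_nonneg _)).trans_lt hρs
  · refine Gs_differentiableAt (by fun_prop) (mul_ne_zero (hs0 _) h0) ?_ ?_
    · rw [norm_mul, norm_mul, ← mul_assoc]
      exact (mul_le_mul_of_nonneg_left h2 (by positivity)).trans_lt (hρp j)
    · rw [norm_mul, norm_mul, ← mul_assoc]
      exact (mul_le_mul_of_nonneg_left h2 (by positivity)).trans_lt (hρq j)
  · refine ellGamma_differentiableAt (div_diffAt (by fun_prop) hf h0) (div_ne_zero (ht0 m) h0) ?_
    rw [norm_div, div_lt_one hpos]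
    exact (ht m).trans_le h1

/-- value of the constant -/
lemma const_val {u : Fin (n + 1) → ℂ} (hu : ∀ j, s j.succ = u j) (hu0 : ∀ j, u j ≠ 0) (huinj : Function.Injective u)
    (hup : ∀ i j, ‖p‖ * ‖u i‖ < ‖u j‖) (huq : ∀ i j, ‖q‖ * ‖u i‖ < ‖u j‖) :
    Kc u * ((∏ j, Phs p q s t (u j)⁻¹) * Vp p q (fun j => (u j)⁻¹)) =
      Gs p q 1 ^ (n + 1) * (∏ j, ellGamma (s 0 / u j) p q) * ∏ j, ∏ m, ellGamma (t m * u j) p q := by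
  have e1 : (∏ j, Phs p q s t (u j)⁻¹) = (∏ j, ellGamma (s 0 / u j) p q) *
      (Gs p q 1 ^ (n + 1) * ∏ i, ∏ l, if l = i then 1 else Gs p q (u l * (u i)⁻¹)) *
      ∏ j, ∏ m, ellGamma (t m * u j) p q := by
    have h3 : Gs p q 1 ^ (n + 1) = ∏ i : Fin (n + 1), Gs p q 1 := by simp
    simp only [Phs, Finset.prod_mul_distrib, hu]
    rw [h3, ← Finset.prod_mul_distrib (f := fun _ : Fin (n + 1) => Gs p q 1)]
    congr 1
    · congr 1
      refine Finset.prod_congr rfl fun i _ => ?_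
      rw [← mul_prod_ite i (fun l => Gs p q (u l * (u i)⁻¹)), mul_inv_cancel₀ (hu0 i)]
    · simp
  have e2 : (∏ i, ∏ l, if l = i then 1 else (1 - u l * (u i)⁻¹)⁻¹) *
      (∏ i, ∏ l, if l = i then 1 else Gs p q (u l * (u i)⁻¹)) * (Vd (fun i => (u i)⁻¹) * Vp p q (fun j => (u j)⁻¹)) = 1 := by
    rw [← VV_eq _ (fun i => inv_ne_zero (hu0 i)), prod_offdiag (fun i l => (1 - u l * (u i)⁻¹)⁻¹),
      prod_offdiag (fun i l => Gs p q (u l * (u i)⁻¹)), VV, ← Finset.prod_mul_distrib, ← Finset.prod_mul_distrib]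
    refine Finset.prod_eq_one fun i _ => ?_
    rw [← Finset.prod_mul_distrib, ← Finset.prod_mul_distrib]
    refine Finset.prod_eq_one fun l hl => ?_
    have hil : i ≠ l := (Finset.mem_Ioi.mp hl).ne
    have hi := hu0 i
    have hl := hu0 l
    have hip : 0 < ‖u i‖ := norm_pos_iff.mpr hi
    have hlp : 0 < ‖u l‖ := norm_pos_iff.mpr hl
    have hr := Gs_refl (p := p) (q := q) (x := u l * (u i)⁻¹) (by positivity)
      (by rw [norm_mul, norm_mul, norm_inv, ← mul_assoc, ← div_eq_mul_inv, div_lt_one hip]; exact hup _ _)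
      (by rw [norm_mul, norm_mul, norm_inv, ← mul_assoc, ← div_eq_mul_inv, div_lt_one hip]; exact huq _ _)
      (by rw [norm_div, norm_mul, norm_inv, div_lt_iff₀ (by positivity), one_mul, ← div_eq_mul_inv, lt_div_iff₀ hip]; exact hup _ _)
      (by rw [norm_div, norm_mul, norm_inv, div_lt_iff₀ (by positivity), one_mul, ← div_eq_mul_inv, lt_div_iff₀ hip]; exact huq _ _)
    have hinv : u i * (u l)⁻¹ = (u l * (u i)⁻¹)⁻¹ := by field_simp
    have hdiv : (u i)⁻¹ / (u l)⁻¹ = u l * (u i)⁻¹ := by field_simp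
    rw [vv, hdiv, hinv, th_eq, th_eq, th1_inv]
    set x := u l * (u i)⁻¹ with hx
    have hx1 : x ≠ 1 := by
      intro h
      rw [hx, mul_inv_eq_one₀ hi] at h
      exact hil (huinj h).symm
    have h1 : 1 - x ≠ 0 := sub_ne_zero.mpr hx1.symm
    have h2 : 1 - x⁻¹ ≠ 0 := sub_ne_zero.mpr fun h => hx1 (inv_eq_one.mp h.symm)
    have c1 := inv_mul_cancel₀ h1
    have c2 := inv_mul_cancel₀ h2
    generalize 1 - x = d1 at *
    generalize 1 - x⁻¹ = d2 at *
    linear_combination hr * (d1⁻¹ * d1 * (d2⁻¹ * d2)) + c1 * (d2⁻¹ * d2) + c2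
  rw [e1, Kc]
  linear_combination (Gs p q 1 ^ (n + 1) * (∏ j, ellGamma (s 0 / u j) p q) * ∏ j, ∏ m, ellGamma (t m * u j) p q) * e2

end

open MeasureTheory Filter Topology
set_option linter.unusedSectionVars false
set_option linter.unusedVariables false

section
variable {p q : ℂ} [hp : Nome p] [hq : Nome q]

variable {n : ℕ} {s t : Fin (n + 2) → ℂ}

lemma Del_sum {u : Fin (n + 1) → ℂ} (hu : ∀ j, s j.succ = u j) (hu0 : ∀ j, u j ≠ 0) (huinj : Function.Injective u)
    (k : ℕ) {z : Fin (n + 1) → ℂ} (hz0 : ∀ j, z j ≠ 0) (hz : ∀ i j, 1 - u i * z j ≠ 0) :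
    ((∏ j, u j)⁻¹) ^ k * (Del p q s t z * ((∏ j, z j)⁻¹) ^ k) =
      Kc u * ∑ σ : Equiv.Perm (Fin (n + 1)),
        (∏ j, KK k (u j) ((z ∘ σ) j)) * ((∏ j, Phs p q s t ((z ∘ σ) j)) * Vp p q (z ∘ σ)) := by
  have e1 : Del p q s t z = ((∏ j, Phs p q s t (z j)) * Vp p q z) *
      (Kc u * (Matrix.of fun j i => (1 - u i * z j)⁻¹ : Matrix (Fin (n + 1)) (Fin (n + 1)) ℂ).det) := by
    rw [← cauchy_det hu0 huinj hz, Del, VV_eq z hz0]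
    simp only [Phi_Phs, hu, Finset.prod_mul_distrib]
    ring
  rw [e1, Matrix.det_apply']
  have e2 : ∀ σ : Equiv.Perm (Fin (n + 1)), (∏ j, KK k (u j) ((z ∘ σ) j)) * ((∏ j, Phs p q s t ((z ∘ σ) j)) * Vp p q (z ∘ σ)) =
      (((∏ j, u j)⁻¹) ^ k * ((∏ j, z j)⁻¹) ^ k * ((∏ j, Phs p q s t (z j)) * Vp p q z)) *
        ((Equiv.Perm.sign σ : ℂ) * ∏ i, (Matrix.of fun j i => (1 - u i * z j)⁻¹ : Matrix (Fin (n + 1)) (Fin (n + 1)) ℂ) (σ i) i) := by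
    intro σ
    have h1 : ∏ j, Phs p q s t ((z ∘ σ) j) = ∏ j, Phs p q s t (z j) := Equiv.prod_comp σ (fun j => Phs p q s t (z j))
    have h2 : ∏ j, z (σ j) = ∏ j, z j := Equiv.prod_comp σ z
    rw [h1, Vp_perm]
    simp only [KK, Finset.prod_mul_distrib, Finset.prod_pow, Finset.prod_inv_distrib, Function.comp, h2,
      mul_inv, mul_pow, Matrix.of_apply]
    ring
  simp only [e2, ← Finset.mul_sum]
  ring

lemma asym_lhs {u : Fin (n + 1) → ℂ} (hu : ∀ j, s j.succ = u j) (huinj : Function.Injective u)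
    (hs0 : ∀ m, s m ≠ 0) (ht0 : ∀ m, t m ≠ 0) (hs : ∀ m, ‖s m‖ < 1) (ht : ∀ m, ‖t m‖ < 1)
    (hup : ∀ i j, ‖p‖ * ‖u i‖ < ‖u j‖) (huq : ∀ i j, ‖q‖ * ‖u i‖ < ‖u j‖)
    {ρ : ℝ} (hρ1 : 1 < ρ) (hρu : ∀ j, 1 < ρ * ‖u j‖)
    (hρs : ‖s 0‖ * ρ < 1) (hρp : ∀ j : Fin (n + 1), ‖p‖ * ‖s j.succ‖ * ρ < 1)
    (hρq : ∀ j : Fin (n + 1), ‖q‖ * ‖s j.succ‖ * ρ < 1) :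
    Tendsto (fun k : ℕ => ((∏ j, u j)⁻¹) ^ k * ∫ x : Tor (n + 1), Del p q s t (eT x) * ((∏ j, eT x j)⁻¹) ^ k) atTop
      (𝓝 (((n + 1).factorial : ℂ) * (Gs p q 1 ^ (n + 1) * (∏ j, ellGamma (s 0 / u j) p q) * ∏ j, ∏ m, ellGamma (t m * u j) p q))) := by
  have hu0 : ∀ j, u j ≠ 0 := fun j => by rw [← hu]; exact hs0 _
  have hu1 : ∀ j, ‖u j‖ < 1 := fun j => by rw [← hu]; exact hs _
  have hgd : ∀ z : Fin (n + 1) → ℂ, ann ρ z → DifferentiableAt ℂ (fun z => (∏ j, Phs p q s t (z j)) * Vp p q z) z := by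
    intro z hz
    have h1 : ∀ j : Fin (n + 1), DifferentiableAt ℂ (fun z : Fin (n + 1) → ℂ => z j) z := fun j => by fun_prop
    have h2 : ∀ j : Fin (n + 1), DifferentiableAt ℂ (fun z : Fin (n + 1) → ℂ => Phs p q s t (z j)) z := fun j =>
      Phs_diffAt (h1 j) hs0 ht0 ht hρs hρp hρq (hz j).1 (hz j).2
    have h3 : DifferentiableAt ℂ (fun z : Fin (n + 1) → ℂ => Vp p q z) z :=
      Vp_diffAt (f := fun z => z) h1 (ann_ne hz)
    have h4 : DifferentiableAt ℂ (fun z : Fin (n + 1) → ℂ => ∏ j, Phs p q s t (z j)) z :=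
      prod_diffAt fun j _ => h2 j
    exact h4.fun_mul h3
  have hlim := kernel_lim hρ1 u hu0 hu1 hρu (fun z => (∏ j, Phs p q s t (z j)) * Vp p q z) hgd
  have hlim2 := hlim.const_mul (Kc u * ((n + 1).factorial : ℂ))
  have hval := const_val (s := s) (t := t) hu hu0 huinj hup huq
  have hval2 : Kc u * ((n + 1).factorial : ℂ) * ((∏ j, Phs p q s t (u j)⁻¹) * Vp p q (fun j => (u j)⁻¹)) =
      ((n + 1).factorial : ℂ) * (Gs p q 1 ^ (n + 1) * (∏ j, ellGamma (s 0 / u j) p q) * ∏ j, ∏ m, ellGamma (t m * u j) p q) := by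
    rw [← hval]; ring
  rw [← hval2]
  refine hlim2.congr fun k => ?_
  have hc : Continuous fun x : Tor (n + 1) => (∏ j, KK k (u j) (eT x j)) *
      ((∏ j, Phs p q s t (eT x j)) * Vp p q (eT x)) := by
    refine Continuous.mul (continuous_finsetProd _ fun j _ => KK_cont (hu0 j) (by unfold eT; fun_prop) (fun x => eT_ne x j)
        (fun x => by rw [norm_mul, eT_norm, mul_one]; exact (hu1 j).ne)) ?_
    exact cont_of_diffAt (F := fun z => (∏ j, Phs p q s t (z j)) * Vp p q z) eT_continuous
      fun x => hgd _ fun j => by rw [eT_norm]; exact ⟨le_rfl, hρ1.le⟩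
  have e : ∀ x : Tor (n + 1), ((∏ j, u j)⁻¹) ^ k * (Del p q s t (eT x) * ((∏ j, eT x j)⁻¹) ^ k) =
      Kc u * ∑ σ : Equiv.Perm (Fin (n + 1)), (fun x : Tor (n + 1) => (∏ j, KK k (u j) (eT x j)) *
      ((∏ j, Phs p q s t (eT x j)) * Vp p q (eT x))) (x ∘ σ) := fun x =>
    Del_sum hu hu0 huinj k (eT_ne x) (fun i j => one_sub_ne (by rw [norm_mul, eT_norm, mul_one]; exact (hu1 i).ne))
  rw [← integral_const_mul (((∏ j, u j)⁻¹) ^ k)]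
  simp only [e]
  rw [integral_const_mul, integral_finsetSum]
  · rw [Finset.sum_congr rfl (fun σ _ => int_perm (fun x : Tor (n + 1) => (∏ j, KK k (u j) (eT x j)) *
      ((∏ j, Phs p q s t (eT x j)) * Vp p q (eT x))) σ)]
    rw [Finset.sum_const, Finset.card_univ, Fintype.card_perm, Fintype.card_fin, nsmul_eq_mul]
    ring
  · intro σ _
    exact cont_integrable (hc.comp (by fun_prop))

lemma int_tor1 {f : ℂ → ℂ} (hf : Continuous fun y => f (ee y)) : ∫ x : Tor 1, f (eT x 0) = ∫ y, f (ee y) := by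
  rw [int_cons (fun x : Tor 1 => f (eT x 0)) (hf.comp (continuous_apply 0))]
  congr 1
  ext a
  have : ∀ y : Tor 0, eT (Fin.cons a y : Tor 1) 0 = ee a := fun y => rfl
  simp [this]

/-- regular part of the evaluation -/
noncomputable def RWs (p q : ℂ) {n : ℕ} (s t : Fin (n + 2) → ℂ) (Y : ℂ) : ℂ :=
  Gs p q ((∏ m, s m) / s 0 * Y) * (∏ j : Fin (n + 1), ellGamma ((∏ m, s m) / s j.succ * Y) p q) *
    ∏ m, ellGamma ((∏ m, t m) / t m / Y) p q

lemma RW_RWs (Y : ℂ) : RW p q s t Y = RWs p q s t Y * (1 - (∏ m, s m) / s 0 * Y)⁻¹ := by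
  rw [RW, RWs, Finset.prod_mul_distrib, Fin.prod_univ_succ, ellGamma_Gs, div_eq_mul_inv (Gs _ _ _)]
  ring

lemma asym_rhs (hs0 : ∀ m, s m ≠ 0) (ht0 : ∀ m, t m ≠ 0) (hs : ∀ m, ‖s m‖ < 1) (ht : ∀ m, ‖t m‖ < 1)
    {ρ : ℝ} (hρ1 : 1 < ρ) (hρu : 1 < ρ * ‖(∏ m, s m) / s 0‖)
    (hρs : ∀ j : Fin (n + 1), ‖(∏ m, s m) / s j.succ‖ * ρ < 1) (hρp : ‖p‖ * ‖(∏ m, s m) / s 0‖ * ρ < 1)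
    (hρq : ‖q‖ * ‖(∏ m, s m) / s 0‖ * ρ < 1) :
    Tendsto (fun k : ℕ => (((∏ m, s m) / s 0)⁻¹) ^ k * ∫ y, RW p q s t (ee y) * ((ee y)⁻¹) ^ k) atTop
      (𝓝 (RWs p q s t ((∏ m, s m) / s 0)⁻¹)) := by
  have hS0 : ∏ m, s m ≠ 0 := prod_ne hs0
  have hT0 : ∏ m, t m ≠ 0 := prod_ne ht0
  set U := (∏ m, s m) / s 0 with hU
  have hU0 : U ≠ 0 := div_ne_zero hS0 (hs0 0)
  have hU1 : ‖U‖ < 1 := div_norm_lt hs0 hs 0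
  have hd : ∀ z : Fin 1 → ℂ, ann ρ z → DifferentiableAt ℂ (fun z => RWs p q s t (z 0)) z := by
    intro z hz
    have h0 := ann_ne hz 0
    have h1 := (hz 0).1
    have h2 := (hz 0).2
    have hpos : 0 < ‖z 0‖ := by linarith
    unfold RWs
    rw [← hU]
    refine DifferentiableAt.fun_mul (DifferentiableAt.fun_mul ?_ (prod_diffAt fun j _ => ?_)) (prod_diffAt fun m _ => ?_)
    · refine Gs_differentiableAt (by fun_prop) (mul_ne_zero hU0 h0) ?_ ?_
      · rw [norm_mul, norm_mul, ← mul_assoc]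
        exact (mul_le_mul_of_nonneg_left h2 (by positivity)).trans_lt hρp
      · rw [norm_mul, norm_mul, ← mul_assoc]
        exact (mul_le_mul_of_nonneg_left h2 (by positivity)).trans_lt hρq
    · refine ellGamma_differentiableAt (by fun_prop) (mul_ne_zero (div_ne_zero hS0 (hs0 _)) h0) ?_
      rw [norm_mul]
      exact (mul_le_mul_of_nonneg_left h2 (by positivity)).trans_lt (hρs j)
    · refine ellGamma_differentiableAt (div_diffAt (by fun_prop) (by fun_prop) h0)
        (div_ne_zero (div_ne_zero hT0 (ht0 m)) h0) ?_
      rw [norm_div, div_lt_one hpos]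
      exact (div_norm_lt ht0 ht m).trans_le h1
  have hlim := kernel_lim hρ1 (fun _ : Fin 1 => U) (fun _ => hU0) (fun _ => hU1) (fun _ => hρu) _ hd
  refine hlim.congr fun k => ?_
  have hc1 : Continuous fun x : UnitAddCircle => RWs p q s t (ee x) :=
    cont_of_diffAt (F := fun z : Fin 1 → ℂ => RWs p q s t (z 0)) (e := fun x _ => ee x) (by fun_prop)
      fun x => hd _ fun j => by simp [hρ1.le]
  have hc : Continuous fun y : UnitAddCircle => KK k U (ee y) * RWs p q s t (ee y) :=
    (KK_cont hU0 ee_continuous ee_ne (fun x => by rw [norm_mul, norm_ee, mul_one]; exact hU1.ne)).mul hc1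
  simp only [Fin.prod_univ_one]
  rw [int_tor1 (f := fun Y => KK k U Y * RWs p q s t Y) hc, ← integral_const_mul]
  congr 1
  ext y
  rw [RW_RWs, ← hU, KK, mul_inv, mul_pow]
  ring

/-- the evaluation in the special region -/
lemma region_eval (hs0 : ∀ m, s m ≠ 0) (ht0 : ∀ m, t m ≠ 0)
    (hs : ∀ m, ‖s m‖ < 1) (ht : ∀ m, ‖t m‖ < 1) (hbal : (∏ m, s m) * ∏ m, t m = p * q)
    (hT1 : ‖p‖ ^ 2 < ‖∏ m, t m‖) (hT2 : ‖∏ m, t m‖ < 1) (hT3 : ‖∏ m, t m‖ ≠ ‖p‖)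
    (hS1 : ‖p‖ ^ 2 < ‖∏ m, s m‖) (hS2 : ‖∏ m, s m‖ < 1) (hS3 : ‖∏ m, s m‖ ≠ ‖p‖)
    (hTs : ∀ m, ‖(∏ m, t m) * s m‖ < ‖q‖) (hSt : ∀ m, ‖(∏ m, s m) * t m‖ < ‖q‖)
    (huinj : Function.Injective fun j : Fin (n + 1) => s j.succ)
    (hup : ∀ i j : Fin (n + 1), ‖p‖ * ‖s i.succ‖ < ‖s j.succ‖) (huq : ∀ i j : Fin (n + 1), ‖q‖ * ‖s i.succ‖ < ‖s j.succ‖)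
    (hsu : ∀ j : Fin (n + 1), ‖s 0‖ < ‖s j.succ‖) (hqs : ∀ j : Fin (n + 1), ‖q‖ * ‖s j.succ‖ < ‖s 0‖)
    {ρ : ℝ} (hρ1 : 1 < ρ) (hρu : ∀ j : Fin (n + 1), 1 < ρ * ‖s j.succ‖)
    (hρs : ‖s 0‖ * ρ < 1) (hρp : ∀ j : Fin (n + 1), ‖p‖ * ‖s j.succ‖ * ρ < 1)
    (hρq : ∀ j : Fin (n + 1), ‖q‖ * ‖s j.succ‖ * ρ < 1)
    {τ : ℝ} (hτ1 : 1 < τ) (hτu : 1 < τ * ‖(∏ m, s m) / s 0‖)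
    (hτs : ∀ j : Fin (n + 1), ‖(∏ m, s m) / s j.succ‖ * τ < 1) (hτp : ‖p‖ * ‖(∏ m, s m) / s 0‖ * τ < 1)
    (hτq : ‖q‖ * ‖(∏ m, s m) / s 0‖ * τ < 1) :
    jj (n := n) p q s t 0 = ((n + 1).factorial : ℂ) * Gs p q 1 ^ n * (RW p q s t 1 * ∏ k, ∏ m, ellGamma (s k * t m) p q) := by
  obtain ⟨C, hC⟩ := jj_eq hs0 ht0 hs ht hbal hT1 hT2 hT3 hS1 hS2 hS3 hTs hSt
  have hS0 : ∏ m, s m ≠ 0 := prod_ne hs0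
  have hT0 : ∏ m, t m ≠ 0 := prod_ne ht0
  have hUe : (∏ m, s m) / s 0 = ∏ j : Fin (n + 1), s j.succ := by
    rw [Fin.prod_univ_succ]
    have := hs0 0
    field_simp
  have L1 := asym_lhs (s := s) (t := t) (u := fun j => s j.succ) (fun j => rfl) huinj hs0 ht0 hs ht hup huq hρ1 hρu hρs hρp hρq
  have L2 := (asym_rhs hs0 ht0 hs ht hτ1 hτu hτs hτp hτq).const_mul C
  have heq : ∀ k : ℕ, ((∏ j : Fin (n + 1), s j.succ)⁻¹) ^ k * ∫ x : Tor (n + 1), Del p q s t (eT x) * ((∏ j, eT x j)⁻¹) ^ k =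
      C * ((((∏ m, s m) / s 0)⁻¹) ^ k * ∫ y, RW p q s t (ee y) * ((ee y)⁻¹) ^ k) := by
    intro k
    rw [jj_int (F := fun Y => (Y⁻¹) ^ k) hs0 ht0 hs ht ((ee_continuous.inv₀ ee_ne).pow k), hUe, mul_left_comm,
      ← integral_const_mul]
    have e : ∀ y, jj (n := n) p q s t y * ((ee y)⁻¹) ^ k = C * (RW p q s t (ee y) * ((ee y)⁻¹) ^ k) := fun y => by
      rw [hC]; ring
    simp only [e]
    rw [integral_const_mul, integral_const_mul]
  have hlim := tendsto_nhds_unique (L1.congr heq) L2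
  have hG0 : ∀ j : Fin (n + 1), ellGamma (s 0 / s j.succ) p q ≠ 0 := by
    intro j
    have hj : 0 < ‖s j.succ‖ := norm_pos_iff.mpr (hs0 _)
    have h00 : 0 < ‖s 0‖ := norm_pos_iff.mpr (hs0 _)
    refine ellGamma_ne (by rw [norm_div, div_lt_one hj]; exact hsu j) ?_
    have h1 : p * q / (s 0 / s j.succ) = p * (q * s j.succ / s 0) := by
      have := hs0 0
      have := hs0 j.succ
      field_simp
    rw [h1, norm_mul, norm_div, norm_mul]
    have h2 : ‖q‖ * ‖s j.succ‖ / ‖s 0‖ < 1 := by rw [div_lt_one h00]; exact hqs j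
    exact mul_lt_one_of_nonneg_of_lt_one_left (norm_nonneg _) hp.lt h2.le
  have hGs : Gs p q 1 ≠ 0 := by
    rw [Gs_one]
    exact inv_ne_zero (mul_ne_zero (pochInf_ne hp.lt) (pochInf_ne hq.lt))
  have hprod : ∏ j : Fin (n + 1), ellGamma (s 0 / s j.succ) p q ≠ 0 := prod_ne hG0
  have hRWs : RWs p q s t ((∏ m, s m) / s 0)⁻¹ * (∏ m, ellGamma (s 0 * t m) p q) =
      Gs p q 1 * ∏ j : Fin (n + 1), ellGamma (s 0 / s j.succ) p q := by
    have hU0 : (∏ m, s m) / s 0 ≠ 0 := div_ne_zero hS0 (hs0 0)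
    rw [RWs, mul_inv_cancel₀ hU0, mul_assoc, ← Finset.prod_mul_distrib]
    have h1 : ∏ m, (ellGamma ((∏ m, t m) / t m / ((∏ m, s m) / s 0)⁻¹) p q * ellGamma (s 0 * t m) p q) = 1 := by
      refine Finset.prod_eq_one fun m _ => ?_
      have h00 := hs0 0
      have hm := ht0 m
      have e : (∏ m, t m) / t m / ((∏ m, s m) / s 0)⁻¹ = p * q / (s 0 * t m) := by
        rw [← hbal]; field_simp
      rw [e, mul_comm]
      refine ellGamma_refl (by positivity) ?_ ?_
      · rw [norm_mul]
        exact mul_lt_one_of_nonneg_of_lt_one_left (norm_nonneg _) (hs 0) (ht m).le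
      · rw [← e, norm_div, norm_inv, div_inv_eq_mul]
        exact mul_lt_one_of_nonneg_of_lt_one_left (norm_nonneg _) (div_norm_lt ht0 ht m) (div_norm_lt hs0 hs 0).le
    rw [h1, mul_one]
    congr 1
    refine Finset.prod_congr rfl fun j _ => ?_
    congr 1
    have h00 := hs0 0
    have hj := hs0 j.succ
    field_simp
  have hCval : C = ((n + 1).factorial : ℂ) * Gs p q 1 ^ n * ∏ k, ∏ m, ellGamma (s k * t m) p q := by
    have hne : Gs p q 1 * ∏ j : Fin (n + 1), ellGamma (s 0 / s j.succ) p q ≠ 0 := mul_ne_zero hGs hprod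
    apply mul_right_cancel₀ hne
    rw [Fin.prod_univ_succ (fun k => ∏ m, ellGamma (s k * t m) p q)]
    have hsw : ∏ j : Fin (n + 1), ∏ m, ellGamma (s j.succ * t m) p q = ∏ j : Fin (n + 1), ∏ m, ellGamma (t m * s j.succ) p q := by
      simp only [mul_comm]
    rw [hsw, ← hRWs, ← mul_assoc, ← hlim, hRWs]
    ring
  rw [hC, ee_zero, hCval]
  ring
end

open MeasureTheory Filter Topology
set_option linter.unusedSectionVars false
set_option linter.unusedVariables false

/-- holomorphy of parametric integrals over compact spaces -/
lemma param_int_diff {X : Type*} [TopologicalSpace X] [CompactSpace X] [MeasurableSpace X]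
    [OpensMeasurableSpace X] [T2Space X] [SecondCountableTopology X] {μ : Measure X} [IsFiniteMeasure μ]
    {U : Set ℂ} (hU : IsOpen U) {F : ℂ → X → ℂ}
    (hc : ContinuousOn (fun u : ℂ × X => F u.1 u.2) (U ×ˢ Set.univ))
    (hd : ∀ x, ∀ w ∈ U, DifferentiableAt ℂ (fun w => F w x) w) :
    DifferentiableOn ℂ (fun w => ∫ x, F w x ∂μ) U := by
  intro w0 hw0
  obtain ⟨r, hr, hrU⟩ := Metric.isOpen_iff.mp hU w0 hw0
  have hsub : Metric.closedBall w0 (r / 2) ⊆ U :=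
    (Metric.closedBall_subset_ball (by linarith)).trans hrU
  have hcx : ∀ w ∈ U, Continuous (F w) := fun w hw => by
    rw [← continuousOn_univ]
    exact hc.comp (f := fun x => (w, x)) (by fun_prop) (fun x _ => ⟨hw, trivial⟩)
  obtain ⟨M, hM⟩ := ((isCompact_closedBall w0 (r / 2)).prod isCompact_univ).exists_bound_of_continuousOn
    (hc.mono (Set.prod_mono hsub (Set.Subset.refl _)))
  have hbd : ∀ x, ∀ w ∈ Metric.ball w0 (r / 4), ‖deriv (fun w => F w x) w‖ ≤ M / (r / 4) := by
    intro x w hw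
    have hs2 : Metric.closedBall w (r / 4) ⊆ Metric.closedBall w0 (r / 2) := by
      apply Metric.closedBall_subset_closedBall'
      have := Metric.mem_ball.mp hw
      linarith
    refine Complex.norm_deriv_le_of_forall_mem_sphere_norm_le (by linarith) ?_ ?_
    · refine DifferentiableOn.diffContOnCl_ball (U := U) (fun w hw => (hd x w hw).differentiableWithinAt) (hs2.trans hsub)
    · intro z hz
      exact hM (z, x) ⟨hs2 (Metric.sphere_subset_closedBall hz), trivial⟩
  have hmeas : AEStronglyMeasurable (fun x => deriv (fun w => F w x) w0) μ := by
    have hseq : Tendsto (fun k : ℕ => ((r / 2 : ℝ) : ℂ) * (1 / ((k : ℂ) + 1))) atTop (𝓝[≠] 0) := by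
      refine tendsto_nhdsWithin_iff.mpr ⟨?_, Eventually.of_forall fun k => ?_⟩
      · simpa using (tendsto_one_div_add_atTop_nhds_zero_nat (𝕜 := ℂ)).const_mul ((r / 2 : ℝ) : ℂ)
      · have h1 : ((r / 2 : ℝ) : ℂ) ≠ 0 := by exact_mod_cast (by linarith : (r / 2 : ℝ) ≠ 0)
        have h2 : (k : ℂ) + 1 ≠ 0 := by exact_mod_cast Nat.succ_ne_zero k
        exact mul_ne_zero h1 (one_div_ne_zero h2)
    refine aestronglyMeasurable_of_tendsto_ae atTop (f := fun (k : ℕ) x =>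
      (((r / 2 : ℝ) : ℂ) * (1 / ((k : ℂ) + 1)))⁻¹ • (F (w0 + ((r / 2 : ℝ) : ℂ) * (1 / ((k : ℂ) + 1))) x - F w0 x)) ?_ ?_
    · intro k
      have hmem : w0 + ((r / 2 : ℝ) : ℂ) * (1 / ((k : ℂ) + 1)) ∈ U := by
        apply hsub
        rw [Metric.mem_closedBall, dist_eq_norm, add_sub_cancel_left, norm_mul, norm_div, norm_one, Complex.norm_real,
          Real.norm_of_nonneg (by linarith)]
        have h2 : ‖(k : ℂ) + 1‖ = (k : ℝ) + 1 := by
          have : (k : ℂ) + 1 = ((k + 1 : ℕ) : ℂ) := by push_cast; rfl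
          rw [this, Complex.norm_natCast]; push_cast; rfl
        rw [h2]
        have h3 : 1 / ((k : ℝ) + 1) ≤ 1 := by
          rw [div_le_one (by positivity)]
          linarith [(Nat.cast_nonneg k : (0 : ℝ) ≤ k)]
        nlinarith
      have h5 := ((hcx _ hmem).sub (hcx _ hw0)).const_smul (((r / 2 : ℝ) : ℂ) * (1 / ((k : ℂ) + 1)))⁻¹
      exact h5.aestronglyMeasurable
    · refine Eventually.of_forall fun x => ?_
      exact (hd x w0 hw0).hasDerivAt.tendsto_slope_zero.comp hseq
  have hb : Metric.ball w0 (r / 4) ∈ 𝓝 w0 := Metric.ball_mem_nhds _ (by linarith)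
  have hbU : Metric.ball w0 (r / 4) ⊆ U := (Metric.ball_subset_ball (by linarith)).trans hrU
  have := hasDerivAt_integral_of_dominated_loc_of_deriv_le (μ := μ) (F := F) (F' := fun w x => deriv (fun w => F w x) w)
    (bound := fun _ => M / (r / 4)) hb
    (by filter_upwards [hb] with w hw; exact (hcx w (hbU hw)).aestronglyMeasurable)
    (cont_integrable (hcx w0 hw0)) hmeas (Eventually.of_forall fun x w hw => hbd x w hw) (integrable_const _)
    (Eventually.of_forall fun x w hw => (hd x w (hbU hw)).hasDerivAt)
  exact this.2.differentiableAt.differentiableWithinAt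

lemma param_int_diff2 {X : Type*} [TopologicalSpace X] [CompactSpace X] [MeasurableSpace X]
    [OpensMeasurableSpace X] [T2Space X] [SecondCountableTopology X] {μ : Measure X} [IsFiniteMeasure μ]
    {W : Type*} [NormedAddCommGroup W] [NormedSpace ℂ W]
    {U : Set ℂ} (hU : IsOpen U) {G : ℂ × W → ℂ} {e : X → W} (he : Continuous e)
    (hJ : ∀ w ∈ U, ∀ x, DifferentiableAt ℂ G (w, e x)) :
    DifferentiableOn ℂ (fun w => ∫ x, G (w, e x) ∂μ) U := by
  refine param_int_diff hU (F := fun w x => G (w, e x)) ?_ ?_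
  · rintro ⟨w, x⟩ ⟨hw, -⟩
    have h1 := (hJ w hw x).continuousAt
    have h2 : ContinuousAt (fun u : ℂ × X => (u.1, e u.2)) (w, x) := by
      apply Continuous.continuousAt
      exact continuous_fst.prodMk (he.comp continuous_snd)
    exact (ContinuousAt.comp (f := fun u : ℂ × X => (u.1, e u.2)) (g := G) h1 h2).continuousWithinAt
  · intro x w hw
    exact (hJ w hw x).comp w (f := fun w : ℂ => (w, e x)) (by fun_prop)

section
variable {p q : ℂ} [hp : Nome p] [hq : Nome q]

lemma DelJ_diffAt {V : Type*} [NormedAddCommGroup V] [NormedSpace ℂ V] {v : V} {n M : ℕ} {s t : V → Fin M → ℂ}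
    {f : V → Fin n → ℂ} (hf : ∀ i, DifferentiableAt ℂ (fun v => f v i) v)
    (hsd : ∀ i, DifferentiableAt ℂ (fun v => s v i) v) (htd : ∀ i, DifferentiableAt ℂ (fun v => t v i) v)
    (hs0 : ∀ m, s v m ≠ 0) (ht0 : ∀ m, t v m ≠ 0)
    (h0 : ∀ i, f v i ≠ 0) (hs : ∀ m i, ‖s v m * f v i‖ < 1) (ht : ∀ m i, ‖t v m / f v i‖ < 1) :
    DifferentiableAt ℂ (fun v => Del p q (s v) (t v) (f v)) v := by
  unfold Del
  have h1 : ∀ j, DifferentiableAt ℂ (fun v => Phi p q (s v) (t v) (f v j)) v := by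
    intro j
    unfold Phi
    have h2 : ∀ m, DifferentiableAt ℂ (fun v => ellGamma (s v m * f v j) p q) v := fun m =>
      ellGamma_differentiableAt ((hsd m).fun_mul (hf j)) (mul_ne_zero (hs0 m) (h0 j)) (hs m j)
    have h3 : ∀ m, DifferentiableAt ℂ (fun v => ellGamma (t v m / f v j) p q) v := fun m =>
      ellGamma_differentiableAt (div_diffAt (htd m) (hf j) (h0 j)) (div_ne_zero (ht0 m) (h0 j)) (ht m j)
    exact prod_diffAt fun m _ => (h2 m).fun_mul (h3 m)
  exact DifferentiableAt.fun_mul (prod_diffAt fun j _ => h1 j) (VV_diffAt hf h0)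

lemma jj_param_diff {n M : ℕ} {U : Set ℂ} (hU : IsOpen U) {s t : ℂ → Fin M → ℂ}
    (hsd : ∀ i, ∀ w ∈ U, DifferentiableAt ℂ (fun v => s v i) w)
    (htd : ∀ i, ∀ w ∈ U, DifferentiableAt ℂ (fun v => t v i) w)
    (hs0 : ∀ w ∈ U, ∀ m, s w m ≠ 0) (ht0 : ∀ w ∈ U, ∀ m, t w m ≠ 0)
    (hs : ∀ w ∈ U, ∀ m, ‖s w m‖ < 1) (ht : ∀ w ∈ U, ∀ m, ‖t w m‖ < 1) :
    DifferentiableOn ℂ (fun w => ∫ x : Tor n, Del p q (s w) (t w) (eT (slc 0 x))) U := by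
  have hJ : ∀ w ∈ U, ∀ z : Fin (n + 1) → ℂ, (∀ i, ‖z i‖ = 1) →
      DifferentiableAt ℂ (fun u : ℂ × (Fin (n + 1) → ℂ) => Del p q (s u.1) (t u.1) u.2) (w, z) := by
    intro w hw z hz
    have hz0 : ∀ i, z i ≠ 0 := fun i h => by have := hz i; rw [h] at this; simp at this
    refine DelJ_diffAt (s := fun u : ℂ × (Fin (n + 1) → ℂ) => s u.1) (t := fun u => t u.1) (f := fun u => u.2)
      (fun i => ?_) (fun i => ?_) (fun i => ?_) (hs0 w hw) (ht0 w hw) hz0 (fun m i => ?_) (fun m i => ?_)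
    · fun_prop
    · exact (hsd i w hw).comp (w, z) (f := fun u : ℂ × (Fin (n + 1) → ℂ) => u.1) differentiableAt_fst
    · exact (htd i w hw).comp (w, z) (f := fun u : ℂ × (Fin (n + 1) → ℂ) => u.1) differentiableAt_fst
    · simpa [hz] using hs w hw m
    · simpa [hz] using ht w hw m
  have hcs : Continuous fun x : Tor n => eT (slc 0 x) :=
    eT_continuous.comp (slc_cont.comp (by fun_prop : Continuous fun x : Tor n => ((0 : UnitAddCircle), x)))
  exact param_int_diff2 (G := fun u : ℂ × (Fin (n + 1) → ℂ) => Del p q (s u.1) (t u.1) u.2) hU hcs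
    (fun w hw x => hJ w hw _ (eT_norm _))

lemma rhs_param_diff {M : ℕ} {U : Set ℂ} {s t : ℂ → Fin M → ℂ} {c : ℂ}
    (hsd : ∀ i, ∀ w ∈ U, DifferentiableAt ℂ (fun v => s v i) w)
    (htd : ∀ i, ∀ w ∈ U, DifferentiableAt ℂ (fun v => t v i) w)
    (hs0 : ∀ w ∈ U, ∀ m, s w m ≠ 0) (ht0 : ∀ w ∈ U, ∀ m, t w m ≠ 0)
    (hs : ∀ w ∈ U, ∀ m, ‖s w m‖ < 1) (ht : ∀ w ∈ U, ∀ m, ‖t w m‖ < 1)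
    (hs' : ∀ w ∈ U, ∀ m, ‖(∏ i, s w i) / s w m‖ < 1) (ht' : ∀ w ∈ U, ∀ m, ‖(∏ i, t w i) / t w m‖ < 1) :
    DifferentiableOn ℂ (fun w => c * (RW p q (s w) (t w) 1 * ∏ k, ∏ m, ellGamma (s w k * t w m) p q)) U := by
  intro w hw
  apply DifferentiableAt.differentiableWithinAt
  have h1 : ∀ m, DifferentiableAt ℂ (fun w => ellGamma ((∏ i, s w i) / s w m * 1) p q) w := fun m => by
    simp only [mul_one]
    exact ellGamma_differentiableAt (div_diffAt (prod_diffAt fun i _ => hsd i w hw) (hsd m w hw) (hs0 w hw m))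
      (div_ne_zero (prod_ne (hs0 w hw)) (hs0 w hw m)) (hs' w hw m)
  have h2 : ∀ m, DifferentiableAt ℂ (fun w => ellGamma ((∏ i, t w i) / t w m / 1) p q) w := fun m => by
    simp only [div_one]
    exact ellGamma_differentiableAt (div_diffAt (prod_diffAt fun i _ => htd i w hw) (htd m w hw) (ht0 w hw m))
      (div_ne_zero (prod_ne (ht0 w hw)) (ht0 w hw m)) (ht' w hw m)
  have h3 : ∀ k m, DifferentiableAt ℂ (fun w => ellGamma (s w k * t w m) p q) w := fun k m =>
    ellGamma_differentiableAt ((hsd k w hw).fun_mul (htd m w hw)) (mul_ne_zero (hs0 w hw k) (ht0 w hw m)) (by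
      rw [norm_mul]
      exact mul_lt_one_of_nonneg_of_lt_one_left (norm_nonneg _) (hs w hw k) (ht w hw m).le)
  have h4 : DifferentiableAt ℂ (fun w => RW p q (s w) (t w) 1) w := by
    unfold RW
    exact prod_diffAt fun m _ => (h1 m).fun_mul (h2 m)
  have h5 : DifferentiableAt ℂ (fun w => ∏ k, ∏ m, ellGamma (s w k * t w m) p q) w :=
    prod_diffAt fun k _ => prod_diffAt fun m _ => h3 k m
  exact (h4.fun_mul h5).const_mul c
end

open MeasureTheory Filter Topology
set_option linter.unusedSectionVars false
set_option linter.unusedVariables false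

/-- the special region of moduli -/
structure Reg {n : ℕ} (P Q : ℝ) (σ θ : Fin (n + 2) → ℝ) (ρ τ : ℝ) : Prop where
  hs0 : ∀ m, 0 < σ m
  ht0 : ∀ m, 0 < θ m
  hs : ∀ m, σ m < 1
  ht : ∀ m, θ m < 1
  hT1 : P ^ 2 < ∏ m, θ m
  hT2 : ∏ m, θ m < 1
  hT3 : ∏ m, θ m ≠ P
  hS1 : P ^ 2 < ∏ m, σ m
  hS2 : ∏ m, σ m < 1
  hS3 : ∏ m, σ m ≠ P
  hTs : ∀ m, (∏ m, θ m) * σ m < Q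
  hSt : ∀ m, (∏ m, σ m) * θ m < Q
  huinj : Function.Injective fun j : Fin (n + 1) => σ j.succ
  hup : ∀ i j : Fin (n + 1), P * σ i.succ < σ j.succ
  huq : ∀ i j : Fin (n + 1), Q * σ i.succ < σ j.succ
  hsu : ∀ j : Fin (n + 1), σ 0 < σ j.succ
  hqs : ∀ j : Fin (n + 1), Q * σ j.succ < σ 0
  hρ1 : 1 < ρ
  hρu : ∀ j : Fin (n + 1), 1 < ρ * σ j.succ
  hρs : σ 0 * ρ < 1
  hρp : ∀ j : Fin (n + 1), P * σ j.succ * ρ < 1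
  hρq : ∀ j : Fin (n + 1), Q * σ j.succ * ρ < 1
  hτ1 : 1 < τ
  hτu : 1 < τ * ((∏ m, σ m) / σ 0)
  hτs : ∀ j : Fin (n + 1), (∏ m, σ m) / σ j.succ * τ < 1
  hτp : P * ((∏ m, σ m) / σ 0) * τ < 1
  hτq : Q * ((∏ m, σ m) / σ 0) * τ < 1

/-- target moduli -/
noncomputable def tsig (n : ℕ) (a r : ℝ) : Fin (n + 2) → ℝ :=
  Fin.cons (a * (r ^ ((∑ j : Fin (n + 1), ((j : ℕ) + 1)) + (n + 2)))⁻¹) (fun j : Fin (n + 1) => a * r ^ ((j : ℕ) + 1))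

lemma tsig_prod {n : ℕ} {a r : ℝ} (hr : r ≠ 0) : ∏ m, tsig n a r m = a ^ (n + 2) * (r ^ (n + 2))⁻¹ := by
  rw [Fin.prod_univ_succ]
  simp only [tsig, Fin.cons_zero, Fin.cons_succ, Finset.prod_mul_distrib, Finset.prod_const, Finset.card_univ, Fintype.card_fin,
    Finset.prod_pow_eq_pow_sum]
  rw [pow_add r]
  field_simp
  ring

lemma exists_reg (n : ℕ) {P Q : ℝ} (hP : 0 < P) (hPQ : P ≤ Q) (hQ : Q < 1) :
    ∃ (σ θ : Fin (n + 2) → ℝ) (ρ τ : ℝ), Reg P Q σ θ ρ τ ∧ (∏ m, σ m) * ∏ m, θ m = P * Q := by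
  have hQ0 : 0 < Q := hP.trans_le hPQ
  obtain ⟨a, ha0, ha⟩ : ∃ a : ℝ, 0 < a ∧ a ^ (2 * (n + 2)) = P * Q :=
    ⟨(P * Q) ^ (((2 * (n + 2) : ℕ) : ℝ)⁻¹), by positivity, Real.rpow_inv_natCast_pow (by positivity) (by positivity)⟩
  have ha1 : a < 1 := by
    by_contra h
    have := one_le_pow₀ (not_lt.mp h) (n := 2 * (n + 2))
    rw [ha] at this
    nlinarith
  obtain ⟨b, hb⟩ : ∃ b, b = a ^ (n + 2) := ⟨_, rfl⟩
  have hb0 : 0 < b := by rw [hb]; positivity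
  have hb2 : b ^ 2 = P * Q := by rw [hb, ← pow_mul, ← ha]; congr 1; ring
  have hbP : P ≤ b := by nlinarith
  have hbQ : b ≤ Q := by nlinarith
  have hb1 : b < 1 := hbQ.trans_lt hQ
  have hP1 : P < 1 := hPQ.trans_lt hQ
  have hPP : P ^ 2 < b := by nlinarith
  obtain ⟨K, hK⟩ : ∃ K, K = (∑ j : Fin (n + 1), ((j : ℕ) + 1)) := ⟨_, rfl⟩
  have hK0 : 0 < K := by
    rw [hK]; exact Finset.sum_pos (fun j _ => Nat.succ_pos _) ⟨0, Finset.mem_univ _⟩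
  -- eventual conditions
  have ev : ∀ {f g : ℝ → ℝ}, ContinuousAt f 1 → ContinuousAt g 1 → f 1 < g 1 → ∀ᶠ r in 𝓝[>] (1 : ℝ), f r < g r :=
    fun hf hg h => (hf.eventually_lt hg h).filter_mono nhdsWithin_le_nhds
  have e1 : ∀ᶠ r in 𝓝[>] (1 : ℝ), ∀ j : Fin (n + 1), a * r ^ ((j : ℕ) + 1) < 1 :=
    eventually_all.mpr fun j => ev (by fun_prop) (by fun_prop) (by simpa using ha1)
  have e2 : ∀ᶠ r in 𝓝[>] (1 : ℝ), a * r < 1 := ev (by fun_prop) (by fun_prop) (by simpa using ha1)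
  have e3 : ∀ᶠ r in 𝓝[>] (1 : ℝ), b * r ^ (n + 2) < 1 := ev (by fun_prop) (by fun_prop) (by simpa using hb1)
  have e4 : ∀ᶠ r in 𝓝[>] (1 : ℝ), P ^ 2 * r ^ (n + 2) < b := ev (by fun_prop) (by fun_prop) (by simpa using hPP)
  have e5 : ∀ᶠ r in 𝓝[>] (1 : ℝ), P < b → P * r ^ (n + 2) < b := by
    by_cases h : P < b
    · filter_upwards [ev (f := fun r => P * r ^ (n + 2)) (g := fun _ => b) (by fun_prop) (by fun_prop) (by simpa using h)] with r hr _ using hr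
    · exact Eventually.of_forall fun r h' => absurd h' h
  have hba : b * a < Q := by nlinarith
  have e6 : ∀ᶠ r in 𝓝[>] (1 : ℝ), ∀ j : Fin (n + 1), b * r ^ (n + 2) * (a * r ^ ((j : ℕ) + 1)) < Q :=
    eventually_all.mpr fun j => ev (by fun_prop) (by fun_prop) (by simpa using hba)
  have e7 : ∀ᶠ r in 𝓝[>] (1 : ℝ), ∀ i j : Fin (n + 1), Q * r ^ ((i : ℕ) + 1) < r ^ ((j : ℕ) + 1) :=
    eventually_all.mpr fun i => eventually_all.mpr fun j => ev (by fun_prop) (by fun_prop) (by simpa using hQ)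
  have e8 : ∀ᶠ r in 𝓝[>] (1 : ℝ), ∀ j : Fin (n + 1), Q * r ^ ((j : ℕ) + 1) * r ^ (K + (n + 2)) < 1 :=
    eventually_all.mpr fun j => ev (by fun_prop) (by fun_prop) (by simpa using hQ)
  have e9 : ∀ᶠ r in 𝓝[>] (1 : ℝ), Q * r ^ K < 1 := ev (by fun_prop) (by fun_prop) (by simpa using hQ)
  have e10 : ∀ᶠ r in 𝓝[>] (1 : ℝ), ∀ j : Fin (n + 1), Q * r ^ ((j : ℕ) + 1) < 1 :=
    eventually_all.mpr fun j => ev (by fun_prop) (by fun_prop) (by simpa using hQ)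
  have e11 : ∀ᶠ r in 𝓝[>] (1 : ℝ), b * (a * r) < Q := ev (by fun_prop) (by fun_prop) (by simpa using hba)
  have e0 : ∀ᶠ r in 𝓝[>] (1 : ℝ), 1 < r := eventually_mem_nhdsWithin
  obtain ⟨r, hr, e1, e2, e3, e4, e5, e6, e7, e8, e9, e10, e11⟩ :=
    (e0.and (e1.and (e2.and (e3.and (e4.and (e5.and (e6.and (e7.and (e8.and (e9.and (e10.and e11))))))))))).exists
  have hr0 : 0 < r := by linarith
  have hS := tsig_prod (n := n) (a := a) hr0.ne'
  rw [← hb] at hS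
  have hT : ∏ m : Fin (n + 2), (fun _ => a * r : Fin (n + 2) → ℝ) m = b * r ^ (n + 2) := by
    simp [mul_pow, hb]
  have s0 : tsig n a r 0 = a * (r ^ (K + (n + 2)))⁻¹ := by rw [hK]; rfl
  have sj : ∀ j : Fin (n + 1), tsig n a r j.succ = a * r ^ ((j : ℕ) + 1) := fun j => rfl
  have rp : ∀ k, 0 < k → 1 < r ^ k := fun k hk => one_lt_pow₀ hr hk.ne'
  have rpi : ∀ k, 0 < k → (r ^ k)⁻¹ < 1 := fun k hk => inv_lt_one_of_one_lt₀ (rp k hk)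
  have rpp : ∀ k, 0 < r ^ k := fun k => pow_pos hr0 k
  have hs00 : a * (r ^ (K + (n + 2)))⁻¹ < a := by
    have := rpi (K + (n + 2)) (by omega)
    nlinarith
  have hba1 : b = a ^ (n + 1) * a := by rw [hb, pow_succ]
  have hU : (b * (r ^ (n + 2))⁻¹) / (a * (r ^ (K + (n + 2)))⁻¹) = a ^ (n + 1) * r ^ K := by
    rw [hba1, pow_add r K]
    have := rpp K
    field_simp
  have hUj : ∀ j : Fin (n + 1), (b * (r ^ (n + 2))⁻¹) / (a * r ^ ((j : ℕ) + 1)) = a ^ (n + 1) * (r ^ (n + 2) * r ^ ((j : ℕ) + 1))⁻¹ := by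
    intro j
    rw [hba1]
    field_simp
  have hbr : b * (r ^ (n + 2))⁻¹ < b := by
    have := rpi (n + 2) (by omega)
    nlinarith
  have hbr0 : 0 < b * (r ^ (n + 2))⁻¹ := by positivity
  have hbr2 : b < b * r ^ (n + 2) := by
    have := rp (n + 2) (by omega)
    nlinarith
  refine ⟨tsig n a r, fun _ => a * r, a⁻¹, (a ^ (n + 1))⁻¹, ?_, ?_⟩
  · constructor
    · intro m; refine Fin.cases ?_ (fun j => ?_) m
      · rw [s0]; positivity
      · rw [sj]; positivity
    · intro m; positivity
    · intro m; refine Fin.cases ?_ (fun j => ?_) m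
      · rw [s0]; linarith
      · exact e1 j
    · intro m; exact e2
    · rw [hT]; linarith
    · rw [hT]; exact e3
    · rw [hT]; exact ne_of_gt (by linarith)
    · rw [hS, ← div_eq_mul_inv, lt_div_iff₀ (rpp _)]; exact e4
    · rw [hS]; linarith
    · rw [hS]
      rcases hbP.lt_or_eq with h | h
      · apply ne_of_gt
        rw [← div_eq_mul_inv, lt_div_iff₀ (rpp _)]; exact e5 h
      · rw [h]; exact hbr.ne
    · intro m; rw [hT]; refine Fin.cases ?_ (fun j => ?_) m
      · have h0 := e6 0
        rw [s0]
        refine lt_of_lt_of_le ?_ h0.le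
        have : 1 < r ^ (((0 : Fin (n + 1)) : ℕ) + 1) := rp _ (by omega)
        have h3 : 0 < b * r ^ (n + 2) := by positivity
        exact mul_lt_mul_of_pos_left (by nlinarith) h3
      · exact e6 j
    · intro m; rw [hS]
      refine lt_trans ?_ e11
      exact mul_lt_mul_of_pos_right hbr (by positivity)
    · intro i j hij
      simp only [sj] at hij
      have h1 := mul_left_cancel₀ ha0.ne' hij
      have h2 := pow_right_injective₀ hr0 hr.ne' h1
      exact Fin.ext (by omega)
    · intro i j
      rw [sj, sj]
      have h1 := e7 i j
      have h2 : P * r ^ ((i : ℕ) + 1) ≤ Q * r ^ ((i : ℕ) + 1) := mul_le_mul_of_nonneg_right hPQ (rpp _).le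
      have h3 := mul_lt_mul_of_pos_left (h2.trans_lt h1) ha0
      linarith
    · intro i j
      rw [sj, sj]
      have h3 := mul_lt_mul_of_pos_left (e7 i j) ha0
      linarith
    · intro j
      rw [s0, sj]
      have := rp ((j : ℕ) + 1) (by omega)
      nlinarith
    · intro j
      rw [s0, sj, ← div_eq_mul_inv, lt_div_iff₀ (rpp _)]
      have h3 := mul_lt_mul_of_pos_left (e8 j) ha0
      linarith
    · exact (one_lt_inv₀ ha0).mpr ha1
    · intro j
      rw [sj, inv_mul_cancel_left₀ ha0.ne']
      exact rp _ (by omega)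
    · rw [s0, mul_comm a, mul_assoc, mul_inv_cancel₀ ha0.ne', mul_one]
      exact rpi _ (by omega)
    · intro j
      rw [sj]
      have h : P * (a * r ^ ((j : ℕ) + 1)) * a⁻¹ = P * r ^ ((j : ℕ) + 1) := by field_simp
      rw [h]
      exact lt_of_le_of_lt (mul_le_mul_of_nonneg_right hPQ (rpp _).le) (e10 j)
    · intro j
      rw [sj]
      have h : Q * (a * r ^ ((j : ℕ) + 1)) * a⁻¹ = Q * r ^ ((j : ℕ) + 1) := by field_simp
      rw [h]
      exact e10 j
    · exact (one_lt_inv₀ (by positivity)).mpr (pow_lt_one₀ ha0.le ha1 (by omega))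
    · rw [hS, s0, hU, inv_mul_cancel_left₀ (by positivity)]
      exact rp K hK0
    · intro j
      rw [hS, sj, hUj, mul_comm (a ^ (n + 1)), mul_assoc, mul_inv_cancel₀ (by positivity), mul_one, ← pow_add]
      exact rpi _ (by omega)
    · rw [hS, s0, hU]
      have h : P * (a ^ (n + 1) * r ^ K) * (a ^ (n + 1))⁻¹ = P * r ^ K := by field_simp
      rw [h]
      exact lt_of_le_of_lt (mul_le_mul_of_nonneg_right hPQ (rpp _).le) e9
    · rw [hS, s0, hU]
      have h : Q * (a ^ (n + 1) * r ^ K) * (a ^ (n + 1))⁻¹ = Q * r ^ K := by field_simp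
      rw [h]
      exact e9
  · rw [hS, hT]
    have := rpp (n + 2)
    field_simp
    exact hb2

section
variable {p q : ℂ} [hp : Nome p] [hq : Nome q]
variable {n : ℕ} {s t : Fin (n + 2) → ℂ}

lemma reg_eval {σ θ : Fin (n + 2) → ℝ} {ρ τ : ℝ} (h : Reg ‖p‖ ‖q‖ σ θ ρ τ)
    (hσ : ∀ m, ‖s m‖ = σ m) (hθ : ∀ m, ‖t m‖ = θ m) (hbal : (∏ m, s m) * ∏ m, t m = p * q) :
    jj (n := n) p q s t 0 = ((n + 1).factorial : ℂ) * Gs p q 1 ^ n * (RW p q s t 1 * ∏ k, ∏ m, ellGamma (s k * t m) p q) := by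
  have hσ' : σ = fun m => ‖s m‖ := funext fun m => (hσ m).symm
  have hθ' : θ = fun m => ‖t m‖ := funext fun m => (hθ m).symm
  subst hσ' hθ'
  have n1 : ‖∏ m, s m‖ = ∏ m, ‖s m‖ := norm_prod _ _
  have n2 : ‖∏ m, t m‖ = ∏ m, ‖t m‖ := norm_prod _ _
  refine region_eval (ρ := ρ) (τ := τ) (fun m => norm_pos_iff.mp (h.hs0 m)) (fun m => norm_pos_iff.mp (h.ht0 m)) h.hs h.ht hbal
    (by rw [n2]; exact h.hT1) (by rw [n2]; exact h.hT2) (by rw [n2]; exact h.hT3)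
    (by rw [n1]; exact h.hS1) (by rw [n1]; exact h.hS2) (by rw [n1]; exact h.hS3)
    (fun m => by rw [norm_mul, n2]; exact h.hTs m) (fun m => by rw [norm_mul, n1]; exact h.hSt m)
    (fun i j hij => h.huinj (congrArg norm hij)) h.hup h.huq h.hsu h.hqs h.hρ1 h.hρu h.hρs h.hρp h.hρq
    h.hτ1 (by rw [norm_div, n1]; exact h.hτu) (fun j => by rw [norm_div, n1]; exact h.hτs j)
    (by rw [norm_div, n1]; exact h.hτp) (by rw [norm_div, n1]; exact h.hτq)
end

open MeasureTheory Filter Topology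
set_option linter.unusedSectionVars false
set_option linter.unusedVariables false

section
variable {p q : ℂ} [hp : Nome p] [hq : Nome q]
variable {n : ℕ} {s t : Fin (n + 2) → ℂ}

lemma line_norm {c : ℂ} (hc : c ≠ 0) (w : ℂ) (v : ℝ) :
    ‖c * Complex.exp (w * v)‖ = Real.exp (Real.log ‖c‖ + w.re * v) := by
  rw [norm_mul, Complex.norm_exp, Real.exp_add, Real.exp_log (norm_pos_iff.mpr hc)]
  simp

lemma line_norm_lt {c : ℂ} (hc : c ≠ 0) (w : ℂ) (v : ℝ) :
    ‖c * Complex.exp (w * v)‖ < 1 ↔ Real.log ‖c‖ + w.re * v < 0 := by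
  rw [line_norm hc, Real.exp_lt_one_iff]

theorem full_eval (hPQ : ‖p‖ ≤ ‖q‖) (hs0 : ∀ m, s m ≠ 0) (ht0 : ∀ m, t m ≠ 0)
    (hs : ∀ m, ‖s m‖ < 1) (ht : ∀ m, ‖t m‖ < 1) (hbal : (∏ m, s m) * ∏ m, t m = p * q) :
    jj (n := n) p q s t 0 = ((n + 1).factorial : ℂ) * Gs p q 1 ^ n * (RW p q s t 1 * ∏ k, ∏ m, ellGamma (s k * t m) p q) := by
  obtain ⟨σ, θ, ρ, τ, hreg, hprod⟩ := exists_reg n (norm_pos_iff.mpr hp.ne) hPQ hq.lt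
  obtain ⟨v, hv⟩ : ∃ v : Fin (n + 2) → ℝ, ∀ m, v m = Real.log (σ m) - Real.log ‖s m‖ := ⟨_, fun _ => rfl⟩
  obtain ⟨u, hu⟩ : ∃ u : Fin (n + 2) → ℝ, ∀ m, u m = Real.log (θ m) - Real.log ‖t m‖ := ⟨_, fun _ => rfl⟩
  have hsum : ∑ m, v m + ∑ m, u m = 0 := by
    simp only [hv, hu, Finset.sum_sub_distrib]
    rw [← Real.log_prod (fun m _ => (hreg.hs0 m).ne'), ← Real.log_prod (fun m _ => (hreg.ht0 m).ne'),
      ← Real.log_prod (fun m _ => norm_ne_zero_iff.mpr (hs0 m)), ← Real.log_prod (fun m _ => norm_ne_zero_iff.mpr (ht0 m))]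
    have h1 := congrArg Real.log hprod
    have h2 := congrArg (fun z => Real.log ‖z‖) hbal
    simp only [norm_mul, norm_prod] at h2
    rw [Real.log_mul (Finset.prod_pos fun m _ => hreg.hs0 m).ne' (Finset.prod_pos fun m _ => hreg.ht0 m).ne'] at h1
    rw [Real.log_mul (Finset.prod_pos fun m _ => norm_pos_iff.mpr (hs0 m)).ne'
      (Finset.prod_pos fun m _ => norm_pos_iff.mpr (ht0 m)).ne'] at h2
    linarith
  obtain ⟨S, hS⟩ : ∃ S : ℂ → Fin (n + 2) → ℂ, S = fun w m => s m * Complex.exp (w * v m) := ⟨_, rfl⟩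
  obtain ⟨T, hT⟩ : ∃ T : ℂ → Fin (n + 2) → ℂ, T = fun w m => t m * Complex.exp (w * u m) := ⟨_, rfl⟩
  have hb : ∀ w, (∏ m, S w m) * ∏ m, T w m = p * q := by
    intro w
    simp only [hS, hT, Finset.prod_mul_distrib, ← Complex.exp_sum, ← Finset.mul_sum]
    have : Complex.exp (w * ∑ m, (v m : ℂ)) * Complex.exp (w * ∑ m, (u m : ℂ)) = 1 := by
      rw [← Complex.exp_add, ← mul_add]
      have h : (∑ m, (v m : ℂ)) + ∑ m, (u m : ℂ) = 0 := by exact_mod_cast hsum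
      rw [h, mul_zero, Complex.exp_zero]
    rw [← hbal]
    linear_combination (∏ m, s m) * (∏ m, t m) * this
  have hSn : ∀ w m, S w m ≠ 0 := fun w m => by rw [hS]; exact mul_ne_zero (hs0 m) (Complex.exp_ne_zero _)
  have hTn : ∀ w m, T w m ≠ 0 := fun w m => by rw [hT]; exact mul_ne_zero (ht0 m) (Complex.exp_ne_zero _)
  have hSd : ∀ m w, DifferentiableAt ℂ (fun w => S w m) w := fun m w => by rw [hS]; fun_prop
  have hTd : ∀ m w, DifferentiableAt ℂ (fun w => T w m) w := fun m w => by rw [hT]; fun_prop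
  obtain ⟨U, hUd⟩ : ∃ U : Set ℂ, U = {w | (∀ m, ‖S w m‖ < 1) ∧ ∀ m, ‖T w m‖ < 1} := ⟨_, rfl⟩
  have hUo : IsOpen U := by
    have : U = (⋂ m, {w | ‖S w m‖ < 1}) ∩ ⋂ m, {w | ‖T w m‖ < 1} := by
      rw [hUd]; ext w; simp
    rw [this]
    refine IsOpen.inter (isOpen_iInter_of_finite fun m => isOpen_lt ?_ continuous_const)
      (isOpen_iInter_of_finite fun m => isOpen_lt ?_ continuous_const)
    · exact (continuous_iff_continuousAt.mpr fun w => (hSd m w).continuousAt).norm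
    · exact (continuous_iff_continuousAt.mpr fun w => (hTd m w).continuousAt).norm
  have hcv : Convex ℝ U := by
    intro x hx y hy a b ha hb' hab
    rw [hUd] at hx hy ⊢
    have key : ∀ c d : ℝ, c + x.re * d < 0 → c + y.re * d < 0 → c + (a • x + b • y).re * d < 0 := by
      intro c d h1 h2
      have h3 : c + (a • x + b • y).re * d = a * (c + x.re * d) + b * (c + y.re * d) := by
        simp only [Complex.add_re, Complex.real_smul, Complex.re_ofReal_mul]
        linear_combination (-c) * hab
      rw [h3]
      rcases ha.eq_or_lt with h | h
      · have : b = 1 := by linarith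
        rw [← h, this]; linarith
      · have := mul_neg_of_pos_of_neg h h1
        have := mul_nonpos_of_nonneg_of_nonpos hb' h2.le
        linarith
    refine ⟨fun m => ?_, fun m => ?_⟩
    · have h1 := hx.1 m
      have h2 := hy.1 m
      simp only [hS] at h1 h2 ⊢
      rw [line_norm_lt (hs0 m)] at h1 h2 ⊢
      exact key _ _ h1 h2
    · have h1 := hx.2 m
      have h2 := hy.2 m
      simp only [hT] at h1 h2 ⊢
      rw [line_norm_lt (ht0 m)] at h1 h2 ⊢
      exact key _ _ h1 h2
  have hS1 : ∀ w : ℂ, w.re = 1 → ∀ m, ‖S w m‖ = σ m := by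
    intro w hw m
    simp only [hS]
    rw [line_norm (hs0 m), hw, hv]
    have : Real.log ‖s m‖ + 1 * (Real.log (σ m) - Real.log ‖s m‖) = Real.log (σ m) := by ring
    rw [this, Real.exp_log (hreg.hs0 m)]
  have hT1 : ∀ w : ℂ, w.re = 1 → ∀ m, ‖T w m‖ = θ m := by
    intro w hw m
    simp only [hT]
    rw [line_norm (ht0 m), hw, hu]
    have : Real.log ‖t m‖ + 1 * (Real.log (θ m) - Real.log ‖t m‖) = Real.log (θ m) := by ring
    rw [this, Real.exp_log (hreg.ht0 m)]
  have hS00 : S 0 = s := by rw [hS]; ext m; simp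
  have hT00 : T 0 = t := by rw [hT]; ext m; simp
  have h0U : (0 : ℂ) ∈ U := by
    rw [hUd]; exact ⟨fun m => by rw [hS00]; exact hs m, fun m => by rw [hT00]; exact ht m⟩
  have h1U : (1 : ℂ) ∈ U := by
    rw [hUd]; exact ⟨fun m => by rw [hS1 1 (by simp)]; exact hreg.hs m, fun m => by rw [hT1 1 (by simp)]; exact hreg.ht m⟩
  have hUS : ∀ w ∈ U, ∀ m, ‖S w m‖ < 1 := fun w hw => by rw [hUd] at hw; exact hw.1
  have hUT : ∀ w ∈ U, ∀ m, ‖T w m‖ < 1 := fun w hw => by rw [hUd] at hw; exact hw.2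
  have hA : DifferentiableOn ℂ (fun w => ∫ x : Tor n, Del p q (S w) (T w) (eT (slc 0 x))) U :=
    jj_param_diff hUo (fun m w _ => hSd m w) (fun m w _ => hTd m w) (fun w _ => hSn w) (fun w _ => hTn w) hUS hUT
  have hB : DifferentiableOn ℂ (fun w => (((n + 1).factorial : ℂ) * Gs p q 1 ^ n) *
      (RW p q (S w) (T w) 1 * ∏ k, ∏ m, ellGamma (S w k * T w m) p q)) U :=
    rhs_param_diff (fun m w _ => hSd m w) (fun m w _ => hTd m w) (fun w _ => hSn w) (fun w _ => hTn w) hUS hUT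
      (fun w hw m => div_norm_lt (hSn w) (hUS w hw) m) (fun w hw m => div_norm_lt (hTn w) (hUT w hw) m)
  have hfreq : ∃ᶠ w in 𝓝[≠] (1 : ℂ), (∫ x : Tor n, Del p q (S w) (T w) (eT (slc 0 x))) =
      (((n + 1).factorial : ℂ) * Gs p q 1 ^ n) * (RW p q (S w) (T w) 1 * ∏ k, ∏ m, ellGamma (S w k * T w m) p q) := by
    have hseq : Tendsto (fun k : ℕ => (1 : ℂ) + (((1 / ((k : ℝ) + 1) : ℝ)) : ℂ) * Complex.I) atTop (𝓝[≠] 1) := by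
      refine tendsto_nhdsWithin_iff.mpr ⟨?_, Eventually.of_forall fun k => ?_⟩
      · have h1 := (Complex.continuous_ofReal.tendsto 0).comp (tendsto_one_div_add_atTop_nhds_zero_nat (𝕜 := ℝ))
        simpa [Function.comp_def] using (h1.mul_const Complex.I).const_add 1
      · have h1 : (1 / ((k : ℝ) + 1) : ℝ) ≠ 0 := by positivity
        have h2 : (((1 / ((k : ℝ) + 1) : ℝ)) : ℂ) ≠ 0 := by exact_mod_cast h1
        simpa only [Set.mem_compl_iff, Set.mem_singleton_iff, add_eq_left] using mul_ne_zero h2 Complex.I_ne_zero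
    refine hseq.frequently (Frequently.of_forall fun k => ?_)
    have hre : ((1 : ℂ) + (((1 / ((k : ℝ) + 1) : ℝ)) : ℂ) * Complex.I).re = 1 := by
      rw [Complex.add_re, Complex.re_ofReal_mul]; simp
    exact reg_eval hreg (hS1 _ hre) (hT1 _ hre) (hb _)
  have hfin := (hA.analyticOnNhd hUo).eqOn_of_preconnected_of_frequently_eq (hB.analyticOnNhd hUo)
    hcv.isPreconnected h1U hfreq h0U
  simp only [hS00, hT00] at hfin
  exact hfin
end

open MeasureTheory Filter Topology
set_option linter.unusedSectionVars false
set_option linter.unusedVariables false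

section
variable {p q : ℂ} [hp : Nome p] [hq : Nome q]

lemma zfull_eT {n : ℕ} (x : Tor n) : zfull (n + 1) (eT x) = eT (slc 0 x) := by
  ext i
  refine Fin.lastCases ?_ (fun j => ?_) i
  · have h : ¬ ((Fin.last n : Fin (n + 1)) : ℕ) < n + 1 - 1 := by simp
    rw [zfull, dif_neg h]
    simp only [eT, slc, Fin.snoc_last, zero_sub, ee_neg, ee_sum]
    rfl
  · have h : ((j.castSucc : Fin (n + 1)) : ℕ) < n + 1 - 1 := by simp
    rw [zfull, dif_pos h]
    simp only [eT, slc, Fin.snoc_castSucc]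
    rfl

lemma integrand_eq {N M : ℕ} (s t : Fin M → ℂ) (z : Fin N → ℂ) (hz : ∀ i, ‖z i‖ = 1) :
    (∏ j : Fin N, ∏ m : Fin M, ellGamma (s m * z j) p q * ellGamma (t m * (z j)⁻¹) p q) /
        ∏ ij ∈ Finset.univ.filter (fun ij : Fin N × Fin N => ij.1 < ij.2),
            ellGamma (z ij.1 * (z ij.2)⁻¹) p q * ellGamma ((z ij.1)⁻¹ * z ij.2) p q = Del p q s t z := by
  rw [Del, div_eq_mul_inv]
  congr 1
  rw [VV, Finset.prod_filter, ← Finset.univ_product_univ, Finset.prod_product, ← Finset.prod_inv_distrib]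
  refine Finset.prod_congr rfl fun i _ => ?_
  rw [← Finset.prod_filter, ← Finset.prod_inv_distrib]
  refine Finset.prod_congr (by ext j; simp) fun j _ => ?_
  rw [vv, ← v_eq (by rw [norm_div, hz, hz, div_one]), inv_div, div_eq_mul_inv, div_eq_mul_inv, mul_comm (z j)]

lemma main_le (n : ℕ) (s t : Fin (n + 2) → ℂ) (hPQ : ‖p‖ ≤ ‖q‖)
    (hs0 : ∀ m, s m ≠ 0) (hs1 : ∀ m, ‖s m‖ < 1)
    (ht0 : ∀ m, t m ≠ 0) (ht1 : ∀ m, ‖t m‖ < 1)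
    (hbal : (∏ m, s m) * ∏ m, t m = p * q) :
    pochInf p p ^ n * pochInf q q ^ n / ((n + 1).factorial : ℂ) *
      torusInt n (fun z =>
        (∏ j : Fin (n + 1), ∏ m : Fin (n + 2),
            ellGamma (s m * zfull (n + 1) z j) p q * ellGamma (t m * (zfull (n + 1) z j)⁻¹) p q) /
        ∏ ij ∈ Finset.univ.filter (fun ij : Fin (n + 1) × Fin (n + 1) => ij.1 < ij.2),
            ellGamma (zfull (n + 1) z ij.1 * (zfull (n + 1) z ij.2)⁻¹) p q *
              ellGamma ((zfull (n + 1) z ij.1)⁻¹ * zfull (n + 1) z ij.2) p q) =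
    (∏ m, ellGamma ((∏ i, s i) * (s m)⁻¹) p q * ellGamma ((∏ i, t i) * (t m)⁻¹) p q) *
      ∏ k : Fin (n + 2), ∏ m : Fin (n + 2), ellGamma (s k * t m) p q := by
  have hI : ∀ x : Tor n, (∏ j : Fin (n + 1), ∏ m : Fin (n + 2),
            ellGamma (s m * zfull (n + 1) (eT x) j) p q * ellGamma (t m * (zfull (n + 1) (eT x) j)⁻¹) p q) /
        ∏ ij ∈ Finset.univ.filter (fun ij : Fin (n + 1) × Fin (n + 1) => ij.1 < ij.2),
            ellGamma (zfull (n + 1) (eT x) ij.1 * (zfull (n + 1) (eT x) ij.2)⁻¹) p q *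
              ellGamma ((zfull (n + 1) (eT x) ij.1)⁻¹ * zfull (n + 1) (eT x) ij.2) p q = Del p q s t (eT (slc 0 x)) := by
    intro x
    rw [zfull_eT]
    exact integrand_eq s t _ (eT_norm _)
  have hcs : Continuous fun x : Tor n => slc 0 x :=
    slc_cont.comp (by fun_prop : Continuous fun x : Tor n => ((0 : UnitAddCircle), x))
  have hcont : Continuous fun x : Tor n => Del p q s t (eT (slc 0 x)) :=
    (Del_cont hs0 ht0 hs1 ht1).comp hcs
  rw [torusInt_eq n _ (by simp only [hI]; exact hcont)]
  simp only [hI]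
  have h := full_eval (n := n) hPQ hs0 ht0 hs1 ht1 hbal
  rw [jj] at h
  rw [h, Gs_one, RW]
  simp only [mul_one, div_one]
  have h1 : pochInf p p ≠ 0 := pochInf_ne hp.lt
  have h2 : pochInf q q ≠ 0 := pochInf_ne hq.lt
  have h3 : ((n + 1).factorial : ℂ) ≠ 0 := by exact_mod_cast (Nat.factorial_pos _).ne'
  simp only [div_eq_mul_inv (∏ i, s i), div_eq_mul_inv (∏ i, t i)]
  rw [inv_pow, mul_pow]
  field_simp
end

theorem AN_elliptic_beta_integral (N : ℕ) (hN : 2 ≤ N) (p q : ℂ)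
    (hp0 : 0 < ‖p‖) (hp1 : ‖p‖ < 1)
    (hq0 : 0 < ‖q‖) (hq1 : ‖q‖ < 1)
    (s t : Fin (N + 1) → ℂ)
    (hs0 : ∀ m, 0 < ‖s m‖) (hs1 : ∀ m, ‖s m‖ < 1)
    (ht0 : ∀ m, 0 < ‖t m‖) (ht1 : ∀ m, ‖t m‖ < 1)
    (hbal : (∏ m, s m) * ∏ m, t m = p * q) :
    pochInf p p ^ (N - 1) * pochInf q q ^ (N - 1) / (N.factorial : ℂ) *
      torusInt (N - 1) (fun z =>
        (∏ j : Fin N, ∏ m : Fin (N + 1),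
            ellGamma (s m * zfull N z j) p q * ellGamma (t m * (zfull N z j)⁻¹) p q) /
        ∏ ij ∈ Finset.univ.filter (fun ij : Fin N × Fin N => ij.1 < ij.2),
            ellGamma (zfull N z ij.1 * (zfull N z ij.2)⁻¹) p q *
              ellGamma ((zfull N z ij.1)⁻¹ * zfull N z ij.2) p q) =
    (∏ m, ellGamma ((∏ i, s i) * (s m)⁻¹) p q * ellGamma ((∏ i, t i) * (t m)⁻¹) p q) *
      ∏ k : Fin (N + 1), ∏ m : Fin (N + 1), ellGamma (s k * t m) p q := by
  obtain ⟨n, rfl⟩ : ∃ n, N = n + 1 := ⟨N - 1, by omega⟩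
  haveI : Nome p := ⟨norm_pos_iff.mp hp0, hp1⟩
  haveI : Nome q := ⟨norm_pos_iff.mp hq0, hq1⟩
  have hs0' : ∀ m, s m ≠ 0 := fun m => norm_pos_iff.mp (hs0 m)
  have ht0' : ∀ m, t m ≠ 0 := fun m => norm_pos_iff.mp (ht0 m)
  rcases le_total ‖p‖ ‖q‖ with h | h
  · exact main_le n s t h hs0' hs1 ht0' ht1 hbal
  · have hsym : ∀ x, ellGamma x p q = ellGamma x q p := fun x => ellGamma_symm x
    simp only [hsym]
    rw [mul_comm (pochInf p p ^ (n + 1 - 1))]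
    exact main_le n s t h hs0' hs1 ht0' ht1 (by rw [hbal, mul_comm])
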